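/- arXiv:2007.05744 — 2 statements merged into one kernel-verified Lean document; each statement's English description precedes it below -/
import Mathlib

section
/- Assume K is infinite, M has maximal depth with respect to Q, and grade(Q, M) > 0. Then the local cohomology module H^{grade(Q, M)}_Q(M) is not finitely generated. -/
open CategoryTheory MvPolynomial

noncomputable section

/-- The standard bigraded polynomial ring `S = K[x_1,…,x_m, y_1,…,y_n]`. -/
abbrev BGS (K : Type) [Field K] (m n : ℕ) : Type := MvPolynomial (Fin m ⊕ Fin n) K

/-- The bigrading weights: `deg x_i = (1,0)`, `deg y_j = (0,1)`. -/
def bwt (m n : ℕ) : Fin m ⊕ Fin n → ℕ × ℕ := Sum.elim (fun _ => (1, 0)) (fun _ => (0, 1))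

/-- `P = (x_1, …, x_m)`. -/
def idealP (K : Type) [Field K] (m n : ℕ) : Ideal (BGS K m n) :=
  Ideal.span (Set.range fun i : Fin m => (X (Sum.inl i) : BGS K m n))

/-- `Q = (y_1, …, y_n)`. -/
def idealQ (K : Type) [Field K] (m n : ℕ) : Ideal (BGS K m n) :=
  Ideal.span (Set.range fun j : Fin n => (X (Sum.inr j) : BGS K m n))

/-- `cd(J, M)`: the cohomological dimension, i.e. the largest `i` such that the local
cohomology module `H^i_J(M)` is nonzero. -/
def cohDim (R : Type) [CommRing R] (J : Ideal R) (M : Type) [AddCommGroup M] [Module R M] : ℕ :=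
  sSup {i : ℕ | Nontrivial ((localCohomology J i).obj (ModuleCat.of R M))}

/-- `grade(J, M)`: the least `i` with `Ext^i(R/J, M) ≠ 0`. -/
def extGrade (R : Type) [CommRing R] (J : Ideal R) (M : Type) [AddCommGroup M] [Module R M] : ℕ :=
  sInf {i : ℕ | Nontrivial
    (((Ext R (ModuleCat R) i).obj (Opposite.op (ModuleCat.of R (R ⧸ J)))).obj (ModuleCat.of R M))}

/-- `mgrade(J, M) = min {cd(J, R/p) : p ∈ Ass(M)}`. -/
def mCohDim (R : Type) [CommRing R] (J : Ideal R) (M : Type) [AddCommGroup M] [Module R M] : ℕ :=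
  sInf ((fun p => cohDim R J (R ⧸ p)) '' associatedPrimes R M)

/-- `M` has maximal depth with respect to `J` if `grade(J, M) = mgrade(J, M)`. -/
def HasMaximalDepth (R : Type) [CommRing R] (J : Ideal R) (M : Type) [AddCommGroup M]
    [Module R M] : Prop :=
  extGrade R J M = mCohDim R J M

/-- A bigrading on an `S`-module `M`: an internal direct sum decomposition indexed by `ℕ × ℕ`
compatible with the bigrading of `S`. -/
structure IsBigrading (K : Type) [Field K] (m n : ℕ) (M : Type) [AddCommGroup M]
    [Module (BGS K m n) M] (ℳ : ℕ × ℕ → AddSubgroup M) : Prop where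
  internal : DirectSum.IsInternal ℳ
  smul_mem : ∀ (d e : ℕ × ℕ) (s : BGS K m n) (x : M),
    IsWeightedHomogeneous (bwt m n) s d → x ∈ ℳ e → s • x ∈ ℳ (d + e)

/-- A submodule is bigraded if it is generated by bihomogeneous elements. -/
def IsBigradedSubmodule (K : Type) [Field K] (m n : ℕ) {M : Type} [AddCommGroup M]
    [Module (BGS K m n) M] (ℳ : ℕ × ℕ → AddSubgroup M) (N : Submodule (BGS K m n) M) : Prop :=
  N = Submodule.span (BGS K m n) {x : M | x ∈ N ∧ ∃ d, x ∈ ℳ d}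

section
open Opposite

namespace Bridge
universe u
variable {R : Type u} [CommRing R]

/-- precomposition cochain map -/
def pre {X X' : ModuleCat.{u} R} (P : ProjectiveResolution X) (P' : ProjectiveResolution X')
    (φ : P'.complex ⟶ P.complex) (Y : ModuleCat.{u} R) :
    P.complex.linearYonedaObj R Y ⟶ P'.complex.linearYonedaObj R Y :=
  (HomologicalComplex.unopFunctor _ _).map
    ((((linearYoneda R (ModuleCat.{u} R)).obj Y).rightOp.mapHomologicalComplex _).map φ).op

lemma pre_f {X X' : ModuleCat.{u} R} (P : ProjectiveResolution X) (P' : ProjectiveResolution X')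
    (φ : P'.complex ⟶ P.complex) (Y : ModuleCat.{u} R) (n : ℕ) (f : P.complex.X n ⟶ Y) :
    (pre P P' φ Y).f n f = φ.f n ≫ f := rfl

lemma key {C : Type*} [Category* C] {A B D E F G : C} (a : A ⟶ B) (b : B ⟶ D) (c : D ⟶ E)
    (d : B ⟶ F) (e : F ⟶ E) (h : A ⟶ G) (a' : G ⟶ F) (_ : Unit)
    (h1 : b ≫ c = d ≫ e) (h2 : h ≫ a' = a ≫ d) : (a ≫ b) ≫ c = h ≫ (a' ≫ e) := by
  rw [Category.assoc, h1, ← Category.assoc, ← h2, Category.assoc]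

lemma nat {X X' : ModuleCat.{u} R} (P : ProjectiveResolution X) (P' : ProjectiveResolution X')
    (g : X' ⟶ X)
    (φ : ProjectiveResolution.Hom P' P g) (Y : ModuleCat.{u} R) (n : ℕ) :
    (P.isoExt (R := R) n Y).inv ≫ ((Ext R (ModuleCat.{u} R) n).map g.op).app Y =
      HomologicalComplex.homologyMap (pre P P' φ.hom Y) n ≫ (P'.isoExt (R := R) n Y).inv := by
  have h1 := ProjectiveResolution.isoLeftDerivedObj_hom_naturality g P' P φ.hom
    (by simpa using φ.hom_f_zero_comp_π_f_zero) ((linearYoneda R (ModuleCat.{u} R)).obj Y).rightOp n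
  have h2 := HomologicalComplex.homologyOp_hom_naturality (pre P P' φ.hom Y) n
  have h1' := congrArg Quiver.Hom.unop h1
  have h2' := congrArg Quiver.Hom.unop h2
  exact key _ _ _ _ _ _ _ () h1' h2'.symm

variable {X : ModuleCat.{u} R} (P : ProjectiveResolution X) {Y : ModuleCat.{u} R} {n : ℕ}

def Rep (f : P.complex.X n ⟶ Y) (e : ((Ext R (ModuleCat.{u} R) n).obj (op X)).obj Y) : Prop :=
  ∃ z : (P.complex.linearYonedaObj R Y).cycles n,
    (P.complex.linearYonedaObj R Y).iCycles n z = f ∧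
    (P.isoExt (R := R) n Y).inv ((P.complex.linearYonedaObj R Y).homologyπ n z) = e

lemma rep_surj (e : ((Ext R (ModuleCat.{u} R) n).obj (op X)).obj Y) :
    ∃ f : P.complex.X n ⟶ Y, P.complex.d (n+1) n ≫ f = 0 ∧ Rep P f e := by
  have h1 : Function.Surjective ((P.complex.linearYonedaObj R Y).homologyπ n) :=
    (ModuleCat.epi_iff_surjective _).1 inferInstance
  obtain ⟨z, hz⟩ := h1 ((P.isoExt (R := R) n Y).hom e)
  refine ⟨(P.complex.linearYonedaObj R Y).iCycles n z, ?_, z, rfl, ?_⟩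
  · have := (P.complex.linearYonedaObj R Y).iCycles_d n (n+1)
    exact congrArg (fun h => h.hom z) this
  · rw [hz]; simp

lemma rep_nat {X' : ModuleCat.{u} R} {P} (P' : ProjectiveResolution X')
    {g : X' ⟶ X} (φ : ProjectiveResolution.Hom P' P g)
    {f : P.complex.X n ⟶ Y} {e : ((Ext R (ModuleCat.{u} R) n).obj (op X)).obj Y}
    (h : Rep P f e) : Rep P' (φ.hom.f n ≫ f) (((Ext R (ModuleCat.{u} R) n).map g.op).app Y e) := by
  obtain ⟨z, rfl, rfl⟩ := h
  refine ⟨HomologicalComplex.cyclesMap (pre P P' φ.hom Y) n z, ?_, ?_⟩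
  · have := HomologicalComplex.cyclesMap_i (pre P P' φ.hom Y) n
    exact congrArg (fun h => h.hom z) this
  · have h1 := nat P P' g φ Y n
    have h2 := HomologicalComplex.homologyπ_naturality (pre P P' φ.hom Y) n
    have h1' := congrArg (fun h => h.hom ((P.complex.linearYonedaObj R Y).homologyπ n z)) h1
    have h2' := congrArg (fun h => h.hom z) h2
    simp only [ModuleCat.hom_comp, LinearMap.comp_apply] at h1' h2'
    rw [h1']
    erw [h2']

lemma rep_smul (a : R)
    {f : P.complex.X n ⟶ Y} {e : ((Ext R (ModuleCat.{u} R) n).obj (op X)).obj Y}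
    (h : Rep P f e) : Rep P (a • f) (a • e) := by
  obtain ⟨z, rfl, rfl⟩ := h
  refine ⟨a • z, ?_, ?_⟩
  · exact map_smul ((P.complex.linearYonedaObj R Y).iCycles n).hom a z
  · rw [map_smul, map_smul]

lemma iCycles_inj (z z' : (P.complex.linearYonedaObj R Y).cycles n)
    (h : (P.complex.linearYonedaObj R Y).iCycles n z = (P.complex.linearYonedaObj R Y).iCycles n z') :
    z = z' := (ModuleCat.mono_iff_injective _).1 inferInstance h

lemma rep_of_zero {e : ((Ext R (ModuleCat.{u} R) n).obj (op X)).obj Y}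
    (h : Rep P 0 e) : e = 0 := by
  obtain ⟨z, hz, rfl⟩ := h
  have : z = 0 := iCycles_inj P _ _ (by rw [hz, map_zero]; rfl)
  rw [this]; simp

lemma rep_of_bdry {p : ℕ} (hp : p + 1 = n) (g : P.complex.X p ⟶ Y)
    {e : ((Ext R (ModuleCat.{u} R) n).obj (op X)).obj Y}
    (h : Rep P (P.complex.d n p ≫ g) e) : e = 0 := by
  obtain ⟨z, hz, rfl⟩ := h
  have : z = (P.complex.linearYonedaObj R Y).toCycles p n g := iCycles_inj P _ _ (by
    rw [hz]
    have := (P.complex.linearYonedaObj R Y).toCycles_i p n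
    exact (congrArg (fun h => h.hom g) this).symm)
  rw [this]
  have := (P.complex.linearYonedaObj R Y).toCycles_comp_homologyπ p n
  have h2 := congrArg (fun h => h.hom g) this
  simp only [ModuleCat.hom_comp, LinearMap.comp_apply] at h2
  erw [h2]; exact map_zero _

lemma rep_zero {f : P.complex.X n ⟶ Y} (h : Rep P f 0) :
    f = 0 ∨ ∃ (p : ℕ) (_ : p + 1 = n) (g : P.complex.X p ⟶ Y), P.complex.d n p ≫ g = f := by
  obtain ⟨z, hz, h0⟩ := h
  have h1 : (P.complex.linearYonedaObj R Y).homologyπ n z = 0 := by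
    have := congrArg (P.isoExt (R := R) n Y).hom h0
    simpa using this
  have ex : (ShortComplex.mk _ _ ((P.complex.linearYonedaObj R Y).toCycles_comp_homologyπ
      ((ComplexShape.up ℕ).prev n) n)).Exact :=
    ShortComplex.exact_of_g_is_cokernel _
      ((P.complex.linearYonedaObj R Y).homologyIsCokernel _ n rfl)
  rw [ShortComplex.moduleCat_exact_iff] at ex
  obtain ⟨w, hw⟩ := ex z h1
  have h3 := (P.complex.linearYonedaObj R Y).toCycles_i ((ComplexShape.up ℕ).prev n) n
  have h4 : (P.complex.linearYonedaObj R Y).d ((ComplexShape.up ℕ).prev n) n w = f := by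
    rw [← hz, ← hw]
    exact (congrArg (fun h => h.hom w) h3).symm
  cases n with
  | zero =>
    left
    rw [(P.complex.linearYonedaObj R Y).shape _ _ (by simp)] at h4
    exact h4.symm
  | succ p =>
    right
    have hpp : (ComplexShape.up ℕ).prev (p+1) = p := by simp
    generalize (ComplexShape.up ℕ).prev (p+1) = q at *
    subst hpp
    exact ⟨_, rfl, w, h4⟩

abbrev NExt (X Y : ModuleCat.{u} R) (n : ℕ) := Abelian.Ext.{u} X Y n

lemma rep_exists (f : P.complex.X n ⟶ Y) (hf : P.complex.d (n+1) n ≫ f = 0) :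
    ∃ e, Rep P f e := by
  have hk := (P.complex.linearYonedaObj R Y).cyclesIsKernel n (n+1) (by simp)
  have ex : (ShortComplex.mk _ _ ((P.complex.linearYonedaObj R Y).iCycles_d n (n+1))).Exact :=
    ShortComplex.exact_of_f_is_kernel _ hk
  rw [ShortComplex.moduleCat_exact_iff] at ex
  obtain ⟨z, hz⟩ := ex f hf
  exact ⟨_, z, hz, rfl⟩

end Bridge

end

section
open Opposite

namespace Bridge
variable {R : Type} [CommRing R]

abbrev trL (J : Ideal R) {t t' : ℕ} (h : t ≤ t') : (R ⧸ J ^ t') →ₗ[R] (R ⧸ J ^ t) :=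
  Submodule.mapQ _ _ LinearMap.id (Ideal.pow_le_pow_right h)

def tr (J : Ideal R) {t t' : ℕ} (h : t ≤ t') :
    ModuleCat.of R (R ⧸ J ^ t') ⟶ ModuleCat.of R (R ⧸ J ^ t) :=
  ModuleCat.ofHom (trL J h)

abbrev LC (J : Ideal R) (i : ℕ) (N : ModuleCat.{0} R) := (localCohomology J i).obj N

abbrev OE (J : Ideal R) (i t : ℕ) (N : ModuleCat.{0} R) :=
  ((Ext R (ModuleCat.{0} R) i).obj (op (ModuleCat.of R (R ⧸ J ^ t)))).obj N

def orestr (J : Ideal R) (i : ℕ) {t t' : ℕ} (h : t ≤ t') (N : ModuleCat.{0} R) :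
   OE J i t N ⟶ OE J i t' N := ((Ext R (ModuleCat.{0} R) i).map (tr J h).op).app N

open Limits in
lemma colim_facts (J : Ideal R) (i : ℕ) (N : ModuleCat.{0} R) :
    ∃ ι : ∀ t, OE J i t N ⟶ LC J i N,
      (∀ x : LC J i N, ∃ t e, ι t e = x) ∧
      (∀ t e, ι t e = 0 → ∃ t', ∃ h : t ≤ t', orestr J i h N e = 0) ∧
      (∀ {t t'} (h : t ≤ t') e, ι t' (orestr J i h N e) = ι t e) := by
  have := localCohomology.hasColimitDiagram.{0,0} (localCohomology.idealPowersDiagram J) i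
  let F := localCohomology.diagram (localCohomology.idealPowersDiagram J) i
  have hc : IsColimit (((evaluation _ _).obj N).mapCocone (colimit.cocone F)) :=
    isColimitOfPreserves ((evaluation _ _).obj N) (colimit.isColimit F)
  refine ⟨fun t => (((evaluation _ _).obj N).mapCocone (colimit.cocone F)).ι.app (op (op t)), ?_, ?_, ?_⟩
  · intro x
    obtain ⟨j, y, hy⟩ := Concrete.isColimit_exists_rep _ hc x
    exact ⟨j.unop.unop, y, hy⟩
  · intro t e he
    obtain ⟨k, f, g, hfg⟩ := Concrete.isColimit_exists_of_rep_eq (F ⋙ (evaluation _ _).obj N) hc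
      (i := op (op t)) (j := op (op t)) e 0 (by rw [map_zero]; exact he)
    rw [map_zero] at hfg
    exact ⟨k.unop.unop, f.unop.unop.down.down, hfg⟩
  · intro t t' h e
    have := (((evaluation _ _).obj N).mapCocone (colimit.cocone F)).w
      (show (op (op t)) ⟶ op (op t') from (homOfLE h).op.op)
    exact congrArg (fun h => h.hom e) this

def restr (J : Ideal R) {i t t' : ℕ} (h : t ≤ t') {N : ModuleCat.{0} R}
   (e : NExt (ModuleCat.of R (R ⧸ J ^ t)) N i) : NExt (ModuleCat.of R (R ⧸ J ^ t')) N i :=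
  (Abelian.Ext.mk₀ (tr J h)).comp e (zero_add _)

section
universe u
variable {R : Type u} [CommRing R]
variable {X : ModuleCat.{u} R} (P : ProjectiveResolution X) {Y : ModuleCat.{u} R} {n : ℕ}

lemma mk_zero_of {f : P.complex.X n ⟶ Y} (hf : P.complex.d (n+1) n ≫ f = 0) (h : Rep P f 0) :
    P.extMk f (n+1) rfl hf = 0 := by
  rcases rep_zero P h with rfl | ⟨p, hp, g, hg⟩
  · simp
  · rw [P.extMk_eq_zero_iff f _ rfl hf p hp]; exact ⟨g, hg⟩

lemma zero_of_mk {f : P.complex.X n ⟶ Y} (hn : n ≠ 0) (hf : P.complex.d (n+1) n ≫ f = 0) {e}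
   (h : Rep P f e) (h0 : P.extMk f (n+1) rfl hf = 0) : e = 0 := by
  obtain ⟨p, rfl⟩ := Nat.exists_eq_succ_of_ne_zero hn
  rw [P.extMk_eq_zero_iff f _ rfl hf p rfl] at h0
  obtain ⟨g, rfl⟩ := h0
  exact rep_of_bdry P rfl g h

lemma exists_hom {X X' : ModuleCat.{u} R} (P : ProjectiveResolution X) (P' : ProjectiveResolution X')
   (g : X' ⟶ X) : Nonempty (ProjectiveResolution.Hom P' P g) :=
  ⟨ProjectiveResolution.lift g P' P, by
    have := ProjectiveResolution.lift_commutes g P' P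
    exact congrArg (fun h => HomologicalComplex.Hom.f h 0) this⟩

theorem B1 (X Y : ModuleCat.{u} R) (n : ℕ)
   (h : Subsingleton (((Ext R (ModuleCat.{u} R) n).obj (op X)).obj Y)) (e : NExt X Y n) : e = 0 := by
  obtain ⟨P⟩ : Nonempty (ProjectiveResolution X) := ⟨ProjectiveResolution.of _⟩
  obtain ⟨f, hf, rfl⟩ := P.extMk_surjective e (n+1) rfl
  obtain ⟨e, he⟩ := rep_exists P f hf
  obtain rfl : e = 0 := Subsingleton.elim _ _
  exact mk_zero_of P hf he

lemma smul_extMk (a : R) {f : P.complex.X n ⟶ Y} (hf : P.complex.d (n+1) n ≫ f = 0)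
    (hf' : P.complex.d (n+1) n ≫ (a • f) = 0) :
    a • P.extMk f (n+1) rfl hf = P.extMk (a • f) (n+1) rfl hf' := by
  rw [Abelian.Ext.smul_eq_comp_mk₀, P.extMk_comp_mk₀]
  congr 1

end

lemma kill_old (J : Ideal R) (i t : ℕ) (N : ModuleCat.{0} R) (e : OE J i t N) (a : R) (ha : a ∈ J ^ t) :
    a • e = 0 := by
  obtain ⟨P⟩ : Nonempty (ProjectiveResolution (ModuleCat.of R (R ⧸ J ^ t))) := ⟨ProjectiveResolution.of _⟩
  obtain ⟨f, hf, hr⟩ := rep_surj P e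
  have h0 : a • 𝟙 (ModuleCat.of R (R ⧸ J ^ t)) = 0 := by
    apply ModuleCat.hom_ext
    apply LinearMap.ext
    intro x
    obtain ⟨x, rfl⟩ := Submodule.Quotient.mk_surjective _ x
    change a • (Submodule.Quotient.mk x : R ⧸ J ^ t) = 0
    rw [← Submodule.Quotient.mk_smul, Submodule.Quotient.mk_eq_zero]
    exact Ideal.mul_mem_right _ _ ha
  let φ : ProjectiveResolution.Hom P P (0 : ModuleCat.of R (R ⧸ J ^ t) ⟶ _) := ⟨a • 𝟙 _, by
    rw [← h0]
    change (a • 𝟙 (P.complex.X 0)) ≫ P.π.f 0 = P.π.f 0 ≫ (a • 𝟙 _)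
    rw [Linear.smul_comp, Linear.comp_smul, Category.id_comp]
    erw [Category.comp_id]⟩
  let ψ : ProjectiveResolution.Hom P P (0 : ModuleCat.of R (R ⧸ J ^ t) ⟶ _) := ⟨0, by
    change 0 ≫ P.π.f 0 = P.π.f 0 ≫ 0
    rw [Limits.zero_comp, Limits.comp_zero]⟩
  have h1 := rep_nat P φ hr
  have h2 := rep_of_zero P (show Rep P 0 _ from by
    have := rep_nat P ψ hr
    rwa [show ψ.hom.f i ≫ f = 0 from Limits.zero_comp] at this)
  rw [h2] at h1
  have h3 : φ.hom.f i ≫ f = a • f := by simp [φ]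
  rw [h3] at h1
  have h4 := rep_smul P a hr
  rcases rep_zero P h1 with h | ⟨p, hp, g, hg⟩
  · rw [h] at h4; exact rep_of_zero P h4
  · rw [← hg] at h4; exact rep_of_bdry P hp g h4

lemma restr_extMk (J : Ideal R) {i t t' : ℕ} (h : t ≤ t') {N : ModuleCat.{0} R}
   (P : ProjectiveResolution (ModuleCat.of R (R ⧸ J ^ t)))
   {f : P.complex.X i ⟶ N} (hf : P.complex.d (i+1) i ≫ f = 0) {e : OE J i t N} (he : Rep P f e)
   (h0 : orestr J i h N e = 0) : restr J h (P.extMk f (i+1) rfl hf) = 0 := by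
  obtain ⟨P'⟩ : Nonempty (ProjectiveResolution (ModuleCat.of R (R ⧸ J ^ t'))) := ⟨ProjectiveResolution.of _⟩
  obtain ⟨φ⟩ := exists_hom P P' (tr J h)
  unfold restr
  rw [ProjectiveResolution.mk₀_comp_extMk f _ rfl hf φ]
  apply mk_zero_of
  have := rep_nat P' φ he
  rwa [show (((Ext R (ModuleCat R) i).map (tr J h).op).app N) e = 0 from h0] at this

theorem B2 (J : Ideal R) (i : ℕ) (N : ModuleCat.{0} R) (hs : Subsingleton (LC J i N)) (t : ℕ)
    (e : NExt (ModuleCat.of R (R ⧸ J ^ t)) N i) : ∃ t', ∃ h : t ≤ t', restr J h e = 0 := by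
  obtain ⟨ι, -, hι, -⟩ := colim_facts J i N
  obtain ⟨P⟩ : Nonempty (ProjectiveResolution (ModuleCat.of R (R ⧸ J ^ t))) := ⟨ProjectiveResolution.of _⟩
  obtain ⟨f, hf, rfl⟩ := P.extMk_surjective e (i+1) rfl
  obtain ⟨e, he⟩ := rep_exists P f hf
  obtain ⟨t', h, h0⟩ := hι t e (Subsingleton.elim _ _)
  exact ⟨t', h, restr_extMk J h P hf he h0⟩

theorem B3 (J : Ideal R) (i : ℕ) (N : ModuleCat.{0} R) (hs : Module.Finite R (LC J i N)) :
    ∃ N0 : ℕ, ∀ t (e : NExt (ModuleCat.of R (R ⧸ J ^ t)) N i), ∀ a ∈ J ^ N0,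
      ∃ t', ∃ h : t ≤ t', restr J h (a • e) = 0 := by
  obtain ⟨ι, hsur, hι, -⟩ := colim_facts J i N
  have hk : ∀ x : LC J i N, ∃ t, ∀ a ∈ J ^ t, a • x = 0 := by
    intro x
    obtain ⟨t, e, rfl⟩ := hsur x
    refine ⟨t, fun a ha => ?_⟩
    rw [← map_smul, kill_old J i t N e a ha, map_zero]
  choose T hT using hk
  obtain ⟨s, hs⟩ := hs.fg_top
  have hall : ∀ x : LC J i N, ∀ a ∈ J ^ (s.sup T), a • x = 0 := by
    intro x a ha
    have hx : x ∈ Submodule.span R (s : Set (LC J i N)) := by rw [hs]; trivial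
    induction hx using Submodule.span_induction with
    | mem x hx => exact hT x a (Ideal.pow_le_pow_right (Finset.le_sup hx) ha)
    | zero => simp
    | add x y _ _ hx hy => rw [smul_add, hx, hy, add_zero]
    | smul r x _ hx => rw [smul_comm, hx, smul_zero]
  refine ⟨s.sup T, fun t e a ha => ?_⟩
  obtain ⟨P⟩ : Nonempty (ProjectiveResolution (ModuleCat.of R (R ⧸ J ^ t))) := ⟨ProjectiveResolution.of _⟩
  obtain ⟨f, hf, rfl⟩ := P.extMk_surjective e (i+1) rfl
  obtain ⟨e, he⟩ := rep_exists P f hf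
  obtain ⟨t', h, h0⟩ := hι t (a • e) (by rw [map_smul]; exact hall _ a ha)
  refine ⟨t', h, ?_⟩
  rw [smul_extMk P a hf (by simp [hf])]
  exact restr_extMk J h P _ (rep_smul P a he) h0

theorem B4 (J : Ideal R) (i : ℕ) (hi : i ≠ 0) (N : ModuleCat.{0} R)
    (H : ∀ t (e : NExt (ModuleCat.of R (R ⧸ J ^ t)) N i), ∃ t', ∃ h : t ≤ t', restr J h e = 0) :
    Subsingleton (LC J i N) := by
  obtain ⟨ι, hsur, -, hι⟩ := colim_facts J i N
  refine ⟨fun a b => ?_⟩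
  suffices h : ∀ a : LC J i N, a = 0 by rw [h a, h b]
  intro a
  obtain ⟨t, e, rfl⟩ := hsur a
  obtain ⟨P⟩ : Nonempty (ProjectiveResolution (ModuleCat.of R (R ⧸ J ^ t))) := ⟨ProjectiveResolution.of _⟩
  obtain ⟨f, hf, hr⟩ := rep_surj P e
  obtain ⟨t', h, h0⟩ := H t (P.extMk f (i+1) rfl hf)
  obtain ⟨P'⟩ : Nonempty (ProjectiveResolution (ModuleCat.of R (R ⧸ J ^ t'))) := ⟨ProjectiveResolution.of _⟩
  obtain ⟨φ⟩ := exists_hom P P' (tr J h)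
  unfold restr at h0
  rw [ProjectiveResolution.mk₀_comp_extMk f _ rfl hf φ] at h0
  rw [← hι h, show orestr J i h N e = 0 from zero_of_mk P' hi _ (rep_nat P' φ hr) h0, map_zero]

end Bridge

end

section
open Opposite

namespace Alg
open Bridge RingTheory.Sequence
open scoped Pointwise
open Abelian.Ext (mk₀)
variable {R : Type} [CommRing R]

/-- `N` is killed by a power of `Q` -/
def Tors (Q : Ideal R) (N : Type) [AddCommGroup N] [Module R N] : Prop :=
  ∃ t, ∀ a ∈ Q ^ t, ∀ x : N, a • x = 0

def VV (Q : Ideal R) (M : ModuleCat.{0} R) (g : ℕ) : Prop :=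
  ∀ i < g, ∀ e : NExt (ModuleCat.of R (R ⧸ Q)) M i, e = 0

lemma smul_zero_of_kill {N M : ModuleCat.{0} R} {i : ℕ} (e : NExt N M i) (a : R)
    (h : ∀ x : N, a • x = 0) : a • e = 0 := by
  have h0 : a • 𝟙 N = 0 := by
    apply ModuleCat.hom_ext
    apply LinearMap.ext
    intro x
    exact h x
  have : a • e = (mk₀ (a • 𝟙 N)).comp e (zero_add i) := by
    rw [Abelian.Ext.mk₀_smul, Abelian.Ext.smul_comp, Abelian.Ext.mk₀_id_comp]
  rw [this, h0]; simp

lemma ses {A B C : ModuleCat.{0} R} (f : A ⟶ B) (g : B ⟶ C) (hf : Function.Injective f)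
    (hg : Function.Surjective g) (hfg : Function.Exact f g) :
    ∃ δ : NExt C A 1,
      (∀ (X : ModuleCat.{0} R) (n : ℕ) (e : NExt X A (n+1)), e.comp (mk₀ f) (add_zero _) = 0 →
        ∃ e' : NExt X C n, e'.comp δ rfl = e) ∧
      (∀ (X : ModuleCat.{0} R) (n : ℕ) (e : NExt X B n), e.comp (mk₀ g) (add_zero _) = 0 →
        ∃ e' : NExt X A n, e'.comp (mk₀ f) (add_zero _) = e) ∧
      (∀ (X : ModuleCat.{0} R) (n : ℕ) (e : NExt X C n), e.comp δ (rfl : n + 1 = n + 1) = 0 →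
        ∃ e' : NExt X B n, e'.comp (mk₀ g) (add_zero _) = e) := by
  have h0 : f ≫ g = 0 := by
    apply ModuleCat.hom_ext
    apply LinearMap.ext
    intro x
    exact hfg.apply_apply_eq_zero x
  let S : ShortComplex (ModuleCat.{0} R) := ShortComplex.mk f g h0
  have hS : S.ShortExact := ModuleCat.shortComplex_shortExact S hfg hf hg
  exact ⟨hS.extClass, fun X n e he => Abelian.Ext.covariant_sequence_exact₁ X hS e he rfl,
    fun X n e he => Abelian.Ext.covariant_sequence_exact₂ X hS e he,
    fun X n e he => Abelian.Ext.covariant_sequence_exact₃ X hS e rfl he⟩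

lemma sesm (M : ModuleCat.{0} R) (r : R) (hr : IsSMulRegular M r) :
    ∃ δ : NExt (ModuleCat.of R (QuotSMulTop r M)) M 1,
      (∀ (X : ModuleCat.{0} R) (n : ℕ) (e : NExt X M (n+1)), r • e = 0 →
        ∃ e' : NExt X (ModuleCat.of R (QuotSMulTop r M)) n, e'.comp δ rfl = e) ∧
      (∀ (X : ModuleCat.{0} R) (n : ℕ) (e : NExt X (ModuleCat.of R (QuotSMulTop r M)) n),
        e.comp δ (rfl : n + 1 = n + 1) = 0 →
        ∃ e' : NExt X M n, e'.comp (mk₀ (ModuleCat.ofHom (Submodule.mkQ (r • (⊤ : Submodule R M)))))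
          (add_zero _) = e) := by
  obtain ⟨δ, h1, h2, h3⟩ := ses (A := M) (B := M) (C := ModuleCat.of R (QuotSMulTop r M)) (r • 𝟙 M)
    (ModuleCat.ofHom (Submodule.mkQ (r • (⊤ : Submodule R M)))) hr
    (Submodule.mkQ_surjective _) (LinearMap.exact_lsmul_mkQ_smul_top M r)
  refine ⟨δ, fun X n e he => h1 X n e ?_, h3⟩
  rwa [Abelian.Ext.smul_eq_comp_mk₀] at he

lemma L1 (Q : Ideal R) (rs : List R) : ∀ (M : ModuleCat.{0} R), IsWeaklyRegular M rs →
    (∀ r ∈ rs, r ∈ Q) → ∀ (N : ModuleCat.{0} R), Tors Q N → ∀ i < rs.length,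
    ∀ e : NExt N M i, e = 0 := by
  induction rs with
  | nil => intro M _ _ N _ i hi; simp at hi
  | cons r rs ih =>
    intro M hM hr N hN i hi e
    rw [isWeaklyRegular_cons_iff] at hM
    obtain ⟨t, ht⟩ := hN
    have inj : ∀ e : NExt N M i, r • e = 0 → e = 0 := by
      intro e he
      obtain ⟨δ, h1, h3⟩ := sesm M r hM.1
      cases i with
      | zero =>
        have hm : Mono (r • 𝟙 M) := (ModuleCat.mono_iff_injective _).2 hM.1
        apply Abelian.Ext.postcomp_mk₀_injective_of_mono N (r • 𝟙 M)
        rw [map_zero]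
        rw [Abelian.Ext.smul_eq_comp_mk₀] at he
        exact he
      | succ j =>
        obtain ⟨e3, rfl⟩ := h1 N j e he
        have := ih (ModuleCat.of R (QuotSMulTop r M)) hM.2 (fun a ha => hr a (by simp [ha])) N
          ⟨t, ht⟩ j (by simpa using hi) e3
        rw [this]; simp
    have h2 : ∀ k, r ^ k • e = 0 → e = 0 := by
      intro k
      induction k with
      | zero => simp
      | succ k ihk =>
        intro h
        rw [pow_succ', mul_smul] at h
        exact ihk (inj _ h)
    exact h2 t (smul_zero_of_kill e _ fun x => ht _ (Ideal.pow_mem_pow (hr r (by simp)) t) x)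

lemma VV_quot (Q : Ideal R) (M : ModuleCat.{0} R) (g : ℕ) (h : VV Q M (g+1)) (x : R)
    (hx : IsSMulRegular M x) : VV Q (ModuleCat.of R (QuotSMulTop x M)) g := by
  intro i hi e
  obtain ⟨δ, h1, h3⟩ := sesm M x hx
  obtain ⟨e2, rfl⟩ := h3 _ i e (h (i+1) (by omega) _)
  rw [h i (by omega) e2]; simp

lemma torsQ (Q : Ideal R) : Tors Q (R ⧸ Q) := by
  refine ⟨1, fun a ha x => ?_⟩
  obtain ⟨x, rfl⟩ := Submodule.Quotient.mk_surjective _ x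
  rw [← Submodule.Quotient.mk_smul, Submodule.Quotient.mk_eq_zero]
  rw [pow_one] at ha
  exact Ideal.mul_mem_right _ _ ha

lemma torsQt (Q : Ideal R) (t : ℕ) : Tors Q (R ⧸ Q ^ t) := by
  refine ⟨t, fun a ha x => ?_⟩
  obtain ⟨x, rfl⟩ := Submodule.Quotient.mk_surjective _ x
  rw [← Submodule.Quotient.mk_smul, Submodule.Quotient.mk_eq_zero]
  exact Ideal.mul_mem_right _ _ ha

lemma VV_of_reg (Q : Ideal R) (rs : List R) (M : ModuleCat.{0} R) (h : IsWeaklyRegular M rs)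
    (hr : ∀ r ∈ rs, r ∈ Q) : VV Q M rs.length :=
  fun i hi e => L1 Q rs M h hr _ (torsQ Q) i hi e

lemma ass_not_ge [IsNoetherianRing R] (Q : Ideal R) (M : ModuleCat.{0} R) (g : ℕ) (hg : 0 < g) (h : VV Q M g)
    (p : Ideal R) (hp : p ∈ associatedPrimes R M) : ¬ Q ≤ p := by
  intro hQ
  obtain ⟨hpr, u, hu⟩ := isAssociatedPrime_iff_exists_injective_linearMap p (M := M) |>.1 hp
  let w : (R ⧸ Q) →ₗ[R] M := u.comp (Submodule.mapQ _ _ LinearMap.id hQ)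
  have h0 := h 0 hg (mk₀ (ModuleCat.ofHom w))
  rw [Abelian.Ext.mk₀_eq_zero_iff] at h0
  have h1 : w (Submodule.Quotient.mk 1) = 0 := by
    have := congrArg (fun f => f.hom (Submodule.Quotient.mk 1)) h0
    exact this
  have h2 : u (Submodule.Quotient.mk 1) = 0 := h1
  rw [map_eq_zero_iff u hu, Submodule.Quotient.mk_eq_zero] at h2
  exact hpr.ne_top ((Ideal.eq_top_iff_one _).2 h2)

/-- avoidance -/
lemma avoid {K : Type} [Field K] [Infinite K] [Algebra K R] (V : Submodule K R)
    (A : Set (Ideal R)) (hA : A.Finite) (h : ∀ p ∈ A, ∃ v ∈ V, v ∉ p) :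
    ∃ v ∈ V, ∀ p ∈ A, v ∉ p := by
  classical
  by_contra hc
  push Not at hc
  have := hA.to_subtype
  let W : A → Subspace K V := fun p => Submodule.comap V.subtype (p.1.restrictScalars K)
  have hu : (⋃ p : A, (W p : Set V)) = Set.univ := by
    ext v
    simp only [Set.mem_iUnion, Set.mem_univ, iff_true]
    obtain ⟨p, hp, hv⟩ := hc v.1 v.2
    exact ⟨⟨p, hp⟩, hv⟩
  obtain ⟨p, hp⟩ := Subspace.exists_eq_top_of_iUnion_eq_univ hu
  obtain ⟨v, hv, hvp⟩ := h p.1 p.2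
  apply hvp
  have : (⟨v, hv⟩ : V) ∈ W p := by rw [hp]; trivial
  exact this

lemma reg_of_avoid [IsNoetherianRing R] (M : Type) [AddCommGroup M] [Module R M] (x : R)
    (h : ∀ p ∈ associatedPrimes R M, x ∉ p) : IsSMulRegular M x := by
  have := biUnion_associatedPrimes_eq_compl_regular R M
  by_contra hc
  have hx : x ∈ ({r : R | IsSMulRegular M r}ᶜ : Set R) := hc
  rw [← this] at hx
  simp only [Set.mem_iUnion] at hx
  obtain ⟨p, hp, hxp⟩ := hx
  exact h p hp hxp

lemma L2 {K : Type} [Field K] [Infinite K] [Algebra K R] [IsNoetherianRing R] (Q : Ideal R)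
    (V : Submodule K R) (hV : ∀ p : Ideal R, p.IsPrime → (∀ v ∈ V, v ∈ p) → Q ≤ p) (g : ℕ) :
    ∀ (M C : ModuleCat.{0} R), Module.Finite R M → Module.Finite R C → VV Q M g → VV Q C g →
    ∃ rs : List R, rs.length = g ∧ (∀ r ∈ rs, r ∈ V) ∧ IsWeaklyRegular M rs ∧
      IsWeaklyRegular C rs := by
  induction g with
  | zero => intro M C _ _ _ _; exact ⟨[], by simp⟩
  | succ g ih =>
    intro M C _ _ hM hC
    obtain ⟨v, hv, hvA⟩ := avoid V (associatedPrimes R M ∪ associatedPrimes R C)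
      ((associatedPrimes.finite R M).union (associatedPrimes.finite R C)) (by
        rintro p (hp | hp)
        · by_contra hc
          push Not at hc
          exact ass_not_ge Q M _ (by simp) hM p hp (hV p hp.isPrime hc)
        · by_contra hc
          push Not at hc
          exact ass_not_ge Q C _ (by simp) hC p hp (hV p hp.isPrime hc))
    have r1 : IsSMulRegular M v := reg_of_avoid M v fun p hp => hvA p (Or.inl hp)
    have r2 : IsSMulRegular C v := reg_of_avoid C v fun p hp => hvA p (Or.inr hp)
    obtain ⟨rs, hl, hr, h1, h2⟩ := ih (ModuleCat.of R (QuotSMulTop v M))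
      (ModuleCat.of R (QuotSMulTop v C)) (inferInstanceAs (Module.Finite R (QuotSMulTop v M)))
      (inferInstanceAs (Module.Finite R (QuotSMulTop v C)))
      (VV_quot Q M g hM v r1) (VV_quot Q C g hC v r2)
    refine ⟨v :: rs, by simp [hl], ?_, ?_, ?_⟩
    · intro r hr'
      rcases List.mem_cons.1 hr' with rfl | h
      · exact hv
      · exact hr r h
    · exact (isWeaklyRegular_cons_iff M v rs).2 ⟨r1, h1⟩
    · exact (isWeaklyRegular_cons_iff C v rs).2 ⟨r2, h2⟩

lemma L3 (Q : Ideal R) (rs : List R) : ∀ (M : ModuleCat.{0} R), IsWeaklyRegular M rs →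
    (∀ r ∈ rs, r ∈ Q) → ∃ (Z : ModuleCat.{0} R) (q : M →ₗ[R] Z), 
      LinearMap.ker q = Ideal.ofList rs • ⊤ ∧ ∀ (X : ModuleCat.{0} R) (w : X ⟶ Z),
      ∃ e : NExt X M rs.length, ∀ (N : ModuleCat.{0} R), Tors Q N → ∀ h : N ⟶ X,
        (mk₀ h).comp e (zero_add _) = 0 → h ≫ w = 0 := by
  induction rs with
  | nil =>
    intro M _ _
    refine ⟨M, LinearMap.id, by simp, fun X w => ⟨mk₀ w, fun N _ h h0 => ?_⟩⟩
    rwa [Abelian.Ext.mk₀_comp_mk₀, Abelian.Ext.mk₀_eq_zero_iff] at h0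
  | cons r rs ih =>
    intro M hM hr
    have hM' := (isWeaklyRegular_cons_iff M r rs).1 hM
    obtain ⟨Z, q, hq, H⟩ := ih (ModuleCat.of R (QuotSMulTop r M)) hM'.2
      (fun a ha => hr a (by simp [ha]))
    obtain ⟨δ, h1, h3⟩ := sesm M r hM'.1
    refine ⟨Z, q.comp (Submodule.mkQ (r • (⊤ : Submodule R M))), ?_, fun X w => ?_⟩
    · rw [LinearMap.ker_comp, hq]
      erw [Submodule.comap_smul_top_of_surjective _ _ (Submodule.mkQ_surjective _)]
      rw [Submodule.ker_mkQ, Ideal.ofList_cons_smul, sup_comm]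
    · obtain ⟨e1, he1⟩ := H X w
      refine ⟨e1.comp δ rfl, fun N hN h h0 => he1 N hN h ?_⟩
      rw [← Abelian.Ext.comp_assoc (a₁₂ := rs.length) (h₁₂ := by omega) (h₂₃ := rfl) (h := by simp)] at h0
      obtain ⟨e2, he2⟩ := h3 _ _ _ h0
      have := L1 Q (r :: rs) M hM hr N hN rs.length (by simp) e2
      rw [← he2, this]; simp

lemma L3' (Q : Ideal R) (rs : List R) (M : Type) [AddCommGroup M] [Module R M]
    (hM : IsWeaklyRegular M rs) (hr : ∀ r ∈ rs, r ∈ Q) (t : ℕ) (v : M)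
    (hv : ∀ a ∈ Q ^ t, a • v ∈ (Ideal.ofList rs • ⊤ : Submodule R M)) :
    ∃ e : NExt (ModuleCat.of R (R ⧸ Q ^ t)) (ModuleCat.of R M) rs.length,
      ∀ (s : R) (t' : ℕ) (h : t ≤ t'), restr Q h (s • e) = 0 →
        s • v ∈ (Ideal.ofList rs • ⊤ : Submodule R M) := by
  obtain ⟨Z, q, hq, H⟩ := L3 Q rs (ModuleCat.of R M) hM hr
  let w : (R ⧸ Q ^ t) →ₗ[R] Z := Submodule.liftQ _ (LinearMap.toSpanSingleton R Z (q v)) (by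
    intro a ha
    rw [LinearMap.mem_ker, LinearMap.toSpanSingleton_apply, ← map_smul, ← LinearMap.mem_ker, hq]
    exact hv a ha)
  obtain ⟨e, he⟩ := H (ModuleCat.of R (R ⧸ Q ^ t)) (ModuleCat.ofHom w)
  refine ⟨e, fun s t' h h0 => ?_⟩
  have h1 := he (ModuleCat.of R (R ⧸ Q ^ t')) (torsQt Q t') (s • tr Q h) (by
    rw [Abelian.Ext.mk₀_smul, Abelian.Ext.smul_comp]
    unfold restr at h0
    rwa [Abelian.Ext.comp_smul] at h0)
  have h2 := congrArg (fun f => f.hom (Submodule.Quotient.mk 1)) h1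
  rw [← hq, LinearMap.mem_ker]
  have h3 : w (s • Submodule.Quotient.mk 1) = 0 := h2
  rw [map_smul] at h3
  rw [map_smul]
  have h4 : w (Submodule.Quotient.mk 1) = (1:R) • q v := rfl
  rw [h4, one_smul] at h3
  exact h3

end Alg

end

section
open Opposite

namespace Alg
open Bridge RingTheory.Sequence
open scoped Pointwise
open Abelian.Ext (mk₀)
variable {R : Type} [CommRing R]

def DD (Q : Ideal R) (N : ModuleCat.{0} R) (i : ℕ) : Prop :=
  ∀ t (e : NExt (ModuleCat.of R (R ⧸ Q ^ t)) N i), ∃ t', ∃ h : t ≤ t', restr Q h e = 0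

lemma pd_quot (rs : List R) : ∀ (M : Type) [AddCommGroup M] [Module R M] (d : ℕ),
    HasProjectiveDimensionLT (ModuleCat.of R M) (d+1) → IsWeaklyRegular M rs →
    HasProjectiveDimensionLT (ModuleCat.of R (M ⧸ (Ideal.ofList rs • ⊤ : Submodule R M)))
      (d + 1 + rs.length) := by
  induction rs with
  | nil =>
    intro M _ _ d hd _
    have e : M ≃ₗ[R] (M ⧸ (Ideal.ofList ([] : List R) • ⊤ : Submodule R M)) :=
      (Submodule.quotEquivOfEqBot _ (by rw [Ideal.ofList_nil, Submodule.bot_smul])).symm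
    exact hasProjectiveDimensionLT_of_iso e.toModuleIso (d+1)
  | cons r rs ih =>
    intro M _ _ d hd hM
    rw [isWeaklyRegular_cons_iff] at hM
    have hS := IsSMulRegular.smulShortComplex_shortExact (M := ModuleCat.of R M) hM.1
    have h1 : HasProjectiveDimensionLT (ModuleCat.of R (QuotSMulTop r M)) (d+1+1) :=
      hS.hasProjectiveDimensionLT_X₃ (d+1) hd
        (hasProjectiveDimensionLT_of_ge (ModuleCat.of R M) (d+1) (d+1+1) (by omega))
    have h2 := ih (QuotSMulTop r M) (d+1) h1 hM.2
    have h3 := hasProjectiveDimensionLT_of_iso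
      (Submodule.quotOfListConsSMulTopEquivQuotSMulTopInner M r rs).symm.toModuleIso (d+1+1+rs.length)
    rw [List.length_cons, show d + 1 + (rs.length + 1) = d+1+1+rs.length by omega]
    exact h3

lemma ext_quot_zero (rs : List R) (h : IsWeaklyRegular R rs) (N : ModuleCat.{0} R) (i : ℕ)
    (hi : rs.length < i)
    (e : NExt (ModuleCat.of R (R ⧸ (Ideal.ofList rs • ⊤ : Ideal R))) N i) : e = 0 := by
  have hp : Projective (ModuleCat.of R R) := inferInstance
  have h0 : HasProjectiveDimensionLT (ModuleCat.of R R) (0+1) := by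
    have : HasProjectiveDimensionLT (ModuleCat.of R R) 1 := inferInstance
    exact this
  have := pd_quot rs R 0 h0 h
  exact e.eq_zero_of_hasProjectiveDimensionLT (0+1+rs.length) (by omega)

lemma DD_above (Q : Ideal R) (n : ℕ)
    (H : ∀ t, ∃ rs : List R, rs.length = n ∧ IsWeaklyRegular R rs ∧ (∀ r ∈ rs, r ∈ Q ^ t) ∧
      ∃ t', Q ^ t' ≤ Ideal.ofList rs) (N : ModuleCat.{0} R) (i : ℕ) (hi : n < i) : DD Q N i := by
  intro t e
  obtain ⟨rs, hl, hr, hm, t', ht'⟩ := H t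
  have hle : (Ideal.ofList rs • ⊤ : Ideal R) ≤ Q ^ t := by
    rw [smul_eq_mul, Ideal.mul_top]
    exact Ideal.span_le.2 (fun r hr => hm r hr)
  have hle2 : Q ^ (max t t') ≤ (Ideal.ofList rs • ⊤ : Ideal R) := by
    rw [smul_eq_mul, Ideal.mul_top]
    exact (Ideal.pow_le_pow_right (le_max_right _ _)).trans ht'
  refine ⟨max t t', le_max_left _ _, ?_⟩
  let f1 : (R ⧸ Q ^ (max t t')) →ₗ[R] (R ⧸ (Ideal.ofList rs • ⊤ : Ideal R)) :=
    Submodule.mapQ _ _ LinearMap.id hle2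
  let f2 : (R ⧸ (Ideal.ofList rs • ⊤ : Ideal R)) →ₗ[R] (R ⧸ Q ^ t) :=
    Submodule.mapQ _ _ LinearMap.id hle
  have hf : tr Q (le_max_left t t') = ModuleCat.ofHom f1 ≫ ModuleCat.ofHom f2 := by
    apply ModuleCat.hom_ext
    apply LinearMap.ext
    intro x
    obtain ⟨x, rfl⟩ := Submodule.Quotient.mk_surjective _ x
    rfl
  unfold restr
  rw [hf, ← Abelian.Ext.mk₀_comp_mk₀, Abelian.Ext.comp_assoc (h₁₂ := rfl) (h₂₃ := zero_add i)
    (h := by omega), ext_quot_zero rs hr N i (by omega) (Abelian.Ext.comp _ _ _)]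
  simp

lemma restr_restr (Q : Ideal R) {t t' t'' i : ℕ} (h : t ≤ t') (h' : t' ≤ t'') {N : ModuleCat.{0} R}
    (e : NExt (ModuleCat.of R (R ⧸ Q ^ t)) N i) :
    restr Q h' (restr Q h e) = restr Q (h.trans h') e := by
  have hf : tr Q (h.trans h') = tr Q h' ≫ tr Q h := by
    apply ModuleCat.hom_ext
    apply LinearMap.ext
    intro x
    obtain ⟨x, rfl⟩ := Submodule.Quotient.mk_surjective _ x
    rfl
  unfold restr
  rw [hf, ← Abelian.Ext.mk₀_comp_mk₀, Abelian.Ext.comp_assoc (h₁₂ := rfl) (h₂₃ := zero_add i)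
    (h := by omega)]

lemma restr_comp (Q : Ideal R) {t t' i j k : ℕ} (h : t ≤ t') {N N' : ModuleCat.{0} R}
    (e : NExt (ModuleCat.of R (R ⧸ Q ^ t)) N i) (d : NExt N N' j) (hk : i + j = k) :
    restr Q h (e.comp d hk) = (restr Q h e).comp d hk := by
  unfold restr
  rw [Abelian.Ext.comp_assoc (h₁₂ := zero_add i) (h₂₃ := hk) (h := by omega)]

lemma DD_ext (Q : Ideal R) (i : ℕ) {A B C : ModuleCat.{0} R} (f : A ⟶ B) (g : B ⟶ C)
    (hf : Function.Injective f) (hg : Function.Surjective g) (hfg : Function.Exact f g)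
    (hA : DD Q A i) (hC : DD Q C i) : DD Q B i := by
  intro t e
  obtain ⟨δ, h1, h2, h3⟩ := ses f g hf hg hfg
  obtain ⟨t', h, h0⟩ := hC t (e.comp (mk₀ g) (add_zero _))
  rw [restr_comp] at h0
  obtain ⟨e', he'⟩ := h2 _ _ _ h0
  obtain ⟨t'', h', h0'⟩ := hA t' e'
  refine ⟨t'', h.trans h', ?_⟩
  rw [← restr_restr Q h h', ← he', restr_comp, h0', Abelian.Ext.zero_comp]

lemma DD_coker (Q : Ideal R) (i : ℕ) {A B C : ModuleCat.{0} R} (f : A ⟶ B) (g : B ⟶ C)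
    (hf : Function.Injective f) (hg : Function.Surjective g) (hfg : Function.Exact f g)
    (hA : DD Q A (i+1)) (hB : DD Q B i) : DD Q C i := by
  intro t e
  obtain ⟨δ, h1, h2, h3⟩ := ses f g hf hg hfg
  obtain ⟨t', h, h0⟩ := hA t (e.comp δ rfl)
  rw [restr_comp] at h0
  obtain ⟨e', he'⟩ := h3 _ _ _ h0
  obtain ⟨t'', h', h0'⟩ := hB t' e'
  refine ⟨t'', h.trans h', ?_⟩
  rw [← restr_restr Q h h', ← he', restr_comp, h0', Abelian.Ext.zero_comp]

lemma cd_step [IsNoetherianRing R] (Q p : Ideal R) (i : ℕ)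
    (h1 : DD Q (ModuleCat.of R (R ⧸ p)) i)
    (h2 : ∀ N : ModuleCat.{0} R, Module.Finite R N → (∀ a ∈ p, ∀ x : N, a • x = 0) → DD Q N (i+1))
    (N : Type) [AddCommGroup N] [Module R N] [hfin : Module.Finite R N] :
    (∀ a ∈ p, ∀ x : N, a • x = 0) → DD Q (ModuleCat.of R N) i := by
  induction hfin using IsNoetherianRing.induction_on_isQuotientEquivQuotientPrime R with
  | subsingleton N =>
    intro _ t e
    refine ⟨t, le_rfl, ?_⟩
    have hz : 𝟙 (ModuleCat.of R N) = 0 := by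
      apply ModuleCat.hom_ext
      apply LinearMap.ext
      intro x
      exact Subsingleton.elim (α := N) _ _
    have : e = 0 := by
      rw [← Abelian.Ext.comp_mk₀_id e, hz]; simp
    rw [this]; unfold restr; simp
  | quotient N q f =>
    intro hk
    have hpq : p ≤ q.1 := by
      intro a ha
      have := hk a ha (f.symm (Submodule.Quotient.mk 1))
      rw [← map_smul, LinearEquiv.map_eq_zero_iff, ← Submodule.Quotient.mk_smul,
        Submodule.Quotient.mk_eq_zero] at this
      simpa using this
    let g : (R ⧸ p) →ₗ[R] N := f.symm.toLinearMap.comp (Submodule.mapQ _ _ LinearMap.id hpq)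
    have hg : Function.Surjective g := by
      intro x
      obtain ⟨a, ha⟩ := Submodule.Quotient.mk_surjective _ (f x)
      refine ⟨Submodule.Quotient.mk a, ?_⟩
      change f.symm (Submodule.Quotient.mk a) = x
      rw [ha, LinearEquiv.symm_apply_apply]
    refine DD_coker Q i (A := ModuleCat.of R (LinearMap.ker g)) (B := ModuleCat.of R (R ⧸ p))
      (ModuleCat.ofHom (Submodule.subtype _)) (ModuleCat.ofHom g)
      (Submodule.subtype_injective _) hg (LinearMap.exact_subtype_ker_map g) (h2 _ ?_ ?_) h1
    · exact inferInstanceAs (Module.Finite R (LinearMap.ker g))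
    · rintro a ha ⟨x, hx⟩
      apply Subtype.ext
      change a • x = 0
      obtain ⟨x, rfl⟩ := Submodule.Quotient.mk_surjective _ x
      rw [← Submodule.Quotient.mk_smul, Submodule.Quotient.mk_eq_zero]
      exact Ideal.mul_mem_right _ _ ha
  | exact N₁ N₂ N₃ f g hf hg hfg ih1 ih3 =>
    intro hk
    refine DD_ext Q i (ModuleCat.ofHom f) (ModuleCat.ofHom g) hf hg hfg (ih1 ?_) (ih3 ?_)
    · intro a ha x
      apply hf
      rw [map_smul, map_zero]
      exact hk a ha _
    · intro a ha x
      obtain ⟨x, rfl⟩ := hg x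
      rw [← map_smul, hk a ha, map_zero]

lemma cd_lemma [IsNoetherianRing R] (Q p : Ideal R) (n g : ℕ)
    (hn : ∀ N : ModuleCat.{0} R, ∀ i > n, DD Q N i)
    (hp : ∀ i > g, DD Q (ModuleCat.of R (R ⧸ p)) i) :
    ∀ k i, i > g → n < i + k → ∀ N : ModuleCat.{0} R, Module.Finite R N →
      (∀ a ∈ p, ∀ x : N, a • x = 0) → DD Q N i := by
  intro k
  induction k with
  | zero => intro i _ hi N _ _; exact hn N i (by omega)
  | succ k ih =>
    intro i hi hik N hN hk
    exact cd_step Q p i (hp i hi) (ih (i+1) (by omega) (by omega)) N hk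

lemma mul_dies [IsNoetherianRing R] (Q p : Ideal R) (d : ℕ)
    (H : ∀ N : ModuleCat.{0} R, Module.Finite R N →
      (∀ a ∈ p, ∀ x : N, a • x = 0) → DD Q N d) (C : Type) [AddCommGroup C] [Module R C]
    [Module.Finite R C] (u : R) (hu : ∀ a ∈ p, ∀ x : C, a • u • x = 0) (t : ℕ)
    (e : NExt (ModuleCat.of R (R ⧸ Q ^ t)) (ModuleCat.of R C) d) :
    ∃ t', ∃ h : t ≤ t', restr Q h (u • e) = 0 := by
  let m : C →ₗ[R] C := LinearMap.lsmul R C u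
  let N := LinearMap.range m
  have hN : DD Q (ModuleCat.of R N) d := by
    apply H
    · exact inferInstanceAs (Module.Finite R N)
    · rintro a ha ⟨x, y, rfl⟩
      apply Subtype.ext
      exact hu a ha y
  have hf : u • 𝟙 (ModuleCat.of R C) =
      ModuleCat.ofHom m.rangeRestrict ≫ ModuleCat.ofHom (Submodule.subtype N) := rfl
  obtain ⟨t', h, h0⟩ := hN t (e.comp (mk₀ (ModuleCat.ofHom m.rangeRestrict)) (add_zero _))
  refine ⟨t', h, ?_⟩
  rw [Abelian.Ext.smul_eq_comp_mk₀, hf, ← Abelian.Ext.mk₀_comp_mk₀,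
    ← Abelian.Ext.comp_assoc (h₁₂ := add_zero d) (h₂₃ := zero_add 0) (h := by omega), restr_comp, h0,
    Abelian.Ext.zero_comp]

end Alg

end

section
namespace Fin1
open Bridge Alg RingTheory.Sequence
open scoped Pointwise

lemma ofList_pow {σ K : Type} [Field K] (l : List σ) (t : ℕ) :
    Ideal.ofList (l.map (fun i => (X i ^ t : MvPolynomial σ K))) =
      Ideal.span ((fun s => monomial s (1 : K)) '' {s | ∃ i ∈ l, s = Finsupp.single i t}) := by
  unfold Ideal.ofList
  congr 1
  ext f
  constructor
  · intro h
    obtain ⟨i, hi, rfl⟩ := List.mem_map.1 h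
    exact ⟨_, ⟨i, hi, rfl⟩, (X_pow_eq_monomial).symm⟩
  · rintro ⟨s, ⟨i, hi, rfl⟩, rfl⟩
    exact List.mem_map.2 ⟨i, hi, X_pow_eq_monomial⟩

lemma powreg {σ K : Type} [Field K] (t : ℕ) (l : List σ) (hl : l.Nodup) :
    IsWeaklyRegular (MvPolynomial σ K) (l.map (fun i => (X i ^ t : MvPolynomial σ K))) := by
  classical
  induction l using List.reverseRecOn with
  | nil => simp
  | append_singleton l k ih =>
    rw [List.map_append, isWeaklyRegular_append_iff]
    have hl2 := List.nodup_append.1 hl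
    refine ⟨ih hl2.1, ?_⟩
    rw [List.map_singleton, isWeaklyRegular_singleton_iff,
      isSMulRegular_quotient_iff_mem_of_smul_mem]
    intro f hf
    have e : (Ideal.ofList (l.map (fun i => (X i ^ t : MvPolynomial σ K))) •
      (⊤ : Submodule (MvPolynomial σ K) (MvPolynomial σ K))) =
      Ideal.ofList (l.map (fun i => (X i ^ t : MvPolynomial σ K))) := by
      simp
    rw [e, ofList_pow, mem_ideal_span_monomial_image] at hf ⊢
    intro xi hxi
    have h2 : Finsupp.single k t + xi ∈ ((X k ^ t : MvPolynomial σ K) • f).support := by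
      rw [mem_support_iff] at hxi ⊢
      rw [smul_eq_mul, X_pow_eq_monomial, coeff_monomial_mul, one_mul]
      exact hxi
    obtain ⟨s, ⟨i, hi, rfl⟩, hs⟩ := hf _ h2
    refine ⟨_, ⟨i, hi, rfl⟩, ?_⟩
    have hik : i ≠ k := by
      rintro rfl
      exact hl2.2.2 _ hi _ (by simp) rfl
    rw [Finsupp.single_le_iff] at hs ⊢
    simpa [Finsupp.single_apply, Ne.symm hik] using hs

variable (K : Type) [Field K] (m n : ℕ)

/-- `K`-span of the `k`-th powers of the `y_j`. -/
def Vk (k : ℕ) : Submodule K (BGS K m n) :=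
  Submodule.span K (Set.range fun j : Fin n => (X (Sum.inr j) ^ k : BGS K m n))

lemma X_mem_Q (j : Fin n) : (X (Sum.inr j) : BGS K m n) ∈ idealQ K m n :=
  Ideal.subset_span ⟨j, rfl⟩

lemma Vk_le (k : ℕ) (v : BGS K m n) (hv : v ∈ Vk K m n k) : v ∈ idealQ K m n ^ k := by
  have : Vk K m n k ≤ (idealQ K m n ^ k).restrictScalars K := by
    refine Submodule.span_le.2 ?_
    rintro _ ⟨j, rfl⟩
    exact Ideal.pow_mem_pow (X_mem_Q K m n j) k
  exact this hv

lemma Vk_prime (k : ℕ) (p : Ideal (BGS K m n)) (hp : p.IsPrime)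
    (h : ∀ v ∈ Vk K m n k, v ∈ p) : idealQ K m n ≤ p := by
  refine Ideal.span_le.2 ?_
  rintro _ ⟨j, rfl⟩
  exact hp.mem_of_pow_mem k (h _ (Submodule.subset_span ⟨j, rfl⟩))

/-- the list of y powers -/
def ys (t : ℕ) : List (BGS K m n) :=
  ((List.finRange n).map Sum.inr).map (fun i => (X i ^ t : BGS K m n))

def xs : List (BGS K m n) :=
  ((List.finRange m).map Sum.inl).map (fun i => (X i ^ 1 : BGS K m n))

lemma ys_reg (t : ℕ) : IsWeaklyRegular (BGS K m n) (ys K m n t) :=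
  powreg t _ (List.Nodup.map Sum.inr_injective (List.nodup_finRange n))

lemma ys_length (t : ℕ) : (ys K m n t).length = n := by simp [ys]
lemma xs_length : (xs K m n).length = m := by simp [xs]

lemma ys_mem (t : ℕ) : ∀ r ∈ ys K m n t, r ∈ idealQ K m n ^ t := by
  intro r hr
  simp only [ys, List.map_map, List.mem_map, List.mem_finRange, true_and, Function.comp] at hr
  obtain ⟨j, rfl⟩ := hr
  exact Ideal.pow_mem_pow (X_mem_Q K m n j) t

lemma ys_pow (t : ℕ) : ∃ t', idealQ K m n ^ t' ≤ Ideal.ofList (ys K m n t) := by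
  refine Ideal.exists_pow_le_of_le_radical_of_fg ?_ (IsNoetherian.noetherian _)
  refine Ideal.span_le.2 ?_
  rintro _ ⟨j, rfl⟩
  refine ⟨t, Ideal.subset_span ?_⟩
  simp only [ys, List.map_map]
  exact List.mem_map.2 ⟨j, by simp, rfl⟩

lemma DDn (N : ModuleCat.{0} (BGS K m n)) (i : ℕ) (hi : n < i) : DD (idealQ K m n) N i :=
  DD_above _ n (fun t => ⟨ys K m n t, ys_length K m n t, ys_reg K m n t, ys_mem K m n t,
    ys_pow K m n t⟩) N i hi

lemma xs_ofList : Ideal.ofList (xs K m n) = idealP K m n := by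
  unfold Ideal.ofList idealP xs
  congr 1
  ext f
  simp [Set.mem_range]

lemma xy_reg : IsWeaklyRegular (BGS K m n) (xs K m n ++ ys K m n 1) := by
  unfold xs ys
  rw [← List.map_append]
  refine powreg 1 _ ?_
  refine List.Nodup.append (List.Nodup.map Sum.inl_injective (List.nodup_finRange m))
    (List.Nodup.map Sum.inr_injective (List.nodup_finRange n)) ?_
  intro a ha hb
  simp only [List.mem_map, List.mem_finRange, true_and] at ha hb
  obtain ⟨i, rfl⟩ := ha
  obtain ⟨j, hj⟩ := hb
  simp at hj

lemma xs_reg : IsWeaklyRegular (BGS K m n) (xs K m n) :=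
  ((isWeaklyRegular_append_iff _ _ _).1 (xy_reg K m n)).1

lemma ys_regP : IsWeaklyRegular (BGS K m n ⧸ idealP K m n) (ys K m n 1) := by
  have := ((isWeaklyRegular_append_iff _ _ _).1 (xy_reg K m n)).2
  have e : (Ideal.ofList (xs K m n) • (⊤ : Submodule (BGS K m n) (BGS K m n))) =
      idealP K m n := by
    rw [xs_ofList]; simp
  rw [e] at this
  exact this

lemma VVP : VV (idealQ K m n) (ModuleCat.of _ (BGS K m n ⧸ idealP K m n)) n := by
  have := VV_of_reg (idealQ K m n) (ys K m n 1)
    (ModuleCat.of _ (BGS K m n ⧸ idealP K m n)) (ys_regP K m n) (by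
      intro r hr
      simpa using ys_mem K m n 1 r hr)
  rwa [ys_length] at this

end Fin1

end

section
namespace Fin1
open Bridge Alg RingTheory.Sequence
open scoped Pointwise

variable {K : Type} [Field K] {m n : ℕ}

lemma exists_proj {M : Type} [AddCommGroup M] (ℳ : ℕ × ℕ → AddSubgroup M)
    (h : DirectSum.IsInternal ℳ) (c : ℕ × ℕ) : ∃ pr : M →+ M, (∀ x ∈ ℳ c, pr x = x) ∧
      ∀ d, d ≠ c → ∀ x ∈ ℳ d, pr x = 0 := by
  classical
  let D := h.chooseDecomposition
  refine ⟨(ℳ c).subtype.comp ((DFinsupp.evalAddMonoidHom (β := fun i => ℳ i) c).comp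
    (DirectSum.decomposeAddEquiv ℳ).toAddMonoidHom), ?_, ?_⟩
  · intro x hx
    exact DirectSum.decompose_of_mem_same ℳ hx
  · intro d hd x hx
    exact DirectSum.decompose_of_mem_ne ℳ hx hd

lemma exists_dec {M : Type} [AddCommGroup M] (ℳ : ℕ × ℕ → AddSubgroup M)
    (h : DirectSum.IsInternal ℳ) (v : M) : ∃ (B : Finset (ℕ ×ₗ ℕ)) (G : ℕ ×ₗ ℕ → M),
      (∀ b, G b ∈ ℳ (ofLex b)) ∧ v = ∑ b ∈ B, G b := by
  classical
  let D := h.chooseDecomposition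
  refine ⟨(DFinsupp.support (DirectSum.decompose ℳ v)).map toLex.toEmbedding,
    fun b => (DirectSum.decompose ℳ v (ofLex b) : M), fun b => Subtype.mem _, ?_⟩
  rw [Finset.sum_map]
  exact (DirectSum.sum_support_decompose ℳ v).symm

lemma topkill {M : Type} [AddCommGroup M] [Module (BGS K m n) M]
    (ℳ : ℕ × ℕ → AddSubgroup M) (hM : IsBigrading K m n M ℳ)
    (a0 : ℕ ×ₗ ℕ) (A : Finset (ℕ ×ₗ ℕ)) (hA : ∀ a ∈ A, a < a0) (F : ℕ ×ₗ ℕ → BGS K m n)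
    (hF : ∀ a, IsWeightedHomogeneous (bwt m n) (F a) (ofLex a)) (B : Finset (ℕ ×ₗ ℕ)) :
    ∀ (δ : ℕ ×ₗ ℕ) (G : ℕ ×ₗ ℕ → M), (∀ b, G b ∈ ℳ (ofLex (δ + b))) →
      (∑ a ∈ insert a0 A, F a) • (∑ b ∈ B, G b) = 0 → ∃ N : ℕ, F a0 ^ N • (∑ b ∈ B, G b) = 0 := by
  classical
  induction B using Finset.induction_on_max with
  | empty => intro δ G _ _; exact ⟨0, by simp⟩
  | insert b0 B hB ih =>
    intro δ G hG h0
    have hb0 : b0 ∉ B := fun h => lt_irrefl _ (hB _ h)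
    obtain ⟨pr, h1, h2⟩ := exists_proj ℳ hM.internal (ofLex (a0 + (δ + b0)))
    have hmem : ∀ a b, F a • G b ∈ ℳ (ofLex (a + (δ + b))) := fun a b =>
      hM.smul_mem _ _ _ _ (hF a) (hG b)
    have key : F a0 • G b0 = 0 := by
      have h3 := congrArg pr h0
      rw [Finset.sum_smul, map_zero, map_sum, Finset.sum_eq_single a0] at h3
      · rw [Finset.smul_sum, map_sum, Finset.sum_eq_single b0] at h3
        · rwa [h1 _ (hmem a0 b0)] at h3
        · intro b hb hne
          refine h2 _ ?_ _ (hmem a0 b)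
          intro h
          have h := ofLex.injective h
          simp at h
          exact hne h
        · intro h; simp at h
      · intro a ha hne
        have ha : a < a0 := hA a ((Finset.mem_insert.1 ha).resolve_left hne)
        rw [Finset.smul_sum, map_sum]
        refine Finset.sum_eq_zero fun b hb => ?_
        refine h2 _ ?_ _ (hmem a b)
        intro h
        have h := ofLex.injective h
        have hb : b ≤ b0 := by
          rcases Finset.mem_insert.1 hb with rfl | hb
          · exact le_rfl
          · exact (hB b hb).le
        have : a + (δ + b) < a0 + (δ + b0) := by
          refine add_lt_add_of_lt_of_le ha ?_
          gcongr
        exact absurd h this.ne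
      · intro h; simp at h
    have e : F a0 • (∑ b ∈ insert b0 B, G b) = ∑ b ∈ B, F a0 • G b := by
      rw [Finset.sum_insert hb0, smul_add, key, zero_add, Finset.smul_sum]
    obtain ⟨N, hN⟩ := ih (a0 + δ) (fun b => F a0 • G b) (fun b => by
      rw [add_assoc]; exact hmem a0 b) (by
      rw [← e, smul_comm, h0, smul_zero])
    refine ⟨N + 1, ?_⟩
    rw [pow_succ, mul_smul, e, hN]

lemma comps_mem {M : Type} [AddCommGroup M] [Module (BGS K m n) M]
    (ℳ : ℕ × ℕ → AddSubgroup M) (hM : IsBigrading K m n M ℳ) (u : M) (p : Ideal (BGS K m n))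
    (hp : p.IsPrime) (hu : ∀ a, a ∈ p ↔ a • u = 0)
    (F : ℕ ×ₗ ℕ → BGS K m n)
    (hF : ∀ a, IsWeightedHomogeneous (bwt m n) (F a) (ofLex a)) (A : Finset (ℕ ×ₗ ℕ)) :
    ∑ a ∈ A, F a ∈ p → ∀ a ∈ A, F a ∈ p := by
  classical
  induction A using Finset.induction_on_max with
  | empty => simp
  | insert a0 A hA ih =>
    intro h
    have h0 : F a0 ∈ p := by
      obtain ⟨B, G, hG, rfl⟩ := exists_dec ℳ hM.internal u
      obtain ⟨N, hN⟩ := topkill ℳ hM a0 A hA F hF B 0 G (by simpa using hG) ((hu _).1 h)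
      exact hp.mem_of_pow_mem N ((hu _).2 hN)
    have ha0 : a0 ∉ A := fun h => lt_irrefl _ (hA _ h)
    rw [Finset.sum_insert ha0] at h
    have h1 := (Ideal.add_mem_iff_right _ h0).1 h
    intro a ha
    rcases Finset.mem_insert.1 ha with rfl | ha
    · exact h0
    · exact ih h1 a ha

lemma bdec (f : BGS K m n) : ∃ A : Finset (ℕ ×ₗ ℕ),
    f = ∑ a ∈ A, weightedHomogeneousComponent (bwt m n) (ofLex a) f ∧
    ∀ a ∉ A, weightedHomogeneousComponent (bwt m n) (ofLex a) f = 0 := by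
  classical
  have hfin := weightedHomogeneousComponent_finsupp (w := bwt m n) f
  have h := sum_weightedHomogeneousComponent (bwt m n) f
  refine ⟨hfin.toFinset.map toLex.toEmbedding, ?_, ?_⟩
  · rw [Finset.sum_map]
    rw [finsum_eq_sum _ hfin] at h
    exact h.symm
  · intro a ha
    by_contra hc
    exact ha (Finset.mem_map.2 ⟨ofLex a, hfin.mem_toFinset.2 hc, rfl⟩)

lemma comp_mem {M : Type} [AddCommGroup M] [Module (BGS K m n) M]
    (ℳ : ℕ × ℕ → AddSubgroup M) (hM : IsBigrading K m n M ℳ) (u : M) (p : Ideal (BGS K m n))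
    (hp : p.IsPrime) (hu : ∀ a, a ∈ p ↔ a • u = 0) (f : BGS K m n) (hf : f ∈ p) (d : ℕ × ℕ) :
    weightedHomogeneousComponent (bwt m n) d f ∈ p := by
  obtain ⟨A, hA, hA'⟩ := bdec f
  by_cases hd : toLex d ∈ A
  · refine comps_mem ℳ hM u p hp hu
      (fun a => weightedHomogeneousComponent (bwt m n) (ofLex a) f)
      (fun a => weightedHomogeneousComponent_isWeightedHomogeneous _ _) A ?_ _ hd
    rw [← hA]; exact hf
  · have := hA' _ hd
    rw [ofLex_toLex] at this
    rw [this]; exact p.zero_mem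

lemma bwt_fst (d : Fin m ⊕ Fin n →₀ ℕ) :
    Finsupp.weight (bwt m n) d = (∑ i, d (Sum.inl i), ∑ j, d (Sum.inr j)) := by
  rw [Finsupp.weight_apply, Finsupp.sum_fintype _ _ (by simp), Fintype.sum_sum_type]
  simp only [bwt, Sum.elim_inl, Sum.elim_inr]
  ext <;> simp [Prod.fst_sum, Prod.snd_sum]

/-- h1 -/
lemma one_sub_notMem {M : Type} [AddCommGroup M] [Module (BGS K m n) M]
    (ℳ : ℕ × ℕ → AddSubgroup M) (hM : IsBigrading K m n M ℳ) (u : M) (p : Ideal (BGS K m n))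
    (hp : p.IsPrime) (hu : ∀ a, a ∈ p ↔ a • u = 0) (r : BGS K m n) (hr : r ∈ idealQ K m n) :
    1 - r ∉ p := by
  classical
  intro h
  have h1 := comp_mem ℳ hM u p hp hu _ h 0
  have h2 : weightedHomogeneousComponent (bwt m n) 0 (1 - r) = 1 := by
    ext d
    rw [coeff_weightedHomogeneousComponent]
    have hQ : idealQ K m n = Ideal.span (X '' (Set.range Sum.inr)) := by
      unfold idealQ; rw [← Set.range_comp]; rfl
    rw [hQ, mem_ideal_span_X_image] at hr
    rw [bwt_fst]
    by_cases hd : d = 0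
    · subst hd
      have : coeff 0 r = 0 := by
        by_contra hc
        obtain ⟨i, _, hi⟩ := hr 0 (mem_support_iff.2 hc)
        simp at hi
      simp only [coeff_sub, this, sub_zero]
      rw [if_pos (by ext <;> simp)]
    · rw [if_neg, coeff_one, if_neg (Ne.symm hd)]
      intro h
      apply hd
      rw [Prod.ext_iff] at h
      simp only [Prod.fst_zero, Prod.snd_zero, Finset.sum_eq_zero_iff, Finset.mem_univ,
        true_implies] at h
      ext i
      rcases i with i | i
      · exact h.1 i
      · exact h.2 i
  rw [h2] at h1
  exact hp.ne_top ((Ideal.eq_top_iff_one _).2 h1)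

lemma mem_P_of_pos (f : BGS K m n) (a b : ℕ) (ha : a ≠ 0)
    (hf : IsWeightedHomogeneous (bwt m n) f (a, b)) : f ∈ idealP K m n := by
  have hP : idealP K m n = Ideal.span (X '' (Set.range Sum.inl)) := by
    unfold idealP; rw [← Set.range_comp]; rfl
  rw [hP, mem_ideal_span_X_image]
  intro d hd
  have := hf (mem_support_iff.1 hd)
  rw [bwt_fst, Prod.mk.injEq] at this
  by_contra hc
  push Not at hc
  apply ha
  rw [← this.1]
  exact Finset.sum_eq_zero fun i _ => hc _ ⟨i, rfl⟩

lemma homog_of_bi (f : BGS K m n) (D : ℕ)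
    (hf : IsWeightedHomogeneous (bwt m n) f (0, D)) : IsHomogeneous f D := by
  intro d hd
  have := hf hd
  rw [bwt_fst, Prod.mk.injEq] at this
  rw [Finsupp.weight_apply, Finsupp.sum_fintype _ _ (by simp), Fintype.sum_sum_type]
  simp [this.1, this.2]

/-- setting the `x`-variables to zero -/
def pj (K : Type) [Field K] (m n : ℕ) : BGS K m n →ₐ[K] BGS K m n :=
  aeval (Sum.elim (fun _ => 0) (fun j => X (Sum.inr j)))

lemma pj_fix (f : BGS K m n) (D : ℕ)
    (hf : IsWeightedHomogeneous (bwt m n) f (0, D)) : pj K m n f = f := by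
  conv_rhs => rw [f.as_sum]
  conv_lhs => rw [f.as_sum]
  rw [map_sum]
  refine Finset.sum_congr rfl fun d hd => ?_
  have := hf (mem_support_iff.1 hd)
  rw [bwt_fst, Prod.mk.injEq] at this
  have h0 : ∀ i, d (Sum.inl i) = 0 := by
    have := this.1
    rw [Finset.sum_eq_zero_iff] at this
    exact fun i => this i (Finset.mem_univ _)
  rw [pj, aeval_monomial, monomial_eq]
  congr 1
  rw [Finsupp.prod, Finsupp.prod]
  refine Finset.prod_congr rfl fun i hi => ?_
  rcases i with i | i
  · rw [h0 i]; simp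
  · simp

lemma pj_P : (idealP K m n).map (pj K m n) ≤ ⊥ := by
  unfold idealP
  rw [Ideal.map_span, Ideal.span_le]
  rintro _ ⟨_, ⟨i, rfl⟩, rfl⟩
  simp [pj]

lemma pj_Q : (idealQ K m n).map (pj K m n) = idealQ K m n := by
  unfold idealQ
  rw [Ideal.map_span]
  congr 1
  ext f
  simp [pj]

lemma pj_Vk (k : ℕ) (v : BGS K m n) (hv : v ∈ Vk K m n k) : pj K m n v = v := by
  have : Vk K m n k ≤ LinearMap.eqLocus (pj K m n).toLinearMap LinearMap.id := by
    refine Submodule.span_le.2 ?_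
    rintro _ ⟨j, rfl⟩
    simp [pj]
  exact this hv

end Fin1

end

section
namespace Fin1
open Bridge Alg RingTheory.Sequence
open scoped Pointwise
open Abelian.Ext (mk₀)

section gen
variable {R : Type} [CommRing R]

lemma VV_iso (Q : Ideal R) (A B : ModuleCat.{0} R) (e : A ≃ₗ[R] B) (d : ℕ) (h : VV Q A d) :
    VV Q B d := by
  intro i hi x
  have h1 := h i hi (x.comp (mk₀ (e.toModuleIso.inv)) (add_zero _))
  have h2 : (x.comp (mk₀ (e.toModuleIso.inv)) (add_zero _)).comp (mk₀ (e.toModuleIso.hom))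
    (add_zero _) = x := by
    rw [Abelian.Ext.comp_assoc_of_third_deg_zero, Abelian.Ext.mk₀_comp_mk₀,
      Iso.inv_hom_id, Abelian.Ext.comp_mk₀_id]
  rw [← h2, h1]; simp

def quotIso (I : Ideal R) (f : R) : QuotSMulTop f (R ⧸ I) ≃ₗ[R] R ⧸ (I ⊔ Ideal.span {f}) :=
  (Submodule.quotEquivOfEq _ _ (by
    ext x
    obtain ⟨x, rfl⟩ := Submodule.Quotient.mk_surjective _ x
    rw [Submodule.mem_smul_pointwise_iff_exists]
    constructor
    · rintro ⟨b, -, hb⟩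
      obtain ⟨b, rfl⟩ := Submodule.Quotient.mk_surjective _ b
      rw [← hb]
      exact ⟨f • b, Ideal.mem_sup_right (Ideal.mul_mem_right _ _
        (Ideal.subset_span rfl)), rfl⟩
    · rintro ⟨z, hz, hz'⟩
      rw [← hz']
      obtain ⟨a, ha, b, hb, rfl⟩ := Submodule.mem_sup.1 hz
      obtain ⟨c, rfl⟩ := Ideal.mem_span_singleton'.1 hb
      refine ⟨Submodule.Quotient.mk c, trivial, ?_⟩
      rw [← Submodule.Quotient.mk_smul, Submodule.mkQ_apply, Submodule.Quotient.eq]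
      have : f • c - (a + c * f) = - a := by rw [smul_eq_mul]; ring
      rw [this]
      exact neg_mem ha)).trans
  (Submodule.quotientQuotientEquivQuotient I (I ⊔ Ideal.span {f}) le_sup_left)

lemma VV_sup (Q I : Ideal R) (f : R) (hf : IsSMulRegular (R ⧸ I) f) (d : ℕ)
    (h : VV Q (ModuleCat.of R (R ⧸ I)) (d + 1)) :
    VV Q (ModuleCat.of R (R ⧸ (I ⊔ Ideal.span {f}))) d :=
  VV_iso Q _ _ (quotIso I f) d (VV_quot Q _ d h f hf)

lemma dim_sup (I : Ideal R) (f : R) (hf : IsSMulRegular (R ⧸ I) f) (d : ℕ)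
    (h : ringKrullDim (R ⧸ I) ≤ (d + 1 : ℕ)) :
    ringKrullDim (R ⧸ (I ⊔ Ideal.span {f})) ≤ d := by
  have h1 : Ideal.Quotient.mk I f ∈ nonZeroDivisors (R ⧸ I) := by
    rw [mem_nonZeroDivisors_iff_right]
    intro x hx
    refine hf ?_
    simp only [smul_zero]
    rw [Algebra.smul_def, mul_comm]
    exact hx
  have h2 := ringKrullDim_quotient_succ_le_of_nonZeroDivisor h1
  have e := DoubleQuot.quotQuotEquivQuotSup I (Ideal.span {f})
  rw [Ideal.map_span, Set.image_singleton] at e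
  rw [ringKrullDim_eq_of_ringEquiv e] at h2
  have h3 := h2.trans h
  push_cast at h3
  generalize ringKrullDim (R ⧸ (I ⊔ Ideal.span {f})) = x at h3
  induction x using WithBot.recBotCoe with
  | bot => exact bot_le
  | coe x =>
    have h4 : x + 1 ≤ (d : ℕ∞) + 1 := by exact_mod_cast h3
    have h5 : x ≤ (d : ℕ∞) := by
      exact (ENat.add_le_add_iff_right (by simp)).1 h4
    exact_mod_cast h5

lemma dim_list (rs : List R) : ∀ (I : Ideal R) (d : ℕ), IsWeaklyRegular (R ⧸ I) rs →
    ringKrullDim (R ⧸ I) ≤ (d + rs.length : ℕ) →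
    ringKrullDim (R ⧸ (I ⊔ Ideal.ofList rs)) ≤ d := by
  induction rs with
  | nil =>
    intro I d _ h
    rw [Ideal.ofList_nil, sup_bot_eq]
    simpa using h
  | cons r rs ih =>
    intro I d hr h
    rw [isWeaklyRegular_cons_iff, (quotIso I r).isWeaklyRegular_congr] at hr
    have := ih (I ⊔ Ideal.span {r}) d hr.2 (dim_sup I r hr.1 _ (by simpa [add_assoc] using h))
    rwa [Ideal.ofList_cons, ← sup_assoc]

end gen

variable {K : Type} [Field K] {m n : ℕ}

attribute [local instance] MvPolynomial.gradedAlgebra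

lemma dimP : ringKrullDim (BGS K m n ⧸ idealP K m n) ≤ n := by
  have h0 : ringKrullDim (BGS K m n) ≤ (n + (xs K m n).length : ℕ) := by
    rw [xs_length, MvPolynomial.ringKrullDim_of_isNoetherianRing]
    simp [add_comm]
  have e : BGS K m n ≃ₗ[BGS K m n] (BGS K m n ⧸ (⊥ : Ideal (BGS K m n))) :=
    (Submodule.quotEquivOfEqBot _ rfl).symm
  have h1 := dim_list (xs K m n) ⊥ n ((e.isWeaklyRegular_congr _).1 (xs_reg K m n)) (by
    rwa [ringKrullDim_eq_of_ringEquiv (RingEquiv.quotientBot (BGS K m n))])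
  rwa [xs_ofList, bot_sup_eq] at h1

def HI (I : Ideal (BGS K m n)) : Prop :=
  I.IsHomogeneous (homogeneousSubmodule (Fin m ⊕ Fin n) K)

lemma HI_span (s : Set (BGS K m n)) (hs : ∀ f ∈ s, ∃ d, IsHomogeneous f d) :
    HI (Ideal.span s) :=
  Ideal.homogeneous_span _ _ fun f hf => by
    obtain ⟨d, hd⟩ := hs f hf
    exact ⟨d, hd⟩

lemma HI_sup {I J : Ideal (BGS K m n)} (hI : HI I) (hJ : HI J) : HI (I ⊔ J) :=
  Ideal.IsHomogeneous.sup hI hJ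

lemma HI_P : HI (idealP K m n) := HI_span _ (by
  rintro _ ⟨i, rfl⟩; exact ⟨1, isHomogeneous_X _ _⟩)

lemma Vk_homog (k : ℕ) (v : BGS K m n) (hv : v ∈ Vk K m n k) : IsHomogeneous v k := by
  have : Vk K m n k ≤ homogeneousSubmodule _ K k := by
    refine Submodule.span_le.2 ?_
    rintro _ ⟨j, rfl⟩
    exact isHomogeneous_X_pow _ _
  exact this hv

lemma pow_le_of_dim (I : Ideal (BGS K m n)) (hI : HI I) (h : ringKrullDim (BGS K m n ⧸ I) ≤ 0) :
    ∃ t, idealQ K m n ^ t ≤ I := by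
  refine Ideal.exists_pow_le_of_le_radical_of_fg ?_ (IsNoetherian.noetherian _)
  rw [Ideal.IsHomogeneous.radical_eq hI]
  refine le_sInf ?_
  rintro J ⟨hJ, hIJ, hJp⟩
  have hk : Ring.KrullDimLE 0 (BGS K m n ⧸ I) := Ring.krullDimLE_iff.2 (by simpa using h)
  have hker : RingHom.ker (Ideal.Quotient.mk I) ≤ J := by rwa [Ideal.mk_ker]
  have hp2 : (J.map (Ideal.Quotient.mk I)).IsPrime :=
    Ideal.map_isPrime_of_surjective Ideal.Quotient.mk_surjective hker
  have hm2 : (J.map (Ideal.Quotient.mk I)).IsMaximal := inferInstance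
  have hc : (J.map (Ideal.Quotient.mk I)).comap (Ideal.Quotient.mk I) = J := by
    rw [Ideal.comap_map_of_surjective _ Ideal.Quotient.mk_surjective]
    exact sup_eq_left.2 hker
  have hJm : J.IsMaximal := by
    rw [← hc]
    exact Ideal.comap_isMaximal_of_surjective _ Ideal.Quotient.mk_surjective
  have hJle : J ≤ idealOfVars (Fin m ⊕ Fin n) K := by
    intro f hf
    have h0 := (mem_iff_homogeneousComponent_mem hJ f).1 hf 0
    rw [homogeneousComponent_zero] at h0
    have : coeff 0 f = 0 := by
      by_contra hc
      exact hJp.ne_top (Ideal.eq_top_of_isUnit_mem _ h0 ((isUnit_iff_ne_zero.2 hc).map C))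
    rw [← pow_one (idealOfVars _ _), mem_pow_idealOfVars_iff']
    intro x hx
    have : x = 0 := by
      rw [← Finsupp.degree_eq_zero_iff]; omega
    rw [this]; assumption
  have hne : idealOfVars (Fin m ⊕ Fin n) K ≠ ⊤ := by
    intro h
    have := (Ideal.eq_top_iff_one _).1 h
    rw [← pow_one (idealOfVars _ _), mem_pow_idealOfVars_iff'] at this
    have := this 0 (by simp)
    simp at this
  have := hJm.eq_of_le hne hJle
  rw [this]
  refine Ideal.span_mono ?_
  rintro _ ⟨j, rfl⟩
  exact ⟨_, rfl⟩

structure Good (I : Ideal (BGS K m n)) (d : ℕ) : Prop where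
  hom : HI I
  vv : VV (idealQ K m n) (ModuleCat.of _ (BGS K m n ⧸ I)) d
  dim : ringKrullDim (BGS K m n ⧸ I) ≤ d

lemma Good_P : Good (idealP K m n) n := ⟨HI_P, VVP K m n, dimP⟩

lemma Good.pow {I : Ideal (BGS K m n)} {d : ℕ} (h : Good I d) (k : ℕ) (rs : List (BGS K m n))
    (hl : rs.length = d) (hr : ∀ r ∈ rs, r ∈ Vk K m n k)
    (hreg : IsWeaklyRegular (BGS K m n ⧸ I) rs) :
    ∃ t, idealQ K m n ^ t ≤ I ⊔ Ideal.ofList rs := by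
  refine pow_le_of_dim _ (HI_sup h.hom (HI_span _ fun f hf => ⟨k, Vk_homog k f (hr f hf)⟩)) ?_
  have := dim_list rs I 0 hreg (by simpa [hl] using h.dim)
  simpa using this

lemma Good.step {I : Ideal (BGS K m n)} {d : ℕ} (h : Good I (d + 1)) (f : BGS K m n) (D : ℕ)
    (hf : IsHomogeneous f D) (hr : IsSMulRegular (BGS K m n ⧸ I) f) :
    Good (I ⊔ Ideal.span {f}) d :=
  ⟨HI_sup h.hom (HI_span _ (by rintro _ rfl; exact ⟨D, hf⟩)), VV_sup _ _ f hr d h.vv,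
    dim_sup I f hr d h.dim⟩

end Fin1

end

section
namespace Fin1
open Bridge Alg RingTheory.Sequence
open scoped Pointwise

lemma ass_elt {R : Type} [CommRing R] [IsNoetherianRing R] (N : Type) [AddCommGroup N] [Module R N]
    (p : Ideal R) (hp : p ∈ associatedPrimes R N) :
    p.IsPrime ∧ ∃ u : N, ∀ a, a ∈ p ↔ a • u = 0 := by
  obtain ⟨hpr, φ, hφ⟩ := isAssociatedPrime_iff_exists_injective_linearMap p (M := N) |>.1 hp
  refine ⟨hpr, φ (Submodule.Quotient.mk 1), fun a => ?_⟩
  rw [← map_smul, map_eq_zero_iff φ hφ, ← Submodule.Quotient.mk_smul,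
    Submodule.Quotient.mk_eq_zero]
  simp

lemma mk_mem_smul {R : Type} [CommRing R] (I J : Ideal R) (a : R) :
    (Submodule.Quotient.mk a : R ⧸ I) ∈ (J • ⊤ : Submodule R (R ⧸ I)) ↔ a ∈ I ⊔ J := by
  have h : (J • ⊤ : Submodule R (R ⧸ I)) = Submodule.map (Submodule.mkQ I) J := by
    have : J = J • (⊤ : Submodule R R) := by simp
    conv_rhs => rw [this, Submodule.map_smul'', Submodule.map_top, Submodule.range_mkQ]
  rw [h]
  change a ∈ Submodule.comap (Submodule.mkQ I) (Submodule.map (Submodule.mkQ I) J) ↔ _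
  rw [Submodule.comap_map_mkQ]

variable {K : Type} [Field K] {m n : ℕ}

attribute [local instance] MvPolynomial.gradedAlgebra

lemma Q_le_vars : idealQ K m n ≤ idealOfVars (Fin m ⊕ Fin n) K := by
  refine Ideal.span_mono ?_
  rintro _ ⟨j, rfl⟩
  exact ⟨_, rfl⟩

lemma mem_of_forall (I : Ideal (BGS K m n)) (hI : HI I) (u : BGS K m n)
    (h : ∀ k, 0 < k → u ∈ I ⊔ idealQ K m n ^ k) : u ∈ I := by
  rw [mem_iff_homogeneousComponent_mem hI]
  intro i
  obtain ⟨a, ha, b, hb, rfl⟩ := Submodule.mem_sup.1 (h (i + 1) (by omega))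
  have hb2 := Ideal.pow_right_mono (Q_le_vars (K := K) (m := m) (n := n)) (i + 1) hb
  rw [mem_pow_idealOfVars_iff'] at hb2
  have h0 : homogeneousComponent i b = 0 := by
    ext d
    rw [coeff_homogeneousComponent, coeff_zero]
    split_ifs with hd
    · exact hb2 d (by omega)
    · rfl
  rw [map_add, h0, add_zero]
  exact (mem_iff_homogeneousComponent_mem hI a).1 ha i

lemma Vk_mem_Q (k : ℕ) (hk : 0 < k) (v : BGS K m n) (hv : v ∈ Vk K m n k) : v ∈ idealQ K m n :=
  Ideal.pow_le_self (by omega) (Vk_le K m n k v hv)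

lemma Vk_list_le (k : ℕ) (rs : List (BGS K m n)) (h : ∀ r ∈ rs, r ∈ Vk K m n k) :
    Ideal.ofList rs ≤ idealQ K m n ^ k :=
  Ideal.span_le.2 fun r hr => Vk_le K m n k r (h r hr)

lemma caseb [Infinite K] (p : Ideal (BGS K m n)) (g : ℕ)
    (hp : ∀ i > g, DD (idealQ K m n) (ModuleCat.of _ (BGS K m n ⧸ p)) i)
    (I : Ideal (BGS K m n)) (d : ℕ) (hd : g < d) (hG : Good I d) (p2 : Ideal (BGS K m n))
    (hp2 : p2 ∈ associatedPrimes (BGS K m n) (BGS K m n ⧸ I)) : ¬ p ≤ p2 := by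
  intro hle
  obtain ⟨hpr, u, hu⟩ := ass_elt _ p2 hp2
  obtain ⟨u, rfl⟩ := Submodule.Quotient.mk_surjective _ u
  have hu0 : u ∈ I := by
    refine mem_of_forall I hG.hom u fun k hk => ?_
    obtain ⟨rs, hl, hr, hreg, -⟩ := L2 (idealQ K m n) (Vk K m n k) (Vk_prime K m n k) d
      (ModuleCat.of _ (BGS K m n ⧸ I)) (ModuleCat.of _ (BGS K m n ⧸ I))
      (inferInstanceAs (Module.Finite _ (BGS K m n ⧸ I)))
      (inferInstanceAs (Module.Finite _ (BGS K m n ⧸ I))) hG.vv hG.vv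
    obtain ⟨t, ht⟩ := hG.pow k rs hl hr hreg
    obtain ⟨e, he⟩ := L3' (idealQ K m n) rs (BGS K m n ⧸ I) hreg
      (fun r h => Vk_mem_Q k hk r (hr r h)) t (Submodule.Quotient.mk 1) (by
        intro a ha
        rw [← Submodule.Quotient.mk_smul, mk_mem_smul]
        simpa using ht ha)
    subst hl
    obtain ⟨t', h, h0⟩ := mul_dies (idealQ K m n) p rs.length
      (cd_lemma (idealQ K m n) p n g (fun N i hi => DDn K m n N i hi) hp (n + 1) rs.length hd
        (by omega)) (BGS K m n ⧸ I) u (by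
        intro a ha x
        obtain ⟨x, rfl⟩ := Submodule.Quotient.mk_surjective _ x
        have h1 := (hu a).1 (hle ha)
        rw [← Submodule.Quotient.mk_smul, Submodule.Quotient.mk_eq_zero] at h1
        rw [← Submodule.Quotient.mk_smul, ← Submodule.Quotient.mk_smul,
          Submodule.Quotient.mk_eq_zero]
        have : a • u • x = (a • u) * x := by simp [mul_assoc]
        rw [this]
        exact Ideal.mul_mem_right _ _ h1) t e
    have h2 := he u t' h h0
    rw [← Submodule.Quotient.mk_smul, mk_mem_smul] at h2
    have h3 : u ∈ I ⊔ Ideal.ofList rs := by simpa using h2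
    exact (sup_le_sup_left (Vk_list_le k rs hr) I) h3
  have : (1 : BGS K m n) ∈ p2 := (hu 1).2 (by
    rw [(Submodule.Quotient.mk_eq_zero I).2 hu0, smul_zero])
  exact hpr.ne_top ((Ideal.eq_top_iff_one _).2 this)

lemma bihom_y (j : Fin n) (e : ℕ) :
    IsWeightedHomogeneous (bwt m n) (X (Sum.inr j) ^ e : BGS K m n) (0, e) := by
  have := (isWeightedHomogeneous_X K (bwt m n) (Sum.inr j)).pow e
  simpa [bwt] using this

lemma casea [Infinite K] (p : Ideal (BGS K m n))
    (hcomp : ∀ f ∈ p, ∀ d, weightedHomogeneousComponent (bwt m n) d f ∈ p)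
    (I : Ideal (BGS K m n)) (hPI : idealP K m n ≤ I) (d : ℕ) (hG : Good I (d + 1))
    (H : ∀ p2 ∈ associatedPrimes (BGS K m n) (BGS K m n ⧸ I), ¬ p ≤ p2) :
    ∃ f ∈ p, ∃ D, IsWeightedHomogeneous (bwt m n) f (0, D) ∧
      IsSMulRegular (BGS K m n ⧸ I) f := by
  classical
  set A := associatedPrimes (BGS K m n) (BGS K m n ⧸ I) with hA
  have hfin : A.Finite := associatedPrimes.finite _ _
  have h1 : ∀ p2 ∈ A, ∃ D, ∀ D' ≥ D, ∃ v ∈ p, IsWeightedHomogeneous (bwt m n) v (0, D') ∧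
      v ∉ p2 := by
    intro p2 hp2
    have hpr : p2.IsPrime := (ass_elt _ p2 hp2).1
    have hIp2 : I ≤ p2 := by
      obtain ⟨_, u, hu⟩ := ass_elt _ p2 hp2
      intro a ha
      rw [hu]
      obtain ⟨u, rfl⟩ := Submodule.Quotient.mk_surjective _ u
      rw [← Submodule.Quotient.mk_smul, Submodule.Quotient.mk_eq_zero]
      exact Ideal.mul_mem_right _ _ ha
    have hQ := ass_not_ge (idealQ K m n) (ModuleCat.of _ (BGS K m n ⧸ I)) (d + 1) (by omega)
      hG.vv p2 hp2
    obtain ⟨j, hj⟩ : ∃ j : Fin n, (X (Sum.inr j) : BGS K m n) ∉ p2 := by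
      by_contra hc
      push Not at hc
      apply hQ
      refine Ideal.span_le.2 ?_
      rintro _ ⟨j, rfl⟩
      exact hc j
    obtain ⟨w, hw, hw2⟩ := Set.not_subset.1 (H p2 hp2)
    obtain ⟨B, hB, -⟩ := bdec w
    obtain ⟨b, hb⟩ : ∃ b : ℕ ×ₗ ℕ, weightedHomogeneousComponent (bwt m n) (ofLex b) w ∉ p2 := by
      by_contra hc
      push Not at hc
      apply hw2
      rw [hB]
      exact Ideal.sum_mem _ fun b _ => hc b
    have hwh := weightedHomogeneousComponent_isWeightedHomogeneous (w := bwt m n) (ofLex b) w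
    have hb0 : (ofLex b).1 = 0 := by
      by_contra hc
      exact hb (hIp2 (hPI (mem_P_of_pos _ (ofLex b).1 (ofLex b).2 hc hwh)))
    refine ⟨(ofLex b).2, fun D' hD' => ⟨X (Sum.inr j) ^ (D' - (ofLex b).2) *
      weightedHomogeneousComponent (bwt m n) (ofLex b) w,
      Ideal.mul_mem_left _ _ (hcomp w hw _), ?_, ?_⟩⟩
    · have := (bihom_y (K := K) (m := m) j (D' - (ofLex b).2)).mul hwh
      convert this using 1
      ext
      · simp [hb0]
      · simp; omega
    · intro h
      rcases hpr.mem_or_mem h with h | h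
      · exact hj (hpr.mem_of_pow_mem _ h)
      · exact hb h
  choose! D hD using h1
  obtain ⟨f, hf, hf2⟩ := avoid (K := K) (weightedHomogeneousSubmodule K (bwt m n)
      (0, hfin.toFinset.sup D) ⊓ p.restrictScalars K) A hfin (by
    intro p2 hp2
    obtain ⟨v, hv, hv1, hv2⟩ := hD p2 hp2 (hfin.toFinset.sup D)
      (Finset.le_sup (f := D) (hfin.mem_toFinset.2 hp2))
    exact ⟨v, ⟨hv1, hv⟩, hv2⟩)
  exact ⟨f, hf.2, _, hf.1, reg_of_avoid _ f hf2⟩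

lemma partII [Infinite K] (p : Ideal (BGS K m n))
    (hcomp : ∀ f ∈ p, ∀ d, weightedHomogeneousComponent (bwt m n) d f ∈ p) (g : ℕ)
    (hp : ∀ i > g, DD (idealQ K m n) (ModuleCat.of _ (BGS K m n ⧸ p)) i) :
    ∀ k d, d + k = n → g ≤ d → ∃ F : Ideal (BGS K m n), F ≤ p ∧ F.map (pj K m n) ≤ F ∧
      Good (idealP K m n ⊔ F) d := by
  intro k
  induction k with
  | zero =>
    rintro d rfl _
    refine ⟨⊥, bot_le, by simp, ?_⟩
    rw [sup_bot_eq]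
    exact Good_P
  | succ k ih =>
    intro d hdk hgd
    obtain ⟨F, hF, hFm, hG⟩ := ih (d + 1) (by omega) (by omega)
    obtain ⟨f, hf, D, hfD, hreg⟩ := casea p hcomp (idealP K m n ⊔ F) le_sup_left d hG
      (fun p2 hp2 => caseb p g hp _ (d + 1) (by omega) hG p2 hp2)
    refine ⟨F ⊔ Ideal.span {f}, sup_le hF ?_, ?_, ?_⟩
    · rw [Ideal.span_le]; rintro _ rfl; exact hf
    · rw [Ideal.map_sup, Ideal.map_span, Set.image_singleton, pj_fix f D hfD]
      exact sup_le_sup_right hFm _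
    · rw [← sup_assoc]
      exact hG.step f D (homog_of_bi f D hfD) hreg

lemma partI [Infinite K] (M : Type) [AddCommGroup M] [Module (BGS K m n) M]
    [Module.Finite (BGS K m n) M] (g : ℕ) (hg : 0 < g)
    (hV : VV (idealQ K m n) (ModuleCat.of _ M) g) (p F : Ideal (BGS K m n)) (hF : F ≤ p)
    (hFm : F.map (pj K m n) ≤ F) (hG : Good (idealP K m n ⊔ F) g) (u : M)
    (hu : ∀ a, a ∈ p ↔ a • u = 0) (h1 : ∀ r ∈ idealQ K m n, 1 - r ∉ p)
    (hfin : Module.Finite (BGS K m n) (LC (idealQ K m n) g (ModuleCat.of _ M))) : False := by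
  obtain ⟨N0, hN0⟩ := B3 _ _ _ hfin
  have fin1 : Module.Finite (BGS K m n) (ModuleCat.of (BGS K m n) M) :=
    inferInstanceAs (Module.Finite _ M)
  have fin2 : Module.Finite (BGS K m n) (ModuleCat.of (BGS K m n) (BGS K m n ⧸ (idealP K m n ⊔ F))) :=
    inferInstanceAs (Module.Finite _ (BGS K m n ⧸ (idealP K m n ⊔ F)))
  obtain ⟨a, haV, haM⟩ : ∃ a ∈ Vk K m n N0, IsSMulRegular M a := by
    obtain ⟨rs, hl, hr, hreg, -⟩ := L2 (idealQ K m n) (Vk K m n N0) (Vk_prime K m n N0) g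
      (ModuleCat.of _ M) (ModuleCat.of _ M) fin1 fin1 hV hV
    rcases rs with _ | ⟨a, rs⟩
    · simp at hl; omega
    · exact ⟨a, hr a (by simp), ((isWeaklyRegular_cons_iff _ _ _).1 hreg).1⟩
  have key : ∀ k, 0 < k → a • u ∈ (idealQ K m n ^ k • ⊤ : Submodule (BGS K m n) M) := by
    intro k hk
    obtain ⟨rs, hl, hr, hregM, hregC⟩ := L2 (idealQ K m n) (Vk K m n k) (Vk_prime K m n k) g
      (ModuleCat.of _ M) (ModuleCat.of _ (BGS K m n ⧸ (idealP K m n ⊔ F))) fin1 fin2 hV hG.vv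
    obtain ⟨t, ht⟩ := hG.pow k rs hl hr hregC
    have ht2 : idealQ K m n ^ t ≤ F ⊔ Ideal.ofList rs := by
      have := Ideal.map_mono (f := pj K m n) ht
      rw [Ideal.map_pow, pj_Q, Ideal.map_sup, Ideal.map_sup] at this
      refine this.trans (sup_le (sup_le (pj_P.trans bot_le) (hFm.trans le_sup_left)) ?_)
      refine le_trans ?_ le_sup_right
      rw [Ideal.ofList, Ideal.map_span, Ideal.span_le]
      rintro _ ⟨r, hr', rfl⟩
      rw [pj_Vk k r (hr r hr')]
      exact Ideal.subset_span hr'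
    obtain ⟨e, he⟩ := L3' (idealQ K m n) rs M hregM
      (fun r h => Vk_mem_Q k hk r (hr r h)) t u (by
        intro b hb
        obtain ⟨c, hc, b, hb', rfl⟩ := Submodule.mem_sup.1 (ht2 hb)
        rw [add_smul, (hu c).1 (hF hc), zero_add]
        exact Submodule.smul_mem_smul hb' trivial)
    subst hl
    obtain ⟨t', h, h0⟩ := hN0 t e a (Vk_le K m n N0 a haV)
    exact Submodule.smul_mono_left (Vk_list_le k rs hr) (he a t' h h0)
  have hkr : a • u ∈ (⨅ i : ℕ, idealQ K m n ^ i • ⊤ : Submodule (BGS K m n) M) := by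
    rw [Submodule.mem_iInf]
    intro i
    rcases Nat.eq_zero_or_pos i with rfl | hi
    · simp
    · exact key i hi
  obtain ⟨⟨r, hr⟩, hru⟩ := (Ideal.mem_iInf_smul_pow_eq_bot_iff _ _).1 hkr
  apply h1 r hr
  rw [hu]
  apply haM
  have : a • (1 - r) • u = a • u - r • a • u := by
    rw [sub_smul, one_smul, smul_sub, smul_comm a r]
  simp only [smul_zero]
  rw [this]
  simp only at hru
  rw [hru, sub_self]

theorem main_aux
    (K : Type) [Field K] [Infinite K] (m n : ℕ)
    (M : Type) [AddCommGroup M] [Module (BGS K m n) M] [Module.Finite (BGS K m n) M]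
    (ℳ : ℕ × ℕ → AddSubgroup M) (hM : IsBigrading K m n M ℳ)
    (hmax : HasMaximalDepth (BGS K m n) (idealQ K m n) M)
    (hg : 0 < extGrade (BGS K m n) (idealQ K m n) M) :
    ¬ Module.Finite (BGS K m n)
        ((localCohomology (idealQ K m n) (extGrade (BGS K m n) (idealQ K m n) M)).obj
          (ModuleCat.of (BGS K m n) M)) := by
  intro hfin
  have hV : VV (idealQ K m n) (ModuleCat.of _ M) (extGrade (BGS K m n) (idealQ K m n) M) := by
    intro i hi e
    have := Nat.notMem_of_lt_sInf hi
    exact B1 _ _ _ (not_nontrivial_iff_subsingleton.1 this) e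
  unfold HasMaximalDepth at hmax
  generalize extGrade (BGS K m n) (idealQ K m n) M = g at *
  obtain ⟨p, hpA, hpg⟩ : ∃ p ∈ associatedPrimes (BGS K m n) M,
      cohDim (BGS K m n) (idealQ K m n) (BGS K m n ⧸ p) = g := by
    have hne : ((fun p => cohDim (BGS K m n) (idealQ K m n) (BGS K m n ⧸ p)) ''
        associatedPrimes (BGS K m n) M).Nonempty := by
      by_contra hc
      rw [Set.not_nonempty_iff_eq_empty] at hc
      unfold mCohDim at hmax
      rw [hc, Nat.sInf_empty] at hmax
      omega
    have := Nat.sInf_mem hne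
    obtain ⟨p, hp, h⟩ := this
    exact ⟨p, hp, h.trans hmax.symm⟩
  obtain ⟨hpr, u, hu⟩ := ass_elt M p hpA
  set T := {i : ℕ | Nontrivial ((localCohomology (idealQ K m n) i).obj
    (ModuleCat.of (BGS K m n) (BGS K m n ⧸ p)))} with hT
  have hTg : sSup T = g := hpg
  have hbdd : BddAbove T := by
    by_contra hc
    rw [Nat.sSup_of_not_bddAbove hc] at hTg
    omega
  have hTne : T.Nonempty := by
    by_contra hc
    rw [Set.not_nonempty_iff_eq_empty] at hc
    rw [hc, csSup_empty] at hTg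
    simp at hTg
    omega
  have hgT : g ∈ T := hTg ▸ Nat.sSup_mem hTne hbdd
  have hp : ∀ i > g, DD (idealQ K m n) (ModuleCat.of _ (BGS K m n ⧸ p)) i := by
    intro i hi t e
    refine B2 _ _ _ (not_nontrivial_iff_subsingleton.1 fun hc => ?_) t e
    have : i ≤ sSup T := le_csSup hbdd hc
    omega
  have hgn : g ≤ n := by
    by_contra hc
    have h1 := B4 (idealQ K m n) g (by omega) (ModuleCat.of _ (BGS K m n ⧸ p))
      (DDn K m n _ g (by omega))
    exact not_nontrivial_iff_subsingleton.2 h1 hgT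
  obtain ⟨F, hF, hFm, hG⟩ := partII p (fun f hf d => comp_mem ℳ hM u p hpr hu f hf d) g hp
    (n - g) g (by omega) le_rfl
  exact partI M g hg hV p F hF hFm hG u hu
    (fun r hr => one_sub_notMem ℳ hM u p hpr hu r hr) hfin

end Fin1

end

theorem localCohomology_at_grade_not_finitely_generated
    (K : Type) [Field K] [Infinite K] (m n : ℕ)
    (M : Type) [AddCommGroup M] [Module (BGS K m n) M] [Module.Finite (BGS K m n) M]
    (ℳ : ℕ × ℕ → AddSubgroup M) (hM : IsBigrading K m n M ℳ)
    (hmax : HasMaximalDepth (BGS K m n) (idealQ K m n) M)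
    (hg : 0 < extGrade (BGS K m n) (idealQ K m n) M) :
    ¬ Module.Finite (BGS K m n)
        ((localCohomology (idealQ K m n) (extGrade (BGS K m n) (idealQ K m n) M)).obj
          (ModuleCat.of (BGS K m n) M)) := by
  exact Fin1.main_aux K m n M ℳ hM hmax hg
end
end

section
/- Suppose K is infinite, M is generalized Cohen–Macaulay with respect to Q, and grade(Q, M) > 0. Then the following statements are equivalent: (a) M has maximal depth with respect to Q; (b) M is sequentially Cohen–Macaulay with respect to Q; (c) M is Cohen–Macaulay with respect to Q. -/
open CategoryTheory MvPolynomial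

noncomputable section

/-- `M` is Cohen–Macaulay with respect to `J` if `grade(J, M) = cd(J, M)`. -/
def IsCMWrt (R : Type) [CommRing R] (J : Ideal R) (M : Type) [AddCommGroup M]
    [Module R M] : Prop :=
  extGrade R J M = cohDim R J M

/-- `M` is sequentially Cohen–Macaulay with respect to `Q`: there is a finite filtration
`0 = M_0 ⊊ M_1 ⊊ … ⊊ M_r = M` by bigraded submodules whose successive quotients are
Cohen–Macaulay with respect to `Q` with strictly increasing cohomological dimensions. -/
def IsSeqCMWrtQ (K : Type) [Field K] (m n : ℕ) (M : Type) [AddCommGroup M]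
    [Module (BGS K m n) M] (ℳ : ℕ × ℕ → AddSubgroup M) : Prop :=
  ∃ (r : ℕ) (F : Fin (r + 1) → Submodule (BGS K m n) M),
    StrictMono F ∧ F 0 = ⊥ ∧ F (Fin.last r) = ⊤ ∧
    (∀ i, IsBigradedSubmodule K m n ℳ (F i)) ∧
    (∀ i : Fin r, IsCMWrt (BGS K m n) (idealQ K m n)
      (↥(F i.succ) ⧸ (Submodule.comap (F i.succ).subtype (F i.castSucc)))) ∧
    (∀ i j : Fin r, i < j →
      cohDim (BGS K m n) (idealQ K m n)
          (↥(F i.succ) ⧸ (Submodule.comap (F i.succ).subtype (F i.castSucc))) <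
      cohDim (BGS K m n) (idealQ K m n)
          (↥(F j.succ) ⧸ (Submodule.comap (F j.succ).subtype (F j.castSucc))))

/-- `M` is generalized Cohen–Macaulay with respect to `J` if `H^i_J(M)` is finitely
generated for all `i < cd(J, M)`. -/
def IsGenCMWrt (R : Type) [CommRing R] (J : Ideal R) (M : Type) [AddCommGroup M]
    [Module R M] : Prop :=
  ∀ i < cohDim R J M, Module.Finite R ((localCohomology J i).obj (ModuleCat.of R M))

namespace GCM
open Opposite

section OldNew
variable {R : Type} [CommRing R]

/-- The chain map on Hom complexes induced by a morphism of projective resolutions. -/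
def yonMap {X X' : ModuleCat.{0} R} (P : ProjectiveResolution X) (P' : ProjectiveResolution X')
    (φ : P'.complex ⟶ P.complex) (Y : ModuleCat.{0} R) :
    P.complex.linearYonedaObj R Y ⟶ P'.complex.linearYonedaObj R Y :=
  (HomologicalComplex.unopFunctor _ _).map
    (((((linearYoneda R (ModuleCat.{0} R)).obj Y).rightOp.mapHomologicalComplex _).map φ).op)

lemma inv_nat_aux {C : Type*} [Category C] {A A' B B' : C} (m : A ⟶ A') (e : A' ≅ B') (e' : A ≅ B)
    (h : B ⟶ B') (H : m ≫ e.hom = e'.hom ≫ h) : e'.inv ≫ m = h ≫ e.inv := by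
  rw [Iso.inv_comp_eq, ← Category.assoc, Iso.eq_comp_inv, H]

lemma isoExt_nat {X X' : ModuleCat.{0} R} (P : ProjectiveResolution X)
    (P' : ProjectiveResolution X') (g : X' ⟶ X)
    (φ : P'.complex ⟶ P.complex) (comm : φ.f 0 ≫ P.π.f 0 = P'.π.f 0 ≫ g)
    (n : ℕ) (Y : ModuleCat.{0} R) :
    ((Ext R (ModuleCat.{0} R) n).map g.op).app Y ≫ (P'.isoExt n Y).hom =
     (P.isoExt n Y).hom ≫ HomologicalComplex.homologyMap (yonMap P P' φ Y) n := by
  have h1 := ProjectiveResolution.isoLeftDerivedObj_inv_naturality g P' P φ comm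
    ((linearYoneda R (ModuleCat.{0} R)).obj Y).rightOp n
  have h1' := congrArg Quiver.Hom.unop h1
  have h2 := HomologicalComplex.homologyOp_hom_naturality (yonMap P P' φ Y) n
  have h2' := congrArg Quiver.Hom.unop (inv_nat_aux _ _ _ _ h2)
  have e1 : ∀ {X : ModuleCat.{0} R} (P : ProjectiveResolution X), (P.isoExt n Y).hom =
     (P.isoLeftDerivedObj ((linearYoneda R (ModuleCat.{0} R)).obj Y).rightOp n).inv.unop ≫
      ((P.complex.linearYonedaObj R Y).homologyOp n).inv.unop := fun P => rfl
  rw [e1, e1]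
  refine (Category.assoc _ _ _).symm.trans ?_
  refine (congrArg (· ≫ ((P'.complex.linearYonedaObj R Y).homologyOp n).inv.unop) h1').trans ?_
  refine (Category.assoc _ _ _).trans ?_
  refine Eq.trans ?_ (Category.assoc _ _ _).symm
  exact congrArg ((P.isoLeftDerivedObj ((linearYoneda R (ModuleCat.{0} R)).obj Y).rightOp n).inv.unop ≫ ·) h2'

/-- A cocycle `f` on a projective resolution represents the (old) Ext class `e`. -/
def Rep {X : ModuleCat.{0} R} (P : ProjectiveResolution X) (n : ℕ) (Y : ModuleCat.{0} R)
    (e : ((Ext R (ModuleCat.{0} R) n).obj (op X)).obj Y) (f : P.complex.X n ⟶ Y) : Prop :=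
  ∃ c : (P.complex.linearYonedaObj R Y).cycles n,
    (((P.complex.linearYonedaObj R Y).iCycles n) c : P.complex.X n ⟶ Y) = f ∧
    ((P.complex.linearYonedaObj R Y).homologyπ n) c = (P.isoExt n Y).hom e

lemma cycles_exists (K : CochainComplex (ModuleCat.{0} R) ℕ) (n : ℕ) (f : K.X n)
    (hf : K.d n (n+1) f = 0) : ∃ c : K.cycles n, K.iCycles n c = f := by
  have : (K.sc n).g f = 0 := by
    have h1 : (ComplexShape.up ℕ).next n = n + 1 := by simp
    have : K.d n ((ComplexShape.up ℕ).next n) f = 0 := by rw [h1]; exact hf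
    exact this
  refine ⟨(K.sc n).moduleCatCyclesIso.inv ⟨f, this⟩, ?_⟩
  have := (K.sc n).moduleCatCyclesIso_inv_iCycles
  exact congrArg (fun (g : (K.sc n).moduleCatLeftHomologyData.K ⟶ (K.sc n).X₂) => g.hom ⟨f, ‹_›⟩) this

lemma cycles_d (K : CochainComplex (ModuleCat.{0} R) ℕ) (n : ℕ) (c : K.cycles n) :
    K.d n (n+1) (K.iCycles n c) = 0 := by
  have := K.iCycles_d n (n+1)
  exact congrArg (fun g => g.hom c) this

lemma homologyπ_zero (K : CochainComplex (ModuleCat.{0} R) ℕ) (n : ℕ) (c : K.cycles n) :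
    K.homologyπ n c = 0 ↔ ∃ b, K.d ((ComplexShape.up ℕ).prev n) n b = K.iCycles n c := by
  have h1 := (K.sc n).moduleCat_pOpcycles_eq_zero_iff ((K.sc n).iCycles c)
  have h2 := congrArg (fun g => g.hom c) (K.sc n).homology_π_ι
  have h3 : Function.Injective (K.sc n).homologyι := (ModuleCat.mono_iff_injective _).mp inferInstance
  constructor
  · intro h
    have : (K.sc n).homologyι ((K.sc n).homologyπ c) = 0 := by
      have h' : (K.sc n).homologyπ c = 0 := h
      rw [h', map_zero]
    obtain ⟨b, hb⟩ := h1.mp (h2.symm.trans this)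
    exact ⟨b, hb⟩
  · rintro ⟨b, hb⟩
    refine h3 ?_
    exact (h2.trans (h1.mpr ⟨b, hb⟩)).trans (map_zero _).symm

variable {X X' : ModuleCat.{0} R} (P : ProjectiveResolution X) (P' : ProjectiveResolution X')
  {Y : ModuleCat.{0} R} {n : ℕ}

lemma Rep.d_comp {e} {f : P.complex.X n ⟶ Y} (h : Rep P n Y e f) :
    P.complex.d (n+1) n ≫ f = 0 := by
  obtain ⟨c, rfl, -⟩ := h
  have := cycles_d _ n c
  rw [ChainComplex.linearYonedaObj_d] at this
  exact this

lemma Rep.exists_right (e : ((Ext R (ModuleCat.{0} R) n).obj (op X)).obj Y) :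
    ∃ f, Rep P n Y e f := by
  obtain ⟨c, hc⟩ := (ModuleCat.epi_iff_surjective
    ((P.complex.linearYonedaObj R Y).homologyπ n)).mp inferInstance ((P.isoExt n Y).hom e)
  exact ⟨_, c, rfl, hc⟩

lemma Rep.exists_left (f : P.complex.X n ⟶ Y) (hf : P.complex.d (n+1) n ≫ f = 0) :
    ∃ e, Rep P n Y e f := by
  obtain ⟨c, hc⟩ := cycles_exists (P.complex.linearYonedaObj R Y) n f (by
    rw [ChainComplex.linearYonedaObj_d]
    exact hf)
  refine ⟨(P.isoExt n Y).inv ((P.complex.linearYonedaObj R Y).homologyπ n c), c, hc, ?_⟩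
  simp

lemma Rep.eq_zero_iff {e} {f : P.complex.X n ⟶ Y} (h : Rep P n Y e f) :
    e = 0 ↔ ∃ g : P.complex.X ((ComplexShape.up ℕ).prev n) ⟶ Y,
      P.complex.d n ((ComplexShape.up ℕ).prev n) ≫ g = f := by
  obtain ⟨c, rfl, hc⟩ := h
  have h1 : e = 0 ↔ (P.isoExt n Y).hom e = 0 := by
    constructor
    · rintro rfl; simp
    · intro h
      have := congrArg (P.isoExt n Y).inv h
      simpa using this
  rw [h1, ← hc, homologyπ_zero]
  rw [ChainComplex.linearYonedaObj_d]
  exact Iff.rfl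

lemma Rep.smul {e} {f : P.complex.X n ⟶ Y} (h : Rep P n Y e f) (a : R) :
    Rep P n Y (a • e) (a • f) := by
  obtain ⟨c, rfl, hc⟩ := h
  refine ⟨a • c, ?_, ?_⟩
  · exact map_smul ((P.complex.linearYonedaObj R Y).iCycles n).hom a c
  · rw [map_smul, map_smul, hc]

lemma Rep.map {e} {f : P.complex.X n ⟶ Y} (h : Rep P n Y e f) (g : X' ⟶ X)
    (φ : P'.complex ⟶ P.complex) (comm : φ.f 0 ≫ P.π.f 0 = P'.π.f 0 ≫ g) :
    Rep P' n Y (((Ext R (ModuleCat.{0} R) n).map g.op).app Y e) (φ.f n ≫ f) := by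
  obtain ⟨c, rfl, hc⟩ := h
  refine ⟨HomologicalComplex.cyclesMap (yonMap P P' φ Y) n c, ?_, ?_⟩
  · have := HomologicalComplex.cyclesMap_i (yonMap P P' φ Y) n
    exact congrArg (fun g => g.hom c) this
  · have h1 := HomologicalComplex.homologyπ_naturality (yonMap P P' φ Y) n
    have h1' := congrArg (fun g => g.hom c) h1
    have h2 := congrArg (fun g => g.hom e) (isoExt_nat P P' g φ comm n Y)
    refine h1'.symm.trans (Eq.trans ?_ h2.symm)
    exact congrArg (HomologicalComplex.homologyMap (yonMap P P' φ Y) n) hc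

end OldNew
end GCM

namespace GCM
open Opposite

section OldNew2
variable {R : Type} [CommRing R]

lemma extMk_eq_zero_iff' {X Y : ModuleCat.{0} R} (P : ProjectiveResolution X) {n : ℕ}
    (f : P.complex.X n ⟶ Y) (hf : P.complex.d (n+1) n ≫ f = 0) :
    P.extMk f (n+1) rfl hf = 0 ↔ ∃ g : P.complex.X ((ComplexShape.up ℕ).prev n) ⟶ Y,
      P.complex.d n ((ComplexShape.up ℕ).prev n) ≫ g = f := by
  cases n with
  | succ n =>
    rw [P.extMk_eq_zero_iff f (n+1+1) rfl hf n rfl]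
    have h1 : (ComplexShape.up ℕ).prev (n+1) = n := by simp
    rw [h1]
  | zero =>
    have h1 : P.complex.d 0 ((ComplexShape.up ℕ).prev 0) = 0 := by
      apply P.complex.shape; simp
    simp only [h1, Limits.zero_comp, exists_const_iff]
    constructor
    · intro h
      refine ⟨⟨0⟩, ?_⟩
      have h' := congrArg P.extEquivCohomologyClass h
      rw [P.extEquivCohomologyClass_extMk, P.extEquivCohomologyClass_zero,
        CochainComplex.HomComplex.CohomologyClass.mk_eq_zero_iff,
        CochainComplex.HomComplex.Cocycle.toSingleMk_mem_coboundaries_iff _ _ _ _ _ 1 (by simp)] at h'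
      obtain ⟨g, hg⟩ := h'
      have : P.cochainComplex.d (-(0:ℕ)) 1 = 0 :=
        (CochainComplex.isZero_of_isStrictlyLE P.cochainComplex 0 1 (by lia)).eq_of_tgt _ _
      rw [this, Limits.zero_comp] at hg
      have := (cancel_epi (P.cochainComplexXIso (-(0:ℕ)) 0 rfl).hom).mp
        ((hg.symm).trans (Limits.comp_zero).symm)
      exact this.symm
    · rintro ⟨-, rfl⟩
      simp

/-- Correspondence between old and new Ext classes. -/
def Cor {X Y : ModuleCat.{0} R} {n : ℕ} (e : ((Ext R (ModuleCat.{0} R) n).obj (op X)).obj Y)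
    (e' : Abelian.Ext.{0} X Y n) : Prop :=
  ∃ (f : (projectiveResolution X).complex.X n ⟶ Y)
    (hf : (projectiveResolution X).complex.d (n+1) n ≫ f = 0),
    Rep (projectiveResolution X) n Y e f ∧ (projectiveResolution X).extMk f (n+1) rfl hf = e'

variable {X X' Y : ModuleCat.{0} R} {n : ℕ}

lemma Cor.exists_new (e : ((Ext R (ModuleCat.{0} R) n).obj (op X)).obj Y) : ∃ e', Cor e e' := by
  obtain ⟨f, hf⟩ := Rep.exists_right (projectiveResolution X) e
  exact ⟨_, f, hf.d_comp, hf, rfl⟩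

lemma Cor.exists_old (e' : Abelian.Ext.{0} X Y n) :
    ∃ e : ((Ext R (ModuleCat.{0} R) n).obj (op X)).obj Y, Cor e e' := by
  obtain ⟨f, hf, rfl⟩ := (projectiveResolution X).extMk_surjective e' (n+1) rfl
  obtain ⟨e, he⟩ := Rep.exists_left (projectiveResolution X) f hf
  exact ⟨e, f, hf, he, rfl⟩

lemma Cor.eq_zero_iff {e : ((Ext R (ModuleCat.{0} R) n).obj (op X)).obj Y}
    {e' : Abelian.Ext.{0} X Y n} (h : Cor e e') : e = 0 ↔ e' = 0 := by
  obtain ⟨f, hf, h1, rfl⟩ := h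
  rw [h1.eq_zero_iff, extMk_eq_zero_iff']

lemma Cor.smul {e : ((Ext R (ModuleCat.{0} R) n).obj (op X)).obj Y}
    {e' : Abelian.Ext.{0} X Y n} (h : Cor e e') (a : R) : Cor (a • e) (a • e') := by
  obtain ⟨f, hf, h1, rfl⟩ := h
  refine ⟨a • f, by rw [Linear.comp_smul, hf, smul_zero], h1.smul _ a, ?_⟩
  rw [Abelian.Ext.smul_eq_comp_mk₀, ProjectiveResolution.extMk_comp_mk₀]
  congr 1

lemma Cor.map {e : ((Ext R (ModuleCat.{0} R) n).obj (op X)).obj Y}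
    {e' : Abelian.Ext.{0} X Y n} (h : Cor e e') (g : X' ⟶ X) :
    Cor (((Ext R (ModuleCat.{0} R) n).map g.op).app Y e)
      ((Abelian.Ext.mk₀ g).comp e' (zero_add n)) := by
  obtain ⟨f, hf, h1, rfl⟩ := h
  let φ : ProjectiveResolution.Hom (projectiveResolution X') (projectiveResolution X) g :=
    ⟨ProjectiveResolution.lift g _ _, by
      rw [ProjectiveResolution.lift_commutes_zero, ChainComplex.single₀_map_f_zero]; rfl⟩
  have hc : φ.hom.f 0 ≫ (projectiveResolution X).π.f 0 = (projectiveResolution X').π.f 0 ≫ g := by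
    have := φ.hom_f_zero_comp_π_f_zero
    rw [ChainComplex.single₀_map_f_zero] at this
    exact this
  refine ⟨φ.hom.f n ≫ f, by simp [← φ.hom.comm_assoc, hf], h1.map _ _ g φ.hom hc, ?_⟩
  exact (ProjectiveResolution.mk₀_comp_extMk f (n+1) rfl hf φ).symm

end OldNew2
end GCM

namespace GCM

section SES
variable {R : Type} [CommRing R] {A B C : Type} [AddCommGroup A] [AddCommGroup B] [AddCommGroup C]
  [Module R A] [Module R B] [Module R C]

/-- A short complex of modules from linear maps. -/
abbrev mkSC (f : A →ₗ[R] B) (g : B →ₗ[R] C) (h : Function.Exact f g) :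
    ShortComplex (ModuleCat.{0} R) :=
  ShortComplex.mk (ModuleCat.ofHom f) (ModuleCat.ofHom g)
    (by rw [← ModuleCat.ofHom_comp, h.linearMap_comp_eq_zero]; rfl)

lemma mkSC_shortExact (f : A →ₗ[R] B) (g : B →ₗ[R] C) (h : Function.Exact f g)
    (hf : Function.Injective f) (hg : Function.Surjective g) : (mkSC f g h).ShortExact :=
  { exact := (ShortComplex.ShortExact.moduleCat_exact_iff_function_exact _).mpr h
    mono_f := (ModuleCat.mono_iff_injective _).mpr hf
    epi_g := (ModuleCat.epi_iff_surjective _).mpr hg }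
end SES

section Hilbert
open TensorProduct

/-- All modules have projective dimension at most `N`. -/
def GlDim (R : Type) [CommRing R] (N : ℕ) : Prop :=
  ∀ X : ModuleCat.{0} R, HasProjectiveDimensionLT X (N + 1)

lemma GlDim.of_ringEquiv {R R' : Type} [CommRing R] [CommRing R'] (e : R ≃+* R') {N : ℕ}
    (h : GlDim R N) : GlDim R' N := by
  intro X
  let : Module R X := Module.compHom X (e : R →+* R')
  let := RingHomInvPair.of_ringEquiv e
  let := RingHomInvPair.of_ringEquiv e.symm
  have : HasProjectiveDimensionLE (ModuleCat.of R X) N := h _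
  exact ModuleCat.hasProjectiveDimensionLE_of_semiLinearEquiv (M := ModuleCat.of R X) e
    { toFun := fun x => x, invFun := fun x => x, left_inv := fun _ => rfl, right_inv := fun _ => rfl,
      map_add' := fun _ _ => rfl, map_smul' := fun _ _ => rfl } N

lemma glDim_field (K : Type) [Field K] : GlDim K 0 := by
  intro X
  have : Projective X := (IsProjective.iff_projective X).mp (Module.Projective.of_free)
  infer_instance

variable {R : Type} [CommRing R]

lemma baseChange_pd (N : ℕ) (X : ModuleCat.{0} R) (h : HasProjectiveDimensionLT X (N + 1)) :
    HasProjectiveDimensionLT (ModuleCat.of (Polynomial R) (Polynomial R ⊗[R] X)) (N + 1) := by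
  induction N generalizing X with
  | zero =>
    rw [zero_add, ← projective_iff_hasProjectiveDimensionLT_one, ← IsProjective.iff_projective] at h ⊢
    infer_instance
  | succ N ih =>
    have hS := X.shortExact_projectiveShortComplex
    have h1 := (hS.hasProjectiveDimensionLT_X₃_iff N inferInstance).mp h
    have h1' := ih _ h1
    have hex := (ShortComplex.ShortExact.moduleCat_exact_iff_function_exact _).mp hS.exact
    have hi := (ModuleCat.mono_iff_injective _).mp hS.mono_f
    have hs := (ModuleCat.epi_iff_surjective _).mp hS.epi_g
    have e1 := Module.Flat.lTensor_exact (Polynomial R) hex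
    have e2 := Module.Flat.lTensor_preserves_injective_linearMap (M := Polynomial R) _ hi
    have e3 := LinearMap.lTensor_surjective (Polynomial R) hs
    have T := mkSC_shortExact (LinearMap.baseChange (Polynomial R) X.projectiveShortComplex.f.hom)
      (LinearMap.baseChange (Polynomial R) X.projectiveShortComplex.g.hom) e1 e2 e3
    refine T.hasProjectiveDimensionLT_X₃ _ h1' ?_
    have : Projective X.projectiveShortComplex.X₂ := inferInstance
    rw [← IsProjective.iff_projective] at this
    have : Projective (ModuleCat.of (Polynomial R) (Polynomial R ⊗[R] X.projectiveShortComplex.X₂)) := by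
      rw [← IsProjective.iff_projective]
      infer_instance
    exact hasProjectiveDimensionLT_of_ge _ 1 _ (by lia)

variable {M : Type} [AddCommGroup M] [Module R M] [Module (Polynomial R) M]
  [IsScalarTower R (Polynomial R) M]

/-- evaluation map -/
def polEps (R M : Type) [CommRing R] [AddCommGroup M] [Module R M] [Module (Polynomial R) M]
    [IsScalarTower R (Polynomial R) M] : Polynomial R ⊗[R] M →ₗ[Polynomial R] M :=
  LinearMap.liftBaseChange (Polynomial R) (LinearMap.id : M →ₗ[R] M)

/-- the difference map -/
def polDel (R M : Type) [CommRing R] [AddCommGroup M] [Module R M] [Module (Polynomial R) M]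
    [IsScalarTower R (Polynomial R) M] : Polynomial R ⊗[R] M →ₗ[Polynomial R] Polynomial R ⊗[R] M :=
  (Polynomial.X : Polynomial R) • LinearMap.id -
    LinearMap.baseChange (Polynomial R)
      (((Polynomial.X : Polynomial R) • (LinearMap.id : M →ₗ[Polynomial R] M)).restrictScalars R)

@[simp] lemma polEps_tmul (p : Polynomial R) (m : M) : polEps R M (p ⊗ₜ m) = p • m := by
  simp [polEps]

@[simp] lemma polDel_tmul (p : Polynomial R) (m : M) :
    polDel R M (p ⊗ₜ m) = (Polynomial.X * p) ⊗ₜ m - p ⊗ₜ ((Polynomial.X : Polynomial R) • m) := by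
  simp [polDel, TensorProduct.smul_tmul']

lemma pol_good (t : Polynomial R ⊗[R] M) : t - 1 ⊗ₜ polEps R M t ∈ LinearMap.range (polDel R M) := by
  induction t using TensorProduct.induction_on with
  | zero => simp
  | add x y hx hy =>
    have := add_mem hx hy
    rw [map_add, TensorProduct.tmul_add]
    convert this using 1; abel
  | tmul p m =>
    induction p using Polynomial.induction_on' generalizing m with
    | add p q hp hq =>
      have := add_mem (hp m) (hq m)
      rw [TensorProduct.add_tmul, map_add, TensorProduct.tmul_add]
      convert this using 1; abel
    | monomial n a =>
      have h1 : Polynomial.monomial n a ⊗ₜ[R] m = (Polynomial.X ^ n : Polynomial R) ⊗ₜ[R] (a • m) := by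
        rw [TensorProduct.tmul_smul, TensorProduct.smul_tmul', Polynomial.smul_eq_C_mul,
          Polynomial.C_mul_X_pow_eq_monomial]
      rw [h1]
      generalize a • m = m'
      clear h1
      induction n generalizing m' with
      | zero => simp
      | succ n ih =>
        have h2 := ih ((Polynomial.X : Polynomial R) • m')
        have h3 : polDel R M ((Polynomial.X ^ n : Polynomial R) ⊗ₜ m') ∈ LinearMap.range (polDel R M) :=
          ⟨_, rfl⟩
        have := add_mem h2 h3
        convert this using 1
        simp only [polDel_tmul, polEps_tmul, smul_smul, ← pow_succ, ← pow_succ']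
        abel

lemma pol_exact : Function.Exact (polDel R M) (polEps R M) := by
  intro t
  constructor
  · intro h
    have := pol_good t
    rw [h, TensorProduct.tmul_zero, sub_zero] at this
    exact this
  · rintro ⟨y, rfl⟩
    induction y using TensorProduct.induction_on with
    | zero => simp
    | add x y hx hy => rw [map_add, map_add, hx, hy, add_zero]
    | tmul p m => simp [smul_smul, mul_comm]

lemma pol_inj : Function.Injective (polDel R M) := by
  rw [injective_iff_map_eq_zero]
  intro t ht
  let E := TensorProduct.equivFinsuppOfBasisLeft (N := M) (Polynomial.basisMonomials R)
  have hE : ∀ (p : Polynomial R) (m : M) n, E (p ⊗ₜ m) n = p.coeff n • m := by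
    intro p m n
    rw [TensorProduct.equivFinsuppOfBasisLeft_apply_tmul_apply]
    rfl
  have key : ∀ (t : Polynomial R ⊗[R] M) n,
      E (polDel R M t) (n+1) = E t n - (Polynomial.X : Polynomial R) • E t (n+1) := by
    intro t n
    induction t using TensorProduct.induction_on with
    | zero => simp
    | add x y hx hy =>
      simp only [map_add, Finsupp.add_apply, smul_add] at *
      rw [hx, hy]; abel
    | tmul p m =>
      simp only [polDel_tmul, map_sub, Finsupp.sub_apply, hE, Polynomial.coeff_X_mul]
      rw [smul_comm]
  have h1 : ∀ n, E t n = (Polynomial.X : Polynomial R) • E t (n+1) := by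
    intro n
    have := key t n
    rw [ht, map_zero, Finsupp.zero_apply] at this
    exact (sub_eq_zero.mp this.symm)
  have h2 : ∀ k n, E t n = (Polynomial.X ^ k : Polynomial R) • E t (n+k) := by
    intro k
    induction k with
    | zero => simp
    | succ k ih =>
      intro n
      rw [ih n, h1 (n+k), smul_smul, ← pow_succ]; rfl
  have h3 : E t = 0 := by
    ext n
    obtain ⟨k, hk⟩ := (E t).support.bddAbove
    rw [h2 (k+1) n]
    have : E t (n + (k+1)) = 0 := by
      by_contra hne
      have := hk (Finsupp.mem_support_iff.mpr hne)
      lia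
    rw [this, smul_zero]; rfl
  exact E.map_eq_zero_iff.mp h3

lemma GlDim.polynomial {N : ℕ} (h : GlDim R N) : GlDim (Polynomial R) (N + 1) := by
  intro X
  let : Module R X := Module.compHom X (Polynomial.C : R →+* Polynomial R)
  have : IsScalarTower R (Polynomial R) X := IsScalarTower.of_algebraMap_smul (fun r x => rfl)
  have T := mkSC_shortExact (polDel R X) (polEps R X) pol_exact pol_inj
    (fun x => ⟨1 ⊗ₜ x, by simp⟩)
  have hb := baseChange_pd N (ModuleCat.of R X) (h _)
  exact T.hasProjectiveDimensionLT_X₃ _ hb (hasProjectiveDimensionLT_of_ge _ (N+1) _ (by lia))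

lemma glDim_mvPolynomial_fin (K : Type) [Field K] (n : ℕ) : GlDim (MvPolynomial (Fin n) K) n := by
  induction n with
  | zero => exact (glDim_field K).of_ringEquiv (MvPolynomial.isEmptyRingEquiv K (Fin 0)).symm
  | succ n ih => exact ih.polynomial.of_ringEquiv (MvPolynomial.finSuccEquiv K n).symm.toRingEquiv

lemma glDim_BGS (K : Type) [Field K] (m n : ℕ) :
    GlDim (MvPolynomial (Fin m ⊕ Fin n) K) (m + n) :=
  (glDim_mvPolynomial_fin K (m+n)).of_ringEquiv
    (MvPolynomial.renameEquiv K finSumFinEquiv.symm).toRingEquiv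

end Hilbert
end GCM

namespace GCM

section API
open Abelian
variable {R : Type} [CommRing R] {X X' X'' Y Y' Y'' : ModuleCat.{0} R} {n : ℕ}

/-- precomposition on Ext -/
def pre (f : X ⟶ X') : Ext.{0} X' Y n →ₗ[R] Ext.{0} X Y n where
  toFun e := (Ext.mk₀ f).comp e (zero_add n)
  map_add' := by simp
  map_smul' := by simp

/-- postcomposition on Ext -/
def post (g : Y ⟶ Y') : Ext.{0} X Y n →ₗ[R] Ext.{0} X Y' n where
  toFun e := e.comp (Ext.mk₀ g) (add_zero n)
  map_add' := by simp
  map_smul' := by simp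

/-- connecting map, covariant -/
def dl {S : ShortComplex (ModuleCat.{0} R)} (hS : S.ShortExact) :
    Ext.{0} X S.X₃ n →ₗ[R] Ext.{0} X S.X₁ (n+1) where
  toFun e := e.comp hS.extClass rfl
  map_add' := by simp
  map_smul' := by simp

/-- connecting map, contravariant -/
def dr {S : ShortComplex (ModuleCat.{0} R)} (hS : S.ShortExact) :
    Ext.{0} S.X₁ Y n →ₗ[R] Ext.{0} S.X₃ Y (n+1) where
  toFun e := hS.extClass.comp e (add_comm 1 n)
  map_add' := by simp
  map_smul' := by simp

lemma pre_pre (f : X ⟶ X') (g : X' ⟶ X'') (e : Ext.{0} X'' Y n) :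
    pre f (pre g e) = pre (f ≫ g) e := by simp [pre]

lemma post_post (f : Y ⟶ Y') (g : Y' ⟶ Y'') (e : Ext.{0} X Y n) :
    post g (post f e) = post (f ≫ g) e := by simp [post]

lemma pre_post (f : X ⟶ X') (g : Y ⟶ Y') (e : Ext.{0} X' Y n) :
    pre f (post g e) = post g (pre f e) := by simp [pre, post]

lemma pre_id (e : Ext.{0} X Y n) : pre (𝟙 X) e = e := by simp [pre]

lemma post_id (e : Ext.{0} X Y n) : post (𝟙 Y) e = e := by simp [post]

lemma pre_zero (e : Ext.{0} X Y n) : pre (0 : X' ⟶ X) e = 0 := by simp [pre]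

lemma post_zero (e : Ext.{0} X Y n) : post (0 : Y ⟶ Y') e = 0 := by simp [post]

lemma pre_smul_id (a : R) (e : Ext.{0} X Y n) : pre (a • 𝟙 X) e = a • e := by
  simp [pre, Ext.mk₀_smul]

lemma post_smul_id (a : R) (e : Ext.{0} X Y n) : post (a • 𝟙 Y) e = a • e := by
  simp [post, Ext.mk₀_smul]

lemma post_sum {ι : Type} [Fintype ι] (g : ι → (Y ⟶ Y')) (e : Ext.{0} X Y n) :
    post (∑ i, g i) e = ∑ i, post (g i) e := by
  simp [post, Ext.mk₀_sum, Ext.comp_sum]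

lemma pre_sum {ι : Type} [Fintype ι] (g : ι → (X ⟶ X')) (e : Ext.{0} X' Y n) :
    pre (∑ i, g i) e = ∑ i, pre (g i) e := by
  simp [pre, Ext.mk₀_sum, Ext.sum_comp]

variable {S : ShortComplex (ModuleCat.{0} R)} (hS : S.ShortExact)
  {S' : ShortComplex (ModuleCat.{0} R)} (hS' : S'.ShortExact)

lemma pre_dl (f : X ⟶ X') (e : Ext.{0} X' S.X₃ n) : pre f (dl hS e) = dl hS (pre f e) := by
  simp only [pre, dl, LinearMap.coe_mk, AddHom.coe_mk]
  rw [Ext.comp_assoc]; lia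

lemma post_dr (g : Y ⟶ Y') (e : Ext.{0} S.X₁ Y n) : post g (dr hS e) = dr hS (post g e) := by
  simp [post, dr]

lemma dl_nat (φ : S ⟶ S') (e : Ext.{0} X S.X₃ n) :
    post φ.τ₁ (dl hS e) = dl hS' (post φ.τ₃ e) := by
  simp [post, dl, ShortComplex.ShortExact.extClass_naturality hS hS' φ]

lemma dr_nat (φ : S ⟶ S') (e : Ext.{0} S'.X₁ Y n) :
    pre φ.τ₃ (dr hS' e) = dr hS (pre φ.τ₁ e) := by
  simp only [pre, dr, LinearMap.coe_mk, AddHom.coe_mk]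
  rw [← Ext.comp_assoc_of_second_deg_zero, ShortComplex.ShortExact.extClass_naturality hS hS' φ,
    Ext.comp_assoc]
  lia

lemma exl₁ (e : Ext.{0} X S.X₁ (n+1)) (h : post S.f e = 0) : ∃ e', dl (n := n) hS e' = e :=
  Ext.covariant_sequence_exact₁ _ hS e h rfl

include hS in
lemma exl₂ (e : Ext.{0} X S.X₂ n) (h : post S.g e = 0) : ∃ e', post S.f e' = e :=
  Ext.covariant_sequence_exact₂ _ hS e h

lemma exl₃ (e : Ext.{0} X S.X₃ n) (h : dl hS e = 0) : ∃ e', post S.g e' = e :=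
  Ext.covariant_sequence_exact₃ _ hS e rfl h

lemma exr₁ (e : Ext.{0} S.X₁ Y n) (h : dr hS e = 0) : ∃ e', pre S.f e' = e :=
  Ext.contravariant_sequence_exact₁ hS _ e (add_comm 1 n) h

include hS in
lemma exr₂ (e : Ext.{0} S.X₂ Y n) (h : pre S.f e = 0) : ∃ e', pre S.g e' = e :=
  Ext.contravariant_sequence_exact₂ hS _ e h

lemma exr₃ (e : Ext.{0} S.X₃ Y (n+1)) (h : pre S.g e = 0) : ∃ e', dr (n := n) hS e' = e :=
  Ext.contravariant_sequence_exact₃ hS _ e h (add_comm 1 n)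

lemma dl_post (e : Ext.{0} X S.X₂ n) : dl hS (post S.g e) = 0 := by
  simp [dl, post]

lemma post_eq_zero_of_zero_comp (e : Ext.{0} X S.X₁ n) : post S.g (post S.f e) = 0 := by
  rw [post_post, S.zero, post_zero]

/-- Vanishing: `y` invertible on the target and nilpotent on the source. -/
lemma ext_zero_of_inv_right (y : R) (s : ℕ) (g : Y ⟶ Y) (hg : y • g = 𝟙 Y)
    (hX : y ^ s • 𝟙 X = 0) (e : Ext.{0} X Y n) : e = 0 := by
  have h1 : ∀ e : Ext.{0} X Y n, e = y • post g e := by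
    intro e
    conv_lhs => rw [← post_id e, ← hg]
    simp [post, Ext.mk₀_smul]
  have h2 : ∀ k : ℕ, ∀ e : Ext.{0} X Y n, ∃ e', e = y ^ k • e' := by
    intro k
    induction k with
    | zero => intro e; exact ⟨e, by simp⟩
    | succ k ih =>
      intro e
      obtain ⟨e', he'⟩ := ih e
      refine ⟨post g e', ?_⟩
      rw [he', h1 e', smul_smul, ← pow_succ, ← h1]
  obtain ⟨e', rfl⟩ := h2 s e
  rw [← pre_smul_id, hX, pre_zero]

/-- Vanishing: `y` invertible on the source and nilpotent on the target. -/
lemma ext_zero_of_inv_left (y : R) (s : ℕ) (g : X ⟶ X) (hg : y • g = 𝟙 X)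
    (hY : y ^ s • 𝟙 Y = 0) (e : Ext.{0} X Y n) : e = 0 := by
  have h1 : ∀ e : Ext.{0} X Y n, e = y • pre g e := by
    intro e
    conv_lhs => rw [← pre_id e, ← hg]
    simp [pre, Ext.mk₀_smul]
  have h2 : ∀ k : ℕ, ∀ e : Ext.{0} X Y n, ∃ e', e = y ^ k • e' := by
    intro k
    induction k with
    | zero => intro e; exact ⟨e, by simp⟩
    | succ k ih =>
      intro e
      obtain ⟨e', he'⟩ := ih e
      refine ⟨pre g e', ?_⟩
      rw [he', h1 e', smul_smul, ← pow_succ, ← h1]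
  obtain ⟨e', rfl⟩ := h2 s e
  rw [← post_smul_id, hY, post_zero]

end API
end GCM

namespace GCM

section Kill
open Abelian
variable {R : Type} [CommRing R] (J : Ideal R)

/-- The module `R / J ^ k`. -/
abbrev TT (k : ℕ) : ModuleCat.{0} R := ModuleCat.of R (R ⧸ J ^ k)

/-- The transition map `R / J ^ l ⟶ R / J ^ k`. -/
def resM {k l : ℕ} (h : k ≤ l) : TT J l ⟶ TT J k :=
  ModuleCat.ofHom (Submodule.mapQ (J ^ l) (J ^ k) LinearMap.id (Ideal.pow_le_pow_right h))

lemma resM_comp {k l p : ℕ} (h : k ≤ l) (h' : l ≤ p) :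
    resM J h' ≫ resM J h = resM J (h.trans h') := by
  apply ModuleCat.hom_ext
  refine LinearMap.ext fun x => ?_
  obtain ⟨x, rfl⟩ := Submodule.Quotient.mk_surjective _ x
  rfl

variable {J} {A B : ModuleCat.{0} R} {i : ℕ}

/-- The class becomes zero further along the system. -/
def Ev {k : ℕ} (e : Ext.{0} (TT J k) A i) : Prop :=
  ∃ (l : ℕ) (h : k ≤ l), pre (resM J h) e = 0

variable (J) in
/-- `a` kills the `i`-th local cohomology. -/
def Kill (a : R) (i : ℕ) (A : ModuleCat.{0} R) : Prop :=
  ∀ (k : ℕ) (e : Ext.{0} (TT J k) A i), Ev (a • e)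

variable (J) in
/-- vanishing of the `i`-th local cohomology. -/
def Van (i : ℕ) (A : ModuleCat.{0} R) : Prop :=
  ∀ (k : ℕ) (e : Ext.{0} (TT J k) A i), Ev e

lemma Ev.of_pre {k l : ℕ} {h : k ≤ l} {e : Ext.{0} (TT J k) A i} (H : Ev (pre (resM J h) e)) :
    Ev e := by
  obtain ⟨p, h', hp⟩ := H
  exact ⟨p, h.trans h', by rw [← resM_comp J h h', ← pre_pre, hp]⟩

lemma Ev.post {k : ℕ} {e : Ext.{0} (TT J k) A i} (H : Ev e) (f : A ⟶ B) : Ev (post f e) := by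
  obtain ⟨p, h', hp⟩ := H
  exact ⟨p, h', by rw [pre_post, hp, map_zero]⟩

lemma Ev.smul {k : ℕ} {e : Ext.{0} (TT J k) A i} (H : Ev e) (a : R) : Ev (a • e) := by
  obtain ⟨p, h', hp⟩ := H
  exact ⟨p, h', by rw [map_smul, hp, smul_zero]⟩

variable {S : ShortComplex (ModuleCat.{0} R)} (hS : S.ShortExact)

include hS in
lemma Van.of_X₂_X₁ (h2 : Van J i S.X₂) (h1 : Van J (i+1) S.X₁) : Van J i S.X₃ := by
  intro k e
  obtain ⟨l, h, hl⟩ := h1 k (dl hS e)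
  rw [pre_dl] at hl
  obtain ⟨e', he'⟩ := exl₃ hS _ hl
  have := (h2 _ e').post S.g
  rw [he'] at this
  exact this.of_pre

include hS in
lemma Van.of_X₁_X₃ (h1 : Van J i S.X₁) (h3 : Van J i S.X₃) : Van J i S.X₂ := by
  intro k e
  obtain ⟨l, h, hl⟩ := h3 k (GCM.post S.g e)
  rw [pre_post] at hl
  obtain ⟨e', he'⟩ := exl₂ hS _ hl
  have := (h1 _ e').post S.f
  rw [he'] at this
  exact this.of_pre

lemma Van.of_glDim {N : ℕ} (hN : GlDim R N) (hi : N < i) : Van J i A := by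
  intro k e
  have := hN (TT J k)
  exact ⟨k, le_rfl, by rw [e.eq_zero_of_hasProjectiveDimensionLT (N+1) hi, map_zero]⟩

lemma Van.of_iso (h : Van J i A) (f : A ≅ B) : Van J i B := by
  intro k e
  have := (h k (GCM.post f.inv e)).post f.hom
  rwa [post_post, f.inv_hom_id, post_id] at this

/-- `J`-torsion modules. -/
def Tors (J : Ideal R) (N : ModuleCat.{0} R) : Prop := ∀ x : N, ∃ k, ∀ a ∈ J ^ k, a • x = 0

lemma ext_restrict [IsNoetherianRing R] {N : ModuleCat.{0} R} (hN : Tors J N) (j : ℕ)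
    (X : ModuleCat.{0} R) [Module.Finite R X] (e : Ext.{0} X N j) :
    ∃ l : ℕ, pre (ModuleCat.ofHom ((J ^ l • (⊤ : Submodule R X)).subtype)) e = 0 := by
  induction j generalizing X with
  | zero =>
    obtain ⟨f, rfl⟩ := Ext.homEquiv₀.symm.surjective e
    obtain ⟨s, hs⟩ := (Module.Finite.fg_top : (⊤ : Submodule R X).FG)
    choose κ hκ using fun x : X => hN (f x)
    refine ⟨s.sup κ, ?_⟩
    have : ModuleCat.ofHom ((J ^ (s.sup κ) • (⊤ : Submodule R X)).subtype) ≫ f = 0 := by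
      apply ModuleCat.hom_ext
      refine LinearMap.ext fun x => ?_
      obtain ⟨x, hx⟩ := x
      change f.hom x = 0
      have hle : (⊤ : Submodule R X) ≤ (⨅ a ∈ J ^ (s.sup κ), LinearMap.ker (a • f.hom)) := by
        rw [← hs, Submodule.span_le]
        intro x hx
        simp only [Submodule.coe_iInf, Set.mem_iInter]
        intro a ha
        exact hκ x a (Ideal.pow_le_pow_right (Finset.le_sup hx) ha)
      refine Submodule.smul_induction_on (p := fun x => f.hom x = 0) hx ?_ ?_
      · intro a ha x _
        have := hle (Submodule.mem_top : x ∈ ⊤)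
        simp only [Submodule.mem_iInf] at this
        rw [map_smul]
        exact this a ha
      · intro x y hx hy; rw [map_add, hx, hy, add_zero]
    simp [pre, Ext.homEquiv₀, this]
  | succ j ih =>
    obtain ⟨r, π, hπ⟩ := Module.Finite.exists_fin' R X
    have hS := mkSC_shortExact (LinearMap.ker π).subtype π
      (LinearMap.exact_subtype_ker_map π) (Submodule.subtype_injective _) hπ
    have : Projective (ModuleCat.of R (Fin r → R)) :=
      (IsProjective.iff_projective _).mp (inferInstanceAs (Module.Projective R (Fin r → R)))
    obtain ⟨e', rfl⟩ := exr₃ hS e (Ext.eq_zero_of_projective _)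
    obtain ⟨l, hl⟩ := ih (ModuleCat.of R (LinearMap.ker π)) e'
    obtain ⟨k, hk⟩ := Ideal.exists_pow_inf_eq_pow_smul J (LinearMap.ker π)
    let p := k + l
    have hmaps : ∀ x ∈ (J ^ p • (⊤ : Submodule R (Fin r → R))), π x ∈ (J ^ p • (⊤ : Submodule R X)) := by
      intro x hx
      have : π x ∈ Submodule.map π (J ^ p • (⊤ : Submodule R (Fin r → R))) := ⟨x, hx, rfl⟩
      rw [Submodule.map_smul''] at this
      exact Submodule.smul_mono le_rfl le_top this
    let π' : ↥(J ^ p • (⊤ : Submodule R (Fin r → R))) →ₗ[R] ↥(J ^ p • (⊤ : Submodule R X)) :=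
      π.restrict hmaps
    let κ' : ↥(LinearMap.ker π') →ₗ[R] ↥(J ^ p • (⊤ : Submodule R (Fin r → R))) :=
      (LinearMap.ker π').subtype
    have hκ' : Function.Exact κ' π' := LinearMap.exact_subtype_ker_map π'
    have hπ' : Function.Surjective π' := by
      rintro ⟨x, hx⟩
      have : x ∈ Submodule.map π (J ^ p • (⊤ : Submodule R (Fin r → R))) := by
        rw [Submodule.map_smul'', Submodule.map_top, LinearMap.range_eq_top.mpr hπ]
        exact hx
      obtain ⟨y, hy, rfl⟩ := this
      exact ⟨⟨y, hy⟩, rfl⟩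
    have hκi : Function.Injective κ' := Submodule.subtype_injective (LinearMap.ker π')
    have hS' := mkSC_shortExact (R := R) (A := ↥(LinearMap.ker π'))
      (B := ↥(J ^ p • (⊤ : Submodule R (Fin r → R)))) (C := ↥(J ^ p • (⊤ : Submodule R X)))
      κ' π' hκ' hκi hπ'
    let t : LinearMap.ker π' →ₗ[R] LinearMap.ker π :=
      LinearMap.codRestrict _ ((Submodule.subtype _).comp (LinearMap.ker π').subtype) (by
        rintro ⟨⟨x, hx⟩, hx'⟩
        exact congrArg Subtype.val hx')
    have ht : ∀ x, t x ∈ (J ^ l • (⊤ : Submodule R (LinearMap.ker π))) := by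
      rintro ⟨⟨x, hx⟩, hx'⟩
      have hx2 : x ∈ LinearMap.ker π := congrArg Subtype.val hx'
      have h1 : x ∈ J ^ p • ⊤ ⊓ LinearMap.ker π := ⟨hx, hx2⟩
      rw [hk p (by lia)] at h1
      have h2 : x ∈ J ^ l • (LinearMap.ker π) := by
        have : p - k = l := by lia
        rw [this] at h1
        exact Submodule.smul_mono le_rfl inf_le_right h1
      have h3 : x ∈ Submodule.map (LinearMap.ker π).subtype (J ^ l • ⊤) := by
        rw [Submodule.map_smul'', Submodule.map_subtype_top]; exact h2
      obtain ⟨y, hy, hyx⟩ := h3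
      have : t ⟨⟨x, hx⟩, hx'⟩ = y := Subtype.ext hyx.symm
      rw [this]; exact hy
    let φ : mkSC (R := R) (A := ↥(LinearMap.ker π'))
      (B := ↥(J ^ p • (⊤ : Submodule R (Fin r → R)))) (C := ↥(J ^ p • (⊤ : Submodule R X)))
      κ' π' hκ' ⟶
        mkSC (LinearMap.ker π).subtype π (LinearMap.exact_subtype_ker_map π) :=
      { τ₁ := ModuleCat.ofHom (X := ↥(LinearMap.ker π')) (Y := ↥(LinearMap.ker π)) t
        τ₂ := ModuleCat.ofHom (J ^ p • (⊤ : Submodule R (Fin r → R))).subtype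
        τ₃ := ModuleCat.ofHom (J ^ p • (⊤ : Submodule R X)).subtype
        comm₁₂ := rfl
        comm₂₃ := rfl }
    refine ⟨p, ?_⟩
    refine (dr_nat hS' hS φ e').trans ?_
    let V : Submodule R ↥(LinearMap.ker π) := J ^ l • (⊤ : Submodule R ↥(LinearMap.ker π))
    let t' : ↥(LinearMap.ker π') →ₗ[R] ↥V := LinearMap.codRestrict V t ht
    have : φ.τ₁ = ModuleCat.ofHom (X := ↥(LinearMap.ker π')) (Y := ↥V) t' ≫
      ModuleCat.ofHom (X := ↥V) (Y := ↥(LinearMap.ker π)) V.subtype := rfl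
    rw [this, ← pre_pre, hl, map_zero, map_zero]

lemma Tors.van [IsNoetherianRing R] {N : ModuleCat.{0} R} (hN : Tors J N) (j : ℕ) :
    Van J (j+1) N := by
  intro k e
  have hS : ∀ k, (mkSC (J ^ k).subtype (J ^ k).mkQ (LinearMap.exact_subtype_mkQ _)).ShortExact :=
    fun k => mkSC_shortExact (J ^ k).subtype (J ^ k).mkQ
    (LinearMap.exact_subtype_mkQ _) (Submodule.subtype_injective _) (Submodule.mkQ_surjective _)
  have : Projective (ModuleCat.of R R) :=
    (IsProjective.iff_projective _).mp (inferInstanceAs (Module.Projective R R))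
  obtain ⟨e', rfl⟩ := exr₃ (hS k) e (Ext.eq_zero_of_projective _)
  have : Module.Finite R (ModuleCat.of R ↥(J ^ k)) := inferInstanceAs (Module.Finite R ↥(J ^ k))
  obtain ⟨l, hl⟩ := ext_restrict hN j (ModuleCat.of R ↥(J ^ k)) e'
  refine ⟨k + l, by lia, ?_⟩
  let t : ↥(J ^ (k+l)) →ₗ[R] ↥(J ^ k) := Submodule.inclusion (Ideal.pow_le_pow_right (by lia))
  have ht : ∀ x, t x ∈ (J ^ l • (⊤ : Submodule R ↥(J ^ k))) := by
    rintro ⟨x, hx⟩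
    have h3 : x ∈ Submodule.map (J ^ k).subtype (J ^ l • ⊤) := by
      rw [Submodule.map_smul'', Submodule.map_subtype_top, smul_eq_mul, ← pow_add, add_comm]
      exact hx
    obtain ⟨y, hy, hyx⟩ := h3
    have : t ⟨x, hx⟩ = y := Subtype.ext hyx.symm
    rw [this]; exact hy
  let φ : mkSC (J ^ (k+l)).subtype (J ^ (k+l)).mkQ (LinearMap.exact_subtype_mkQ _) ⟶
      mkSC (J ^ k).subtype (J ^ k).mkQ (LinearMap.exact_subtype_mkQ _) :=
    { τ₁ := ModuleCat.ofHom t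
      τ₂ := 𝟙 _
      τ₃ := resM J (by lia) }
  refine (dr_nat (hS (k+l)) (hS k) φ e').trans ?_
  have : φ.τ₁ = ModuleCat.ofHom (LinearMap.codRestrict _ t ht) ≫
    ModuleCat.ofHom ((J ^ l • (⊤ : Submodule R ↥(J ^ k))).subtype) := rfl
  rw [this, ← pre_pre, hl, map_zero, map_zero]

end Kill
end GCM

namespace GCM

section Shift
open Abelian
variable {R : Type} [CommRing R] {ι : Type} [Fintype ι] (y : ι → R)

section Lin
variable (A : Type) [AddCommGroup A] [Module R A] {B : Type} [AddCommGroup B] [Module R B]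

/-- The product of the localizations at the `y i`. -/
abbrev CC : Type := ∀ i, LocalizedModule (Submonoid.powers (y i)) A

/-- The canonical map to the product of localizations. -/
def cc : A →ₗ[R] CC y A :=
  LinearMap.pi fun i => LocalizedModule.mkLinearMap (Submonoid.powers (y i)) A

/-- The torsion submodule. -/
abbrev GG : Submodule R A := LinearMap.ker (cc y A)
/-- The image in the product of localizations. -/
abbrev DD : Submodule R (CC y A) := LinearMap.range (cc y A)
/-- The shift. -/
abbrev SH : Type := CC y A ⧸ DD y A

variable {A}

omit [Fintype ι] in
lemma mem_GG_iff (x : A) : x ∈ GG y A ↔ ∀ i, ∃ s : ℕ, y i ^ s • x = 0 := by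
  simp only [GG, LinearMap.mem_ker, cc, funext_iff, LinearMap.pi_apply, Pi.zero_apply,
    LocalizedModule.mkLinearMap_apply]
  refine forall_congr' fun i => ?_
  rw [← LocalizedModule.zero_mk 1, LocalizedModule.mk_eq]
  constructor
  · rintro ⟨⟨_, s, rfl⟩, h⟩
    exact ⟨s, by simpa [Submonoid.smul_def] using h⟩
  · rintro ⟨s, h⟩
    exact ⟨⟨_, s, rfl⟩, by simpa [Submonoid.smul_def] using h⟩

lemma GG_tors (x : A) (hx : x ∈ GG y A) : ∃ k, ∀ a ∈ Ideal.span (Set.range y) ^ k, a • x = 0 := by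
  rw [mem_GG_iff] at hx
  have h1 : Ideal.span (Set.range y) ≤ Ideal.radical (LinearMap.ker (LinearMap.toSpanSingleton R A x)) := by
    rw [Ideal.span_le]
    rintro _ ⟨i, rfl⟩
    obtain ⟨s, hs⟩ := hx i
    exact ⟨s, by simpa using hs⟩
  obtain ⟨k, hk⟩ := Ideal.exists_pow_le_of_le_radical_of_fg h1 (Submodule.fg_span (Set.finite_range y))
  exact ⟨k, fun a ha => by simpa using hk ha⟩

/-- functoriality of the product of localizations -/
def ccMap (u : A →ₗ[R] B) : CC y A →ₗ[R] CC y B :=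
  LinearMap.pi fun i => (IsLocalizedModule.map (Submonoid.powers (y i))
    (LocalizedModule.mkLinearMap (Submonoid.powers (y i)) A)
    (LocalizedModule.mkLinearMap (Submonoid.powers (y i)) B) u).comp (LinearMap.proj i)

omit [Fintype ι] in
lemma ccMap_cc (u : A →ₗ[R] B) (x : A) : ccMap y u (cc y A x) = cc y B (u x) := by
  funext i
  exact IsLocalizedModule.map_apply _ _ _ _ _

/-- functoriality of the image -/
def ddMap (u : A →ₗ[R] B) : DD y A →ₗ[R] DD y B :=
  (ccMap y u).restrict (by rintro _ ⟨x, rfl⟩; exact ⟨u x, (ccMap_cc y u x).symm⟩)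

/-- functoriality of the shift -/
def shMap (u : A →ₗ[R] B) : SH y A →ₗ[R] SH y B :=
  Submodule.mapQ _ _ (ccMap y u) (by rintro _ ⟨x, rfl⟩; exact ⟨u x, (ccMap_cc y u x).symm⟩)

variable (A)
omit [Fintype ι] in
lemma hS1 : (mkSC (GG y A).subtype (cc y A).rangeRestrict
    (by rw [LinearMap.exact_iff, LinearMap.ker_rangeRestrict, Submodule.range_subtype])).ShortExact :=
  mkSC_shortExact _ _ _ (Submodule.subtype_injective _) (LinearMap.surjective_rangeRestrict _)

omit [Fintype ι] in
lemma hS2 : (mkSC (DD y A).subtype (DD y A).mkQ (LinearMap.exact_subtype_mkQ _)).ShortExact :=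
  mkSC_shortExact _ _ _ (Submodule.subtype_injective _) (Submodule.mkQ_surjective _)
end Lin

open Classical in
lemma cc_id (A : Type) [AddCommGroup A] [Module R A] :
    ∑ i, (ModuleCat.ofHom (LinearMap.proj i) ≫ ModuleCat.ofHom (LinearMap.single R
      (fun i => LocalizedModule (Submonoid.powers (y i)) A) i)) = 𝟙 (ModuleCat.of R (CC y A)) := by
  apply ModuleCat.hom_ext
  rw [ModuleCat.hom_sum]
  refine LinearMap.ext fun x => ?_
  rw [LinearMap.sum_apply]
  exact Finset.univ_sum_single x

lemma locInv (A : Type) [AddCommGroup A] [Module R A] (z : R) :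
    z • ModuleCat.ofHom (LocalizedModule.divBy (M := A) (⟨z, Submonoid.mem_powers z⟩ :
      Submonoid.powers z)) = 𝟙 _ := by
  apply ModuleCat.hom_ext
  refine LinearMap.ext fun x => ?_
  exact LocalizedModule.mul_by_divBy (⟨z, Submonoid.mem_powers z⟩ : Submonoid.powers z) x

lemma extCC_right (A : Type) [AddCommGroup A] [Module R A] {X : ModuleCat.{0} R} {n l : ℕ}
    (h : ∀ i, y i ^ l • 𝟙 X = 0) (e : Ext.{0} X (ModuleCat.of R (CC y A)) n) : e = 0 := by
  classical
  rw [← post_id e, ← cc_id, post_sum]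
  refine Finset.sum_eq_zero fun i _ => ?_
  rw [← post_post, ext_zero_of_inv_right (y i) l _ (locInv A (y i)) (h i) (post _ e), map_zero]

lemma extCC_left (A : Type) [AddCommGroup A] [Module R A] {X : ModuleCat.{0} R} {n l : ℕ}
    (h : ∀ i, y i ^ l • 𝟙 X = 0) (e : Ext.{0} (ModuleCat.of R (CC y A)) X n) : e = 0 := by
  classical
  rw [← pre_id e, ← cc_id, pre_sum]
  refine Finset.sum_eq_zero fun i _ => ?_
  rw [← pre_pre, ext_zero_of_inv_left (y i) l _ (locInv A (y i)) (h i) (pre _ e), map_zero]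

lemma TT_kill {J : Ideal R} (k : ℕ) {a : R} (ha : a ∈ J ^ k) : a • 𝟙 (TT J k) = 0 := by
  apply ModuleCat.hom_ext
  refine LinearMap.ext fun x => ?_
  obtain ⟨x, rfl⟩ := Submodule.Quotient.mk_surjective _ x
  change a • (Submodule.Quotient.mk x : R ⧸ J ^ k) = 0
  rw [← Submodule.Quotient.mk_smul, Submodule.Quotient.mk_eq_zero]
  exact Ideal.mul_mem_right _ _ ha

omit [Fintype ι] in
lemma TT_kill_y (k : ℕ) (i : ι) : y i ^ k • 𝟙 (TT (Ideal.span (Set.range y)) k) = 0 :=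
  TT_kill k (Ideal.pow_mem_pow (Ideal.subset_span (Set.mem_range_self i)) k)

lemma Kill.shift_aux {J : Ideal R} {a : R} {i : ℕ} {S₁ S₂ : ShortComplex (ModuleCat.{0} R)}
    (h₁ : S₁.ShortExact) (h₂ : S₂.ShortExact) (θ : S₂.X₁ ≅ S₁.X₃)
    (hΓ : Van J (i+1+1) S₁.X₁) (hC : ∀ k (e : Ext.{0} (TT J k) S₂.X₂ i), e = 0)
    (h : Kill J a (i+1) S₁.X₂) : Kill J a i S₂.X₃ := by
  intro k e
  obtain ⟨l, hl, hl'⟩ := hΓ k (dl h₁ (post θ.hom (dl h₂ e)))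
  rw [pre_dl, pre_post, pre_dl] at hl'
  obtain ⟨e'', he''⟩ := exl₃ h₁ _ hl'
  obtain ⟨p, hp, hp'⟩ := h l e''
  refine ⟨p, hl.trans hp, ?_⟩
  have h1 : dl h₂ (pre (resM _ (hl.trans hp)) (a • e)) = 0 := by
    have := congrArg (fun e => post θ.inv (post S₁.g e)) hp'
    simp only [← pre_post] at this
    rw [map_smul, he'', map_zero, map_zero, map_smul, post_post, θ.hom_inv_id, post_id] at this
    rw [← this, map_smul, map_smul, ← resM_comp _ hl hp, ← pre_pre, map_smul, pre_dl]
  obtain ⟨e3, he3⟩ := exl₃ h₂ _ h1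
  rw [← he3, hC p e3, map_zero]

lemma Kill.shift [IsNoetherianRing R] {a : R} {i : ℕ} (A : Type) [AddCommGroup A] [Module R A]
    (h : Kill (Ideal.span (Set.range y)) a (i+1) (ModuleCat.of R A)) :
    Kill (Ideal.span (Set.range y)) a i (ModuleCat.of R (SH y A)) := by
  have hT : Tors (Ideal.span (Set.range y)) (ModuleCat.of R (GG y A)) := by
    rintro ⟨x, hx⟩
    obtain ⟨k, hk⟩ := GG_tors y x hx
    exact ⟨k, fun a ha => Subtype.ext (hk a ha)⟩
  exact Kill.shift_aux (hS1 y A) (hS2 y A) (Iso.refl _) (hT.van (i+1))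
    (fun k e => extCC_right y A (fun i => TT_kill_y y k i) e) h

lemma van_iff_kill {J : Ideal R} {i : ℕ} {A : ModuleCat.{0} R} : Van J i A ↔ Kill J 1 i A := by
  simp [Van, Kill]

lemma Van.shift [IsNoetherianRing R] {i : ℕ} (A : Type) [AddCommGroup A] [Module R A]
    (h : Van (Ideal.span (Set.range y)) (i+1) (ModuleCat.of R A)) :
    Van (Ideal.span (Set.range y)) i (ModuleCat.of R (SH y A)) := by
  rw [van_iff_kill] at h ⊢
  exact h.shift y A

end Shift
end GCM

namespace GCM

section ThmT
open Abelian
variable {R : Type} [CommRing R]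

lemma Kill.zero {J : Ideal R} {a : R} {M : ModuleCat.{0} R} (h : Kill J a 0 M) (x : M) (k : ℕ)
    (hx : ∀ b ∈ J ^ k, b • x = 0) : a • x = 0 := by
  let f : TT J k ⟶ M := ModuleCat.ofHom (Submodule.liftQ (J ^ k) (LinearMap.toSpanSingleton R M x)
    (fun b hb => hx b hb))
  obtain ⟨l, hl, hl'⟩ := h k (Ext.mk₀ f)
  have h1 : Ext.mk₀ (a • (resM J hl ≫ f)) = 0 := by
    rw [Ext.mk₀_smul, ← hl', map_smul]
    simp [pre]
  have h2 : a • (resM J hl ≫ f) = 0 := (Ext.mk₀_eq_zero_iff _).mp h1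
  have h3 := congrArg (fun g : TT J l ⟶ M => g.hom (Submodule.Quotient.mk 1)) h2
  have h4 : a • ((1 : R) • x) = 0 := h3
  rwa [one_smul] at h4

lemma step_aux {S₁ S₂ : ShortComplex (ModuleCat.{0} R)} (h₁ : S₁.ShortExact) (h₂ : S₂.ShortExact)
    (φ : S₁ ⟶ S₂) {W : ModuleCat.{0} R} {j : ℕ} {b : R} (hC : ∀ w : Ext.{0} S₁.X₂ W j, w = 0)
    (hb : ∀ w : Ext.{0} S₂.X₃ W (j+1), b • pre φ.τ₃ w = 0) (w : Ext.{0} S₂.X₁ W j) :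
    b • pre φ.τ₁ w = 0 := by
  have : dr h₁ (b • pre φ.τ₁ w) = 0 := by
    rw [map_smul, ← dr_nat h₁ h₂, hb]
  obtain ⟨w', hw'⟩ := exr₁ h₁ _ this
  rw [← hw', hC w', map_zero]

lemma gamma_aux {S₁ : ShortComplex (ModuleCat.{0} R)} (h₁ : S₁.ShortExact) {a : R}
    (ha : a • S₁.f = 0) {W : ModuleCat.{0} R} {j : ℕ} (w : Ext.{0} S₁.X₂ W j) :
    ∃ w' : Ext.{0} S₁.X₃ W j, pre S₁.g w' = a • w := by
  apply exr₂ h₁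
  rw [← pre_smul_id, pre_pre]
  rw [Linear.comp_smul, Category.comp_id, ha, pre_zero]

lemma comb_aux {A M D E W : ModuleCat.{0} R} {j : ℕ} (u : A ⟶ M) (q : M ⟶ D) (p : A ⟶ E)
    (v : E ⟶ D) (h : u ≫ q = p ≫ v) (w : Ext.{0} M W j) (w' : Ext.{0} D W j) {a b : R}
    (hw : pre q w' = a • w) (hb : b • pre v w' = 0) : (b * a) • pre u w = 0 := by
  rw [mul_smul, ← map_smul, ← hw, pre_pre, h, ← pre_pre, ← map_smul, hb, map_zero]

variable [IsNoetherianRing R] {ι : Type} [Fintype ι] (y : ι → R)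

lemma tmain_zero {N : ℕ} (hN : GlDim R N) {W : ModuleCat.{0} R} {s : ℕ}
    (hW : ∀ i, y i ^ s • 𝟙 W = 0) (t : ℕ) : ∀ (A : Type) [AddCommGroup A] [Module R A]
    (_ : ∀ i, Van (Ideal.span (Set.range y)) i (ModuleCat.of R A)) (j : ℕ) (_ : N < j + t)
    (w : Ext.{0} (ModuleCat.of R A) W j), w = 0 := by
  induction t with
  | zero =>
    intro A _ _ _ j hj w
    have := hN (ModuleCat.of R A)
    exact w.eq_zero_of_hasProjectiveDimensionLT (N+1) hj
  | succ t ih =>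
    intro A _ _ hA j hj w
    have hinj : Function.Injective (cc y A) := by
      rw [injective_iff_map_eq_zero]
      intro x hx
      obtain ⟨k, hk⟩ := GG_tors y x hx
      have := (van_iff_kill.mp (hA 0)).zero x k hk
      simpa using this
    let θ : A ≃ₗ[R] DD y A := LinearEquiv.ofInjective (cc y A) hinj
    have h1 := step_aux (hS2 y A) (hS2 y A) (𝟙 _) (W := W) (j := j) (b := 1)
      (fun w => extCC_left y A hW w)
      (fun w => by
        rw [one_smul]
        exact ih (SH y A) (fun i => (hA (i+1)).shift y A) (j+1) (by lia) _)
      (pre (ModuleCat.ofHom (θ.symm : DD y A →ₗ[R] A)) w)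
    rw [one_smul] at h1
    replace h1 := (pre_id _).symm.trans h1
    have h2 : ModuleCat.ofHom (θ : A →ₗ[R] DD y A) ≫
      ModuleCat.ofHom (θ.symm : DD y A →ₗ[R] A) = 𝟙 _ := by
      apply ModuleCat.hom_ext
      refine LinearMap.ext fun x => ?_
      exact θ.symm_apply_apply x
    rw [← pre_id w, ← h2, ← pre_pre, h1, map_zero]

lemma tmain {N : ℕ} (hN : GlDim R N) {W : ModuleCat.{0} R} {s : ℕ}
    (hW : ∀ i, y i ^ s • 𝟙 W = 0) (a : R) (d : ℕ) : ∀ (A M : Type) [AddCommGroup A] [Module R A]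
    [AddCommGroup M] [Module R M] (u : A →ₗ[R] M)
    (_ : ∀ i < d, Kill (Ideal.span (Set.range y)) a i (ModuleCat.of R M))
    (_ : ∀ i, d ≤ i → Van (Ideal.span (Set.range y)) i (ModuleCat.of R A)) (j : ℕ)
    (w : Ext.{0} (ModuleCat.of R M) W j), a ^ d • pre (ModuleCat.ofHom u) w = 0 := by
  induction d with
  | zero =>
    intro A M _ _ _ _ u _ hA j w
    rw [tmain_zero y hN hW (N+1) A (fun i => hA i (Nat.zero_le _)) j (by lia) (pre _ w), smul_zero]
  | succ d ih =>
    intro A M _ _ _ _ u hM hA j w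
    have hΓ : a • ModuleCat.ofHom (GG y M).subtype = 0 := by
      apply ModuleCat.hom_ext
      refine LinearMap.ext fun x => ?_
      obtain ⟨k, hk⟩ := GG_tors y x.1 x.2
      exact (hM 0 (by lia)).zero x.1 k hk
    obtain ⟨w', hw'⟩ := gamma_aux (hS1 y M) hΓ w
    let φ : mkSC (DD y A).subtype (DD y A).mkQ (LinearMap.exact_subtype_mkQ _) ⟶
        mkSC (DD y M).subtype (DD y M).mkQ (LinearMap.exact_subtype_mkQ _) :=
      { τ₁ := ModuleCat.ofHom (ddMap y u)
        τ₂ := ModuleCat.ofHom (ccMap y u)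
        τ₃ := ModuleCat.ofHom (shMap y u)
        comm₁₂ := rfl
        comm₂₃ := rfl }
    have h1 := step_aux (hS2 y A) (hS2 y M) φ (W := W) (j := j) (b := a ^ d)
      (fun w => extCC_left y A hW w)
      (fun w => ih (SH y A) (SH y M) (shMap y u) (fun i hi => (hM (i+1) (by lia)).shift y M)
        (fun i hi => (hA (i+1) (by lia)).shift y A) (j+1) w) w'
    have h2 : ModuleCat.ofHom u ≫ ModuleCat.ofHom (cc y M).rangeRestrict =
        ModuleCat.ofHom (cc y A).rangeRestrict ≫ ModuleCat.ofHom (ddMap y u) := by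
      apply ModuleCat.hom_ext
      refine LinearMap.ext fun x => ?_
      exact Subtype.ext (ccMap_cc y u x).symm
    rw [pow_succ]
    exact comb_aux (W := W) (j := j) _ _ _ _ h2 w w' hw' h1

theorem thmT {N : ℕ} (hN : GlDim R N) {A M : Type} [AddCommGroup A] [Module R A]
    [AddCommGroup M] [Module R M] (u : A →ₗ[R] M) (d : ℕ)
    (hM : ∀ i < d, ∃ p, ∀ a ∈ Ideal.span (Set.range y) ^ p,
      Kill (Ideal.span (Set.range y)) a i (ModuleCat.of R M))
    (hA : ∀ i, d ≤ i → Van (Ideal.span (Set.range y)) i (ModuleCat.of R A))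
    (hsep : ∀ x : M, (∀ s, x ∈ Ideal.span (Set.range y) ^ s • (⊤ : Submodule R M)) → x = 0)
    (htf : ∀ x : M, (∀ a ∈ Ideal.span (Set.range y), a • x = 0) → x = 0) (x : A) : u x = 0 := by
  have htf' : ∀ k, ∀ x : M, (∀ a ∈ Ideal.span (Set.range y) ^ k, a • x = 0) → x = 0 := by
    intro k
    induction k with
    | zero => intro x hx; simpa using hx 1 (by simp)
    | succ k ih =>
      intro x hx
      apply ih
      intro a ha
      apply htf
      intro b hb
      rw [smul_smul]
      apply hx
      rw [pow_succ, mul_comm b a]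
      exact Ideal.mul_mem_mul ha hb
  have hM' : ∃ p, ∀ i < d, ∀ a ∈ Ideal.span (Set.range y) ^ p,
      Kill (Ideal.span (Set.range y)) a i (ModuleCat.of R M) := by
    choose! p hp using hM
    refine ⟨(Finset.range d).sup p, fun i hi a ha => hp i hi a ?_⟩
    exact Ideal.pow_le_pow_right (Finset.le_sup (Finset.mem_range.mpr hi)) ha
  obtain ⟨p, hp⟩ := hM'
  suffices u x ∈ GG y M by
    obtain ⟨k, hk⟩ := GG_tors y _ this
    exact htf' k _ hk
  rw [mem_GG_iff]
  intro i
  refine ⟨p * d, hsep _ fun s => ?_⟩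
  set V : Submodule R M := Ideal.span (Set.range y) ^ s • (⊤ : Submodule R M) with hV
  have hW : ∀ i, y i ^ s • 𝟙 (ModuleCat.of R (M ⧸ V)) = 0 := by
    intro i
    apply ModuleCat.hom_ext
    refine LinearMap.ext fun x => ?_
    obtain ⟨x, rfl⟩ := Submodule.Quotient.mk_surjective _ x
    change y i ^ s • (Submodule.Quotient.mk x : M ⧸ V) = 0
    rw [← Submodule.Quotient.mk_smul, Submodule.Quotient.mk_eq_zero]
    exact Submodule.smul_mem_smul (Ideal.pow_mem_pow (Ideal.subset_span (Set.mem_range_self i)) s)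
      trivial
  have := tmain y hN hW (y i ^ p) d A M u (fun j hj => hp j hj _
    (Ideal.pow_mem_pow (Ideal.subset_span (Set.mem_range_self i)) p)) hA 0
    (Ext.mk₀ (ModuleCat.ofHom V.mkQ))
  have h1 : Ext.mk₀ ((y i ^ p) ^ d • (ModuleCat.ofHom u ≫ ModuleCat.ofHom V.mkQ)) = 0 := by
    rw [Ext.mk₀_smul, ← this]
    simp [pre]
  have h2 := (Ext.mk₀_eq_zero_iff _).mp h1
  have h3 := congrArg (fun g => g.hom x) h2
  have h4 : (y i ^ p) ^ d • (Submodule.Quotient.mk (u x) : M ⧸ V) = 0 := h3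
  rw [← Submodule.Quotient.mk_smul, Submodule.Quotient.mk_eq_zero] at h4
  rwa [pow_mul]

end ThmT
end GCM

namespace GCM

section F5
open Abelian TensorProduct
variable {R : Type} [CommRing R]

lemma exists_hom_quot (B : Type) [AddCommGroup B] [Module R B] [Module.Finite R B]
    (p : PrimeSpectrum R) (hp : Module.annihilator R B ≤ p.asIdeal) :
    ∃ g : B →ₗ[R] R ⧸ p.asIdeal, g ≠ 0 := by
  have h1 : p ∈ Module.support R B := by
    rw [Module.support_eq_zeroLocus]; exact hp
  rw [Module.mem_support_iff_nontrivial_residueField_tensorProduct] at h1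
  have h2 : ∃ b : B, (1 : p.asIdeal.ResidueField) ⊗ₜ[R] b ≠ 0 := by
    by_contra! h
    obtain ⟨t, ht⟩ := exists_ne (0 : p.asIdeal.ResidueField ⊗[R] B)
    apply ht
    induction t with
    | zero => rfl
    | tmul c b =>
      have : c ⊗ₜ[R] b = c • ((1 : p.asIdeal.ResidueField) ⊗ₜ[R] b) := by
        rw [TensorProduct.smul_tmul', smul_eq_mul, mul_one]
      rw [this, h, smul_zero]
    | add x y hx hy =>
      by_cases hx0 : x = 0
      · by_cases hy0 : y = 0
        · rw [hx0, hy0, add_zero]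
        · exact absurd (hy hy0) hy0
      · exact absurd (hx hx0) hx0
  obtain ⟨b, hb⟩ := h2
  have h3 : ∃ φ : Module.Dual p.asIdeal.ResidueField (p.asIdeal.ResidueField ⊗[R] B),
      φ (1 ⊗ₜ b) ≠ 0 := by
    by_contra! h
    exact hb ((Module.forall_dual_apply_eq_zero_iff p.asIdeal.ResidueField _).mp h)
  obtain ⟨φ, hφ⟩ := h3
  let f : B →ₗ[R] p.asIdeal.ResidueField :=
    (φ.restrictScalars R).comp (TensorProduct.mk R p.asIdeal.ResidueField B 1)
  obtain ⟨s, hs⟩ := (Module.Finite.fg_top : (⊤ : Submodule R B).FG)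
  classical
  obtain ⟨c, hc⟩ := IsLocalization.exist_integer_multiples_of_finset
    (nonZeroDivisors (R ⧸ p.asIdeal)) (s.image f)
  let ι : (R ⧸ p.asIdeal) →ₗ[R] p.asIdeal.ResidueField :=
    (Algebra.linearMap (R ⧸ p.asIdeal) p.asIdeal.ResidueField).restrictScalars R
  have hι : Function.Injective ι := IsFractionRing.injective (R ⧸ p.asIdeal) p.asIdeal.ResidueField
  obtain ⟨c', hc'⟩ := Ideal.Quotient.mk_surjective (c : R ⧸ p.asIdeal)
  have hcs : ∀ z : p.asIdeal.ResidueField, c' • z = (c : R ⧸ p.asIdeal) • z := by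
    intro z
    rw [← hc', ← Ideal.Quotient.algebraMap_eq, algebraMap_smul]
  have hr : ∀ x, (c' • f) x ∈ LinearMap.range ι := by
    intro x
    have : (⊤ : Submodule R B) ≤ (LinearMap.range ι).comap (c' • f) := by
      rw [← hs, Submodule.span_le]
      intro x hx
      obtain ⟨d, hd⟩ := hc (f x) (Finset.mem_image_of_mem _ hx)
      exact ⟨d, hd.trans (hcs _).symm⟩
    exact this trivial
  refine ⟨(LinearEquiv.ofInjective ι hι).symm.toLinearMap.comp ((c' • f).codRestrict _ hr), ?_⟩
  intro h
  have h4 := LinearMap.congr_fun h b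
  simp only [LinearMap.comp_apply, LinearMap.zero_apply, LinearEquiv.coe_coe,
    LinearEquiv.map_eq_zero_iff] at h4
  have h5 : c' • f b = 0 := congrArg Subtype.val h4
  rw [hcs, Algebra.smul_def, mul_eq_zero] at h5
  rcases h5 with h5 | h5
  · have : (c : R ⧸ p.asIdeal) = 0 := (map_eq_zero_iff _ hι).mp h5
    exact nonZeroDivisors.ne_zero c.2 this
  · exact hφ h5

variable {J : Ideal R}

lemma Van.of_linearEquiv {i : ℕ} {A B : Type} [AddCommGroup A] [Module R A] [AddCommGroup B]
    [Module R B] (e : A ≃ₗ[R] B) (h : Van J i (ModuleCat.of R A)) : Van J i (ModuleCat.of R B) :=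
  h.of_iso e.toModuleIso

lemma Van.of_subsingleton {i : ℕ} {A : Type} [AddCommGroup A] [Module R A] [Subsingleton A] :
    Van J i (ModuleCat.of R A) := by
  intro k e
  refine ⟨k, le_rfl, ?_⟩
  have : 𝟙 (ModuleCat.of R A) = 0 := by
    apply ModuleCat.hom_ext
    exact Subsingleton.elim _ _
  rw [← post_id e, this, post_zero, map_zero]

variable [IsNoetherianRing R]

lemma F5_step {i : ℕ} (B : Type) [AddCommGroup B] [Module R B] [Module.Finite R B]
    (hB : Van J i (ModuleCat.of R B))
    (hi : ∀ (L : Type) [AddCommGroup L] [Module R L] [Module.Finite R L],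
      Module.annihilator R B ≤ Module.annihilator R L → Van J (i+1) (ModuleCat.of R L))
    (I : Ideal R) : Module.annihilator R B ≤ I → ∀ (L : Type) [AddCommGroup L] [Module R L]
      [Module.Finite R L], I ≤ Module.annihilator R L → Van J i (ModuleCat.of R L) := by
  induction I using (inferInstance : WellFoundedGT (Ideal R)).induction with
  | ind I IH =>
  intro hI L _ _ hL
  refine IsNoetherianRing.induction_on_isQuotientEquivQuotientPrime R (M := L) hL
    (motive := fun L _ _ _ => I ≤ Module.annihilator R L → Van J i (ModuleCat.of R L)) ?_ ?_ ?_
  · intro L _ _ _ _ _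
    exact Van.of_subsingleton
  · intro L _ _ _ p e hIL
    rw [e.annihilator_eq, Ideal.annihilator_quotient] at hIL
    refine Van.of_linearEquiv e.symm ?_
    rcases hIL.lt_or_eq with h | h
    · exact IH p.asIdeal h (hI.trans hIL) (R ⧸ p.asIdeal) Ideal.annihilator_quotient.ge
    · obtain ⟨g, hg⟩ := exists_hom_quot B p (hI.trans hIL)
      have e1 : (mkSC (LinearMap.ker g).subtype g.rangeRestrict
          (by rw [LinearMap.exact_iff, LinearMap.ker_rangeRestrict, Submodule.range_subtype])).ShortExact :=
        mkSC_shortExact _ _ _ (Submodule.subtype_injective _) (LinearMap.surjective_rangeRestrict _)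
      have e2 : (mkSC (LinearMap.range g).subtype (LinearMap.range g).mkQ
          (LinearMap.exact_subtype_mkQ _)).ShortExact :=
        mkSC_shortExact _ _ _ (Submodule.subtype_injective _) (Submodule.mkQ_surjective _)
      have v1 : Van J i (ModuleCat.of R (LinearMap.range g)) :=
        Van.of_X₂_X₁ e1 hB (hi (LinearMap.ker g)
          (LinearMap.annihilator_le_of_injective _ (Submodule.subtype_injective _)))
      refine Van.of_X₁_X₃ e2 v1 ?_
      obtain ⟨b, hb⟩ : ∃ b, g b ≠ 0 := by
        by_contra! h'
        exact hg (LinearMap.ext h')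
      obtain ⟨c, hc⟩ := Ideal.Quotient.mk_surjective (g b)
      have hcp : c ∉ p.asIdeal := by
        intro h'
        exact hb (hc ▸ Ideal.Quotient.eq_zero_iff_mem.mpr h')
      have hle : I ≤ Module.annihilator R ((R ⧸ p.asIdeal) ⧸ LinearMap.range g) := by
        refine le_trans ?_ (LinearMap.annihilator_le_of_surjective (LinearMap.range g).mkQ
          (Submodule.mkQ_surjective _))
        rw [Ideal.annihilator_quotient]; exact hIL
      refine IH _ (lt_of_le_of_ne hle ?_) (hI.trans hle) _ le_rfl
      intro h'
      apply hcp
      rw [← h, h', Module.mem_annihilator]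
      intro z
      obtain ⟨z, rfl⟩ := Submodule.Quotient.mk_surjective _ z
      rw [← Submodule.Quotient.mk_smul, Submodule.Quotient.mk_eq_zero]
      obtain ⟨z, rfl⟩ := Ideal.Quotient.mk_surjective z
      refine ⟨z • b, ?_⟩
      rw [map_smul, ← hc, Algebra.smul_def, Algebra.smul_def, Ideal.Quotient.algebraMap_eq, mul_comm]
  · intro L1 _ _ _ L2 _ _ _ L3 _ _ _ f g hf hg hfg h1 h3 h
    exact Van.of_X₁_X₃ (mkSC_shortExact f g hfg hf hg)
      (h1 (h.trans (LinearMap.annihilator_le_of_injective f hf)))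
      (h3 (h.trans (LinearMap.annihilator_le_of_surjective g hg)))

lemma F5_main {N : ℕ} (hN : GlDim R N) {c : ℕ} (B : Type) [AddCommGroup B] [Module R B]
    [Module.Finite R B] (hB : ∀ i, c < i → Van J i (ModuleCat.of R B)) (t : ℕ) :
    ∀ i, N < i + t → c < i → ∀ (L : Type) [AddCommGroup L] [Module R L] [Module.Finite R L],
      Module.annihilator R B ≤ Module.annihilator R L → Van J i (ModuleCat.of R L) := by
  induction t with
  | zero => intro i hi _ L _ _ _ _; exact Van.of_glDim hN hi
  | succ t ih =>
    intro i hi hc L _ _ _ h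
    exact F5_step B (hB i hc) (fun L _ _ _ h => ih (i+1) (by lia) (by lia) L h) _ le_rfl L h

lemma F5 {N : ℕ} (hN : GlDim R N) {c : ℕ} (B : Type) [AddCommGroup B] [Module R B]
    [Module.Finite R B] (hB : ∀ i, c < i → Van J i (ModuleCat.of R B))
    (L : Type) [AddCommGroup L] [Module R L] [Module.Finite R L]
    (h : Module.annihilator R B ≤ Module.annihilator R L) (i : ℕ) (hi : c < i) :
    Van J i (ModuleCat.of R L) :=
  F5_main hN B hB (N + 1) i (by lia) hi L h

end F5
end GCM

namespace GCM

section Trans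
open Limits Opposite
variable {R : Type} [CommRing R] (J : Ideal R) (i : ℕ) (A : ModuleCat.{0} R)

/-- The old Ext. -/
abbrev OE (k : ℕ) : ModuleCat.{0} R := ((Ext R (ModuleCat.{0} R) i).obj (op (TT J k))).obj A

/-- evaluated transition map -/
abbrev oeMap {k l : ℕ} (h : k ≤ l) : OE J i A k ⟶ OE J i A l :=
  ((Ext R (ModuleCat.{0} R) i).map (resM J h).op).app A

lemma lc_pack : ∃ (f : ∀ k, OE J i A k ⟶ (localCohomology J i).obj A),
    (∀ h, ∃ k e, f k e = h) ∧
    (∀ k e, f k e = 0 ↔ ∃ (l : ℕ) (hl : k ≤ l), oeMap J i A hl e = 0) := by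
  let D := localCohomology.diagram (localCohomology.idealPowersDiagram J) i
  have hD : HasColimit D := inferInstance
  let hc := isColimitOfPreserves ((evaluation _ (ModuleCat.{0} R)).obj A) (colimit.isColimit D)
  refine ⟨fun k => (((evaluation _ (ModuleCat.{0} R)).obj A).mapCocone (colimit.cocone D)).ι.app
    (op (op k)), ?_, ?_⟩
  · intro h
    obtain ⟨k, e, he⟩ := Concrete.isColimit_exists_rep _ hc h
    exact ⟨k.unop.unop, e, he⟩
  · intro k e
    have := Concrete.isColimit_rep_eq_iff_exists _ hc (i := op (op k)) (j := op (op k)) e 0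
    rw [map_zero] at this
    refine this.trans ?_
    constructor
    · rintro ⟨l, f, g, h⟩
      refine ⟨l.unop.unop, leOfHom f.unop.unop, ?_⟩
      rw [map_zero] at h
      exact h
    · rintro ⟨l, hl, h⟩
      refine ⟨op (op l), (homOfLE hl).op.op, (homOfLE hl).op.op, ?_⟩
      rw [map_zero]
      exact h

variable {J i A}

lemma Cor.ev {k : ℕ} {e : OE J i A k} {e' : Abelian.Ext.{0} (TT J k) A i} (h : Cor e e') :
    (∃ (l : ℕ) (hl : k ≤ l), oeMap J i A hl e = 0) ↔ Ev e' := by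
  refine exists_congr fun l => exists_congr fun hl => ?_
  exact (h.map (resM J hl)).eq_zero_iff

lemma van_iff : Van J i A ↔ Subsingleton ((localCohomology J i).obj A) := by
  obtain ⟨f, hf1, hf2⟩ := lc_pack J i A
  constructor
  · intro h
    refine subsingleton_of_forall_eq 0 fun x => ?_
    obtain ⟨k, e, rfl⟩ := hf1 x
    obtain ⟨e', he'⟩ := Cor.exists_new e
    rw [hf2, he'.ev]
    exact h k e'
  · intro h k e'
    obtain ⟨e, he⟩ := Cor.exists_old e'
    rw [← he.ev, ← hf2]
    exact Subsingleton.elim _ _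

lemma kill_of_finite (h : Module.Finite R ((localCohomology J i).obj A)) :
    ∃ p, ∀ a ∈ J ^ p, Kill J a i A := by
  obtain ⟨f, hf1, hf2⟩ := lc_pack J i A
  obtain ⟨s, hs⟩ := h.fg_top
  choose κ e he using hf1
  have hkill : ∀ x, ∀ a ∈ J ^ (κ x), a • x = 0 := by
    intro x a ha
    obtain ⟨e', he'⟩ := Cor.exists_new (e x)
    have h1 : a • e' = 0 := by rw [← pre_smul_id, TT_kill _ ha, pre_zero]
    have h2 : a • e x = 0 := (he'.smul a).eq_zero_iff.mpr h1
    calc a • x = a • f (κ x) (e x) := by rw [he]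
      _ = f (κ x) (a • e x) := (map_smul (f (κ x)).hom a (e x)).symm
      _ = 0 := by rw [h2, map_zero]
  refine ⟨s.sup κ, fun a ha => ?_⟩
  have hall : ∀ x : (localCohomology J i).obj A, a • x = 0 := by
    intro x
    have : (⊤ : Submodule R ((localCohomology J i).obj A)) ≤
        LinearMap.ker (a • (LinearMap.id : ((localCohomology J i).obj A) →ₗ[R] _)) := by
      rw [← hs, Submodule.span_le]
      intro x hx
      exact hkill x a (Ideal.pow_le_pow_right (Finset.le_sup hx) ha)
    exact this (Submodule.mem_top : x ∈ ⊤)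
  intro k e'
  obtain ⟨e0, he0⟩ := Cor.exists_old e'
  rw [← (he0.smul a).ev, ← hf2]
  exact (map_smul (f k).hom a e0).trans (hall _)

end Trans
end GCM

namespace GCM

section Dims
variable {R : Type} [CommRing R] {J : Ideal R}

lemma van_iff_not {i : ℕ} {A : Type} [AddCommGroup A] [Module R A] :
    Van J i (ModuleCat.of R A) ↔ ¬ Nontrivial ((localCohomology J i).obj (ModuleCat.of R A)) := by
  rw [van_iff, not_nontrivial_iff_subsingleton]

lemma van_of_cohDim_lt {N : ℕ} (hN : GlDim R N) {A : Type} [AddCommGroup A] [Module R A] {i : ℕ}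
    (h : cohDim R J A < i) : Van J i (ModuleCat.of R A) := by
  rw [van_iff_not]
  intro hi
  refine absurd (le_csSup ⟨N, ?_⟩ hi) (not_le.mpr h)
  intro j hj
  by_contra hlt
  exact (van_iff_not.mp (Van.of_glDim hN (not_le.mp hlt))) hj

lemma cohDim_le {A : Type} [AddCommGroup A] [Module R A] {c : ℕ}
    (h : ∀ i, c < i → Van J i (ModuleCat.of R A)) : cohDim R J A ≤ c := by
  apply csSup_le'
  intro j hj
  by_contra hlt
  exact (van_iff_not.mp (h j (not_le.mp hlt))) hj

lemma cohDim_congr {A B : Type} [AddCommGroup A] [Module R A] [AddCommGroup B] [Module R B]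
    (e : A ≃ₗ[R] B) : cohDim R J A = cohDim R J B := by
  unfold cohDim
  congr 1
  ext i
  exact ((localCohomology J i).mapIso e.toModuleIso).toLinearEquiv.toEquiv.nontrivial_congr

lemma extGrade_congr {A B : Type} [AddCommGroup A] [Module R A] [AddCommGroup B] [Module R B]
    (e : A ≃ₗ[R] B) : extGrade R J A = extGrade R J B := by
  unfold extGrade
  congr 1
  ext i
  exact (((Ext R (ModuleCat R) i).obj (Opposite.op (ModuleCat.of R (R ⧸ J)))).mapIso
    e.toModuleIso).toLinearEquiv.toEquiv.nontrivial_congr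

lemma isCMWrt_congr {A B : Type} [AddCommGroup A] [Module R A] [AddCommGroup B] [Module R B]
    (e : A ≃ₗ[R] B) : IsCMWrt R J A ↔ IsCMWrt R J B := by
  unfold IsCMWrt
  rw [cohDim_congr e, extGrade_congr e]

lemma cohDim_mono [IsNoetherianRing R] {N : ℕ} (hN : GlDim R N) (B L : Type) [AddCommGroup B]
    [Module R B] [Module.Finite R B] [AddCommGroup L] [Module R L] [Module.Finite R L]
    (h : Module.annihilator R B ≤ Module.annihilator R L) : cohDim R J L ≤ cohDim R J B :=
  cohDim_le (F5 hN B (fun _ hi => van_of_cohDim_lt hN hi) L h)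

lemma subsingleton_of_lt [IsNoetherianRing R] {N : ℕ} (hN : GlDim R N) {ι : Type} [Fintype ι]
    (y : ι → R) (hJ : J = Ideal.span (Set.range y)) {A M : Type} [AddCommGroup A] [Module R A]
    [AddCommGroup M] [Module R M] (hgen : IsGenCMWrt R J M)
    (hsep : ∀ x : M, (∀ s, x ∈ J ^ s • (⊤ : Submodule R M)) → x = 0)
    (htf : ∀ x : M, (∀ a ∈ J, a • x = 0) → x = 0) (u : A →ₗ[R] M) (hu : Function.Injective u)
    (h : cohDim R J A < cohDim R J M) : Subsingleton A := by
  subst hJ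
  have := thmT y hN u (cohDim R (Ideal.span (Set.range y)) A + 1)
    (fun i hi => kill_of_finite (hgen i (by lia)))
    (fun i hi => van_of_cohDim_lt hN hi) hsep htf
  exact subsingleton_of_forall_eq 0 fun x => hu ((this x).trans (map_zero u).symm)

lemma tf_of_extGrade {M : Type} [AddCommGroup M] [Module R M] (h : 0 < extGrade R J M) (x : M)
    (hx : ∀ a ∈ J, a • x = 0) : x = 0 := by
  have h0 := Nat.notMem_of_lt_sInf h
  rw [Set.mem_ofPred_eq, not_nontrivial_iff_subsingleton] at h0
  let f : ModuleCat.of R (R ⧸ J) ⟶ ModuleCat.of R M :=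
    ModuleCat.ofHom (Submodule.liftQ J (LinearMap.toSpanSingleton R M x) (fun b hb => hx b hb))
  obtain ⟨e, he⟩ := Cor.exists_old (Abelian.Ext.mk₀ f)
  have h1 := he.eq_zero_iff.mp (Subsingleton.elim _ _)
  have h2 := (Abelian.Ext.mk₀_eq_zero_iff _).mp h1
  have h3 : (1 : R) • x = 0 :=
    congrArg (fun g : ModuleCat.of R (R ⧸ J) ⟶ ModuleCat.of R M => g.hom (Submodule.Quotient.mk 1)) h2
  rwa [one_smul] at h3

lemma nontrivial_of_extGrade {M : Type} [AddCommGroup M] [Module R M] (h : 0 < extGrade R J M) :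
    Nontrivial M := by
  by_contra hM
  rw [not_nontrivial_iff_subsingleton] at hM
  obtain ⟨i, hi⟩ := Nat.nonempty_of_pos_sInf h
  rw [Set.mem_ofPred_eq] at hi
  obtain ⟨e, he⟩ := exists_ne (0 : ((Ext R (ModuleCat R) i).obj
    (Opposite.op (ModuleCat.of R (R ⧸ J)))).obj (ModuleCat.of R M))
  apply he
  obtain ⟨e', he'⟩ := Cor.exists_new e
  rw [he'.eq_zero_iff]
  have : 𝟙 (ModuleCat.of R M) = 0 := by
    apply ModuleCat.hom_ext
    exact Subsingleton.elim _ _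
  rw [← post_id e', this, post_zero]

lemma cohDim_ass [IsNoetherianRing R] {N : ℕ} (hN : GlDim R N) {ι : Type} [Fintype ι]
    (y : ι → R) (hJ : J = Ideal.span (Set.range y)) {M : Type}
    [AddCommGroup M] [Module R M] [Module.Finite R M] (hgen : IsGenCMWrt R J M)
    (hsep : ∀ x : M, (∀ s, x ∈ J ^ s • (⊤ : Submodule R M)) → x = 0)
    (htf : ∀ x : M, (∀ a ∈ J, a • x = 0) → x = 0) (p : Ideal R) (hp : p ∈ associatedPrimes R M) :
    cohDim R J (R ⧸ p) = cohDim R J M := by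
  obtain ⟨h1, f, hf⟩ := (isAssociatedPrime_iff_exists_injective_linearMap p M).mp hp
  refine le_antisymm (cohDim_mono hN M (R ⧸ p) (LinearMap.annihilator_le_of_injective f hf)) ?_
  by_contra hlt
  have := subsingleton_of_lt hN y hJ hgen hsep htf f hf (not_le.mp hlt)
  exact h1.ne_top (Ideal.Quotient.subsingleton_iff.mp this)

lemma mCohDim_eq [IsNoetherianRing R] {N : ℕ} (hN : GlDim R N) {ι : Type} [Fintype ι]
    (y : ι → R) (hJ : J = Ideal.span (Set.range y)) {M : Type}
    [AddCommGroup M] [Module R M] [Module.Finite R M] [Nontrivial M] (hgen : IsGenCMWrt R J M)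
    (hsep : ∀ x : M, (∀ s, x ∈ J ^ s • (⊤ : Submodule R M)) → x = 0)
    (htf : ∀ x : M, (∀ a ∈ J, a • x = 0) → x = 0) : mCohDim R J M = cohDim R J M := by
  have h := fun p hp => cohDim_ass hN y hJ hgen hsep htf p hp
  unfold mCohDim
  rw [Set.image_congr h, (associatedPrimes.nonempty R M).image_const, csInf_singleton]
end Dims

section Graded
variable {K : Type} [Field K] {m n : ℕ} {M : Type} [AddCommGroup M] [Module (BGS K m n) M]
  {ℳ : ℕ × ℕ → AddSubgroup M}

lemma top_le_span (hM : IsBigrading K m n M ℳ) :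
    (⊤ : Submodule (BGS K m n) M) = Submodule.span (BGS K m n) {x : M | ∃ d, x ∈ ℳ d} := by
  refine le_antisymm ?_ le_top
  intro x _
  obtain ⟨z, rfl⟩ := hM.internal.2 x
  induction z using DirectSum.induction_on with
  | zero => rw [map_zero]; exact Submodule.zero_mem _
  | of d z =>
    rw [DirectSum.coeAddMonoidHom_of]
    exact Submodule.subset_span ⟨d, z.2⟩
  | add z w hz hw => rw [map_add]; exact Submodule.add_mem _ (hz trivial) (hw trivial)

lemma pow_smul_le (hM : IsBigrading K m n M ℳ) (s : ℕ) :
    idealQ K m n ^ s • (⊤ : Submodule (BGS K m n) M) ≤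
      Submodule.span (BGS K m n) {x : M | ∃ d : ℕ × ℕ, s ≤ d.2 ∧ x ∈ ℳ d} := by
  induction s with
  | zero =>
    refine le_top.trans ?_
    rw [top_le_span hM]
    exact Submodule.span_mono fun x ⟨d, hd⟩ => ⟨d, Nat.zero_le _, hd⟩
  | succ s ih =>
    rw [pow_succ', Submodule.mul_smul]
    refine (Submodule.smul_mono le_rfl ih).trans ?_
    rw [idealQ, Submodule.span_smul_span, Submodule.span_le]
    rintro _ ⟨_, ⟨j, rfl⟩, x, ⟨d, hd, hx⟩, rfl⟩
    refine Submodule.subset_span ⟨bwt m n (Sum.inr j) + d, ?_, ?_⟩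
    · simp [bwt]; lia
    · exact hM.smul_mem _ _ _ _ (isWeightedHomogeneous_X K (bwt m n) (Sum.inr j)) hx

lemma sep (hM : IsBigrading K m n M ℳ) (x : M)
    (hx : ∀ s, x ∈ idealQ K m n ^ s • (⊤ : Submodule (BGS K m n) M)) : x = 0 := by
  let e : (DirectSum (ℕ × ℕ) fun d => ℳ d) ≃+ M :=
    AddEquiv.ofBijective (DirectSum.coeAddMonoidHom ℳ) hM.internal
  have hof : ∀ (d : ℕ × ℕ) (x : M) (hx : x ∈ ℳ d), e.symm x = DirectSum.of (fun d => ℳ d) d ⟨x, hx⟩ := by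
    intro d x hx
    rw [AddEquiv.symm_apply_eq]
    exact (DirectSum.coeAddMonoidHom_of ℳ d ⟨x, hx⟩).symm
  have key : ∀ s, ∀ x ∈ Submodule.span (BGS K m n) {x : M | ∃ d : ℕ × ℕ, s ≤ d.2 ∧ x ∈ ℳ d},
      ∀ d : ℕ × ℕ, d.2 < s → e.symm x d = 0 := by
    intro s x hx d hd
    induction hx using Submodule.closure_induction with
    | zero => simp
    | add x y _ _ h1 h2 => rw [map_add, DirectSum.add_apply, h1, h2, add_zero]
    | smul_mem r x hx =>
      obtain ⟨d', hd', hx⟩ := hx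
      induction r using MvPolynomial.induction_on' with
      | monomial u a =>
        have h1 := hM.smul_mem _ d' _ x (isWeightedHomogeneous_monomial (bwt m n) u a rfl) hx
        rw [hof _ _ h1]
        apply DirectSum.of_eq_of_ne
        rintro rfl
        simp at hd
        lia
      | add p q h1 h2 => rw [add_smul, map_add, DirectSum.add_apply, h1, h2, add_zero]
  rw [← AddEquiv.map_eq_zero_iff e.symm]
  refine DFinsupp.ext fun d => ?_
  exact key (d.2 + 1) x (pow_smul_le hM _ (hx _)) d (Nat.lt_succ_self _)

end Graded
end GCM

theorem genCM_maximalDepth_iff_seqCM_iff_CM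
    (K : Type) [Field K] [Infinite K] (m n : ℕ)
    (M : Type) [AddCommGroup M] [Module (BGS K m n) M] [Module.Finite (BGS K m n) M]
    (ℳ : ℕ × ℕ → AddSubgroup M) (hM : IsBigrading K m n M ℳ)
    (hgen : IsGenCMWrt (BGS K m n) (idealQ K m n) M)
    (hg : 0 < extGrade (BGS K m n) (idealQ K m n) M) :
    (HasMaximalDepth (BGS K m n) (idealQ K m n) M ↔ IsSeqCMWrtQ K m n M ℳ) ∧
    (IsSeqCMWrtQ K m n M ℳ ↔ IsCMWrt (BGS K m n) (idealQ K m n) M) := by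
  have hN := GCM.glDim_BGS K m n
  have hsep := GCM.sep hM
  have htf := GCM.tf_of_extGrade hg
  have hnt : Nontrivial M := GCM.nontrivial_of_extGrade hg
  have hJ : idealQ K m n =
    Ideal.span (Set.range fun j : Fin n => (X (Sum.inr j) : BGS K m n)) := rfl
  have hac : HasMaximalDepth (BGS K m n) (idealQ K m n) M ↔
      IsCMWrt (BGS K m n) (idealQ K m n) M := by
    unfold HasMaximalDepth IsCMWrt
    rw [GCM.mCohDim_eq hN _ hJ hgen hsep htf]
  have hbc : IsSeqCMWrtQ K m n M ℳ ↔ IsCMWrt (BGS K m n) (idealQ K m n) M := by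
    constructor
    · rintro ⟨r, F, hF, h0, h1, -, hCM, hlt⟩
      match r, F, hF, h0, h1, hCM, hlt with
      | 0, F, hF, h0, h1, hCM, hlt =>
        exact absurd (h0.symm.trans h1) bot_ne_top
      | 1, F, hF, h0, h1, hCM, hlt =>
        have h2 := hCM 0
        have e1 := Submodule.quotEquivOfEqBot (Submodule.comap (F (Fin.succ (0 : Fin 1))).subtype
          (F (Fin.castSucc (0 : Fin 1)))) (by
            rw [show F (Fin.castSucc (0 : Fin 1)) = ⊥ from h0, Submodule.comap_bot,
              Submodule.ker_subtype])
        have e2 := LinearEquiv.ofTop (F (Fin.succ (0 : Fin 1))) h1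
        exact (GCM.isCMWrt_congr (e1.trans e2)).mp h2
      | r + 2, F, hF, h0, h1, hCM, hlt =>
        exfalso
        have h2 := hlt 0 (Fin.last (r + 1)) (Fin.last_pos)
        have h3 := GCM.cohDim_mono (J := idealQ K m n) hN M
          (↥(F (Fin.last (r + 1)).succ) ⧸ (Submodule.comap (F (Fin.last (r + 1)).succ).subtype
            (F (Fin.last (r + 1)).castSucc)))
          ((LinearMap.annihilator_le_of_injective _ (Submodule.subtype_injective _)).trans
            (LinearMap.annihilator_le_of_surjective _ (Submodule.mkQ_surjective _)))
        have e1 := Submodule.quotEquivOfEqBot (Submodule.comap (F (Fin.succ (0 : Fin (r + 2)))).subtype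
          (F (Fin.castSucc (0 : Fin (r + 2))))) (by
            rw [show F (Fin.castSucc (0 : Fin (r + 2))) = ⊥ from h0, Submodule.comap_bot,
              Submodule.ker_subtype])
        have h4 := GCM.subsingleton_of_lt hN _ hJ hgen hsep htf
          ((F (Fin.succ (0 : Fin (r + 2)))).subtype.comp e1.toLinearMap)
          ((Submodule.subtype_injective _).comp e1.injective) (h2.trans_le h3)
        have h5 : Subsingleton (F (Fin.succ (0 : Fin (r + 2)))) := e1.symm.toEquiv.subsingleton
        have h6 := (Submodule.subsingleton_iff_eq_bot).mp h5
        have h7 : F 0 < F (Fin.succ (0 : Fin (r + 2))) := hF (Fin.succ_pos _)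
        rw [h0, h6] at h7
        exact lt_irrefl _ h7
    · intro h
      refine ⟨1, ![⊥, ⊤], ?_, rfl, rfl, ?_, ?_, ?_⟩
      · rw [Fin.strictMono_iff_lt_succ]
        intro i
        fin_cases i
        exact bot_lt_top
      · intro i
        fin_cases i
        · refine le_antisymm bot_le ?_
          exact Submodule.span_le.mpr fun x hx => hx.1
        · refine (GCM.top_le_span hM).trans ?_
          refine congrArg _ (Set.ext fun x => ?_)
          exact ⟨fun hx => ⟨trivial, hx⟩, fun hx => hx.2⟩
      · intro i
        fin_cases i
        have e1 := Submodule.quotEquivOfEqBot (Submodule.comap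
          (⊤ : Submodule (BGS K m n) M).subtype ⊥) (by
            rw [Submodule.comap_bot, Submodule.ker_subtype])
        exact (GCM.isCMWrt_congr (e1.trans Submodule.topEquiv)).mpr h
      · intro i j hij
        exact absurd hij (by rw [Subsingleton.elim i j]; exact lt_irrefl _)
  exact ⟨hac.trans hbc.symm, hbc⟩
end
end
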